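/- arXiv:2302.03966 — 2 statements merged into one kernel-verified Lean document; each statement's English description precedes it below -/
import Mathlib

section
/- Given an integer k ≥ 4 and positive constants δ, γ with δ > 2/k and γ ≤ δ/2, there exist α, ξ > 0 such that the following holds for all sufficiently large n: if G = (V₁, …, V_k, E) is a spanning subgraph of the n-blow-up of C_k with δ̄(G) ≥ δn and α*_b(G) < αn, then there exists a ξ-absorbing set R ⊆ V(G) of size at most γn. -/
/-- `A` has a transversal `C_k`-factor in `G`: there are pairwise vertex-disjoint transversal
copies of `C_k` (each copy `c j` winding through the parts, one vertex per part) whose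
vertices cover `A` exactly. -/
def HasTransversalCkFactorOn {k n : ℕ} (G : SimpleGraph (ZMod k × Fin n))
    (A : Set (ZMod k × Fin n)) : Prop :=
  ∃ (m : ℕ) (c : Fin m → ZMod k → Fin n),
    (∀ (j : Fin m) (i : ZMod k), G.Adj (i, c j i) (i + 1, c j (i + 1))) ∧
    (∀ i : ZMod k, Function.Injective fun j => c j i) ∧
    (∀ i : ZMod k, Set.range (fun j => c j i) = {a : Fin n | (i, a) ∈ A})

/-! ## Basic notions: cycles, the monoid of tilings, paths -/

namespace Abs

open Finset

variable {k n : ℕ}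

/-- a transversal cycle -/
def IsCyc (A : ZMod k → Fin n → Fin n → Prop) (c : ZMod k → Fin n) : Prop :=
  ∀ i, A i (c i) (c (i + 1))

/-- the vertex multiset of a transversal tuple -/
noncomputable def tr [NeZero k] (c : ZMod k → Fin n) : Multiset (ZMod k × Fin n) :=
  ∑ i : ZMod k, {(i, c i)}

/-- the multisets that are sums of transversal cycles -/
noncomputable def F [NeZero k] (A : ZMod k → Fin n → Fin n → Prop) :
    AddSubmonoid (Multiset (ZMod k × Fin n)) :=
  AddSubmonoid.closure {m | ∃ c, IsCyc A c ∧ m = tr c}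

/-- no bipartite holes of size `a` -/
def Hole (A : ZMod k → Fin n → Fin n → Prop) (a : ℕ) : Prop :=
  ∀ (i : ZMod k) (S T : Finset (Fin n)), a ≤ S.card → a ≤ T.card → ∃ p ∈ S, ∃ q ∈ T, A i p q

open Classical in
/-- neighbours in the next part -/
noncomputable def outN (A : ZMod k → Fin n → Fin n → Prop) (i : ZMod k) (p : Fin n) :
    Finset (Fin n) := univ.filter (fun q => A i p q)

open Classical in
/-- neighbours in the previous part -/
noncomputable def inN (A : ZMod k → Fin n → Fin n → Prop) (i : ZMod k) (p : Fin n) :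
    Finset (Fin n) := univ.filter (fun q => A (i - 1) q p)

/-- vertices of a sequence starting in part `i` -/
noncomputable def sq (i : ZMod k) (w : ℕ → Fin n) (m : ℕ) : Multiset (ZMod k × Fin n) :=
  ∑ j ∈ range m, {(i + (j : ZMod k), w j)}

/-- the sequence is a path -/
def Pth (A : ZMod k → Fin n → Fin n → Prop) (i : ZMod k) (w : ℕ → Fin n) (m : ℕ) : Prop :=
  ∀ j : ℕ, j + 1 < m → A (i + (j : ZMod k)) (w j) (w (j + 1))

lemma sq_cons (i : ZMod k) (w : ℕ → Fin n) (m : ℕ) :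
    sq i w (m + 1) = {(i, w 0)} + sq (i + 1) (fun j => w (j + 1)) m := by
  unfold sq
  rw [Finset.sum_range_succ', add_comm]
  congr 1
  · simp
  · apply Finset.sum_congr rfl
    intro j _
    push_cast
    rw [show i + ((j : ZMod k) + 1) = i + 1 + j by ring]

lemma sq_snoc (i : ZMod k) (w : ℕ → Fin n) (m : ℕ) :
    sq i w (m + 1) = sq i w m + {(i + (m : ZMod k), w m)} := by
  unfold sq
  rw [Finset.sum_range_succ]

lemma mem_sq {i : ZMod k} {w : ℕ → Fin n} {m : ℕ} {v : ZMod k × Fin n} :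
    v ∈ sq i w m ↔ ∃ j < m, v = (i + (j : ZMod k), w j) := by
  unfold sq
  simp [Multiset.mem_sum]

lemma card_sq (i : ZMod k) (w : ℕ → Fin n) (m : ℕ) : (sq i w m).card = m := by
  unfold sq
  simp

lemma cast_inj' {a b : ℕ} (ha : a < k) (hb : b < k) (h : (a : ZMod k) = b) : a = b := by
  rw [ZMod.natCast_eq_natCast_iff'] at h
  rwa [Nat.mod_eq_of_lt ha, Nat.mod_eq_of_lt hb] at h

lemma nodup_sq (i : ZMod k) (w : ℕ → Fin n) (m : ℕ) (hm : m ≤ k) : (sq i w m).Nodup := by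
  induction m with
  | zero => simp [sq]
  | succ m ih =>
    rw [sq_snoc, Multiset.nodup_add]
    refine ⟨ih (by omega), by simp, ?_⟩
    rw [Multiset.disjoint_singleton]
    rw [mem_sq]
    rintro ⟨j, hj, h⟩
    have h1 := congrArg Prod.fst h
    simp only [add_right_inj] at h1
    have := cast_inj' (by omega) (by omega) h1
    omega

lemma sq_mem_F [NeZero k] (A : ZMod k → Fin n → Fin n → Prop) (i : ZMod k) (w : ℕ → Fin n)
    (hp : Pth A i w k) (hc : A (i - 1) (w (k - 1)) (w 0)) : sq i w k ∈ F A := by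
  have hk0 : 0 < k := Nat.pos_of_ne_zero (NeZero.ne k)
  apply AddSubmonoid.subset_closure
  have key : ∀ j < k, ∀ x : ZMod k, x = i + (j : ZMod k) → (x - i).val = j := by
    intro j hj x hx
    subst hx
    rw [add_sub_cancel_left, ZMod.val_natCast, Nat.mod_eq_of_lt hj]
  refine ⟨fun x => w ((x - i).val), ?_, ?_⟩
  · intro x
    obtain ⟨j, hj, hx⟩ : ∃ j < k, x = i + (j : ZMod k) :=
      ⟨(x - i).val, ZMod.val_lt _, by simp⟩
    simp only
    rw [key j hj x hx]
    by_cases h : j + 1 < k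
    · rw [key (j + 1) h (x + 1) (by rw [hx]; push_cast; ring), hx]
      exact hp j h
    · have hj' : j = k - 1 := by omega
      have hx1 : x = i - 1 := by
        rw [hx, hj', Nat.cast_sub (by omega)]; simp; ring
      rw [key 0 hk0 (x + 1) (by rw [hx1]; simp), hj', hx1]
      exact hc
  · unfold sq tr
    refine Finset.sum_bij' (fun j _ => i + (j : ZMod k)) (fun x _ => (x - i).val) ?_ ?_ ?_ ?_ ?_
    · simp
    · intro x _; simpa using ZMod.val_lt _
    · intro j hj; exact key j (by simpa using hj) _ rfl
    · intro x _; simp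
    · intro j hj
      simp only
      rw [key j (by simpa using hj) _ rfl]

lemma hole_out {A : ZMod k → Fin n → Fin n → Prop} {a : ℕ} (hA : Hole A a) (i : ZMod k)
    (Q T : Finset (Fin n)) (hT : a ≤ T.card) [DecidablePred fun q => ∃ t ∈ T, A i q t] :
    Q.card ≤ (Q.filter (fun q => ∃ t ∈ T, A i q t)).card + a := by
  by_contra h
  push Not at h
  have h1 := Finset.card_filter_add_card_filter_not (s := Q) (fun q => ∃ t ∈ T, A i q t)
  obtain ⟨p, hp, q, hq, hpq⟩ := hA i (Q.filter (fun q => ¬ ∃ t ∈ T, A i q t)) T (by omega) hT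
  exact (Finset.mem_filter.1 hp).2 ⟨q, hq, hpq⟩

lemma hole_in {A : ZMod k → Fin n → Fin n → Prop} {a : ℕ} (hA : Hole A a) (i : ZMod k)
    (Q T : Finset (Fin n)) (hT : a ≤ T.card) [DecidablePred fun q => ∃ t ∈ T, A i t q] :
    Q.card ≤ (Q.filter (fun q => ∃ t ∈ T, A i t q)).card + a := by
  by_contra h
  push Not at h
  have h1 := Finset.card_filter_add_card_filter_not (s := Q) (fun q => ∃ t ∈ T, A i t q)
  obtain ⟨p, hp, q, hq, hpq⟩ := hA i T (Q.filter (fun q => ¬ ∃ t ∈ T, A i t q)) hT (by omega)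
  exact (Finset.mem_filter.1 hq).2 ⟨p, hp, hpq⟩

lemma exists_path {A : ZMod k → Fin n → Fin n → Prop} {a : ℕ} (hA : Hole A a) (i : ZMod k)
    (Q : ℕ → Finset (Fin n)) (m : ℕ) (hQ : ∀ j < m + 1, 2 * a + 1 ≤ (Q j).card) :
    ∃ w : ℕ → Fin n, (∀ j < m + 1, w j ∈ Q j) ∧ Pth A i w (m + 1) := by
  classical
  suffices H : a + 1 ≤ ((Q m).filter (fun v => ∃ w : ℕ → Fin n, (∀ j < m + 1, w j ∈ Q j) ∧
      Pth A i w (m + 1) ∧ w m = v)).card by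
    obtain ⟨v, hv⟩ := Finset.card_pos.1 (lt_of_lt_of_le (Nat.succ_pos a) H)
    obtain ⟨-, w, h1, h2, -⟩ := Finset.mem_filter.1 hv
    exact ⟨w, h1, h2⟩
  induction m with
  | zero =>
    refine le_trans ?_ (Finset.card_le_card (s := Q 0) ?_)
    · have := hQ 0 (by omega); omega
    · intro v hv
      simp only [Finset.mem_filter]
      refine ⟨hv, fun _ => v, ?_, ?_, rfl⟩
      · intro j hj
        have : j = 0 := by omega
        rw [this]; exact hv
      · intro j hj; omega
  | succ m ih =>
    have ih := ih (fun j hj => hQ j (by omega))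
    have h1 := hole_in hA (i + (m : ZMod k)) (Q (m + 1))
      ((Q m).filter (fun v => ∃ w : ℕ → Fin n, (∀ j < m + 1, w j ∈ Q j) ∧
      Pth A i w (m + 1) ∧ w m = v)) (by omega)
    have h2 := hQ (m + 1) (by omega)
    have h3 : a + 1 + a ≤ (Q (m + 1)).card := by omega
    refine le_trans (Nat.le_of_add_le_add_right (h3.trans h1)) (Finset.card_le_card ?_)
    · intro v hv
      obtain ⟨hv, t, ht, htv⟩ := Finset.mem_filter.1 hv
      obtain ⟨-, w, hw1, hw2, hw3⟩ := Finset.mem_filter.1 ht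
      refine Finset.mem_filter.2 ⟨hv, fun j => if j = m + 1 then v else w j, ?_, ?_, by simp⟩
      · intro j hj
        by_cases h : j = m + 1
        · simp [h, hv]
        · simp only [h, if_false]; exact hw1 j (by omega)
      · intro j hj
        by_cases h : j = m
        · subst h; simp; rw [hw3]; exact htv
        · have h3 : j ≠ m + 1 := by omega
          simp only [h3, if_false, add_left_inj, h]
          exact hw2 j (by omega)

lemma card_avoid (W : Finset (ZMod k × Fin n)) (i : ZMod k) (T : Finset (Fin n))
    [DecidablePred fun p : Fin n => (i, p) ∉ W] :
    T.card ≤ (T.filter (fun p => (i, p) ∉ W)).card + W.card := by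
  classical
  have h1 := Finset.card_filter_add_card_filter_not (s := T) (fun p => (i, p) ∉ W)
  have h2 : (T.filter (fun p => ¬ (i, p) ∉ W)).card ≤ W.card := by
    refine Finset.card_le_card_of_injOn (fun p => (i, p)) ?_ ?_
    · intro p hp
      have := (Finset.mem_filter.1 hp).2
      simpa using this
    · intro p _ q _ h
      simpa using h
  omega

/-- `x` and `y` can be exchanged robustly -/
def Sw [NeZero k] (A : ZMod k → Fin n → Fin n → Prop) (B s : ℕ) (x y : ZMod k × Fin n) : Prop :=
  ∀ W : Finset (ZMod k × Fin n), W.card + s ≤ B → ∃ S : Multiset (ZMod k × Fin n),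
    S.card ≤ s ∧ S.Nodup ∧ (∀ v ∈ S, v ∉ W) ∧ {x} + S ∈ F A ∧ {y} + S ∈ F A

variable [NeZero k] {A : ZMod k → Fin n → Fin n → Prop}

lemma Sw.symm {B s : ℕ} {x y : ZMod k × Fin n} (h : Sw A B s x y) : Sw A B s y x := by
  intro W hW
  obtain ⟨S, h1, h2, h3, h4, h5⟩ := h W hW
  exact ⟨S, h1, h2, h3, h5, h4⟩

lemma Sw.mono {B s t : ℕ} {x y : ZMod k × Fin n} (h : Sw A B s x y) (hst : s ≤ t) :
    Sw A B t x y := by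
  intro W hW
  obtain ⟨S, h1, h2, h3, h4, h5⟩ := h W (by omega)
  exact ⟨S, by omega, h2, h3, h4, h5⟩

lemma Sw.comp {B s : ℕ} {x y : ZMod k × Fin n} (Q : Finset (ZMod k × Fin n)) (hQ : B + 1 ≤ Q.card)
    (h : ∀ w ∈ Q, Sw A B s x w ∧ Sw A B s w y) : Sw A B (3 * s + 5) x y := by
  classical
  intro W hW
  obtain ⟨w, hwQ, hwW⟩ : ∃ w ∈ Q, w ∉ W := Finset.exists_mem_notMem_of_card_lt_card (by omega)
  have hc := Finset.card_insert_le w W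
  obtain ⟨S, h1, h2, h3, h4, h5⟩ := (h w hwQ).1 (insert w W) (by omega)
  have hc2 := Finset.card_union_le (insert w W) S.toFinset
  have hc3 := Multiset.toFinset_card_le S
  obtain ⟨T, g1, g2, g3, g4, g5⟩ := (h w hwQ).2 (insert w W ∪ S.toFinset) (by omega)
  refine ⟨S + ({w} + T), ?_, ?_, ?_, ?_, ?_⟩
  · simp; omega
  · simp only [Multiset.nodup_add, Multiset.nodup_singleton, true_and, h2, g2,
      Multiset.singleton_disjoint, Multiset.disjoint_add_right, Multiset.disjoint_singleton]
    refine ⟨fun hw => g3 w hw (by simp), fun hw => h3 w hw (by simp), ?_⟩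
    rw [Multiset.disjoint_right]
    intro v hv hv'
    exact g3 v hv (by simp [hv'])
  · intro v hv hvW
    simp only [Multiset.mem_add, Multiset.mem_singleton] at hv
    rcases hv with hv | rfl | hv
    · exact h3 v hv (by simp [hvW])
    · exact hwW hvW
    · exact g3 v hv (by simp [hvW])
  · rw [← add_assoc]; exact add_mem h4 g4
  · have : {y} + (S + ({w} + T)) = ({w} + S) + ({y} + T) := by abel
    rw [this]; exact add_mem h5 g5

end Abs

namespace Abs

open Finset

variable {k n : ℕ}

lemma off_ne (i : ZMod k) {c d : ℕ} (hc : c < k) (hd : d < k) (h : c ≠ d) :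
    i + (c : ZMod k) ≠ i + (d : ZMod k) := by
  intro h'
  exact h (cast_inj' hc hd (by simpa using h'))

variable [NeZero k] {A : ZMod k → Fin n → Fin n → Prop}

lemma cons_mem_F (hk : 4 ≤ k) (i : ZMod k) (p : Fin n) (w : ℕ → Fin n) (h0 : A i p (w 0))
    (hp : Pth A (i + 1) w (k - 1)) (hl : A (i - 1) (w (k - 2)) p) :
    {(i, p)} + sq (i + 1) w (k - 1) ∈ F A := by
  obtain ⟨K, rfl⟩ : ∃ K, k = K + 4 := ⟨k - 4, by omega⟩
  have := sq_mem_F A i (fun j => match j with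
    | 0 => p
    | j + 1 => w j) ?_ ?_
  · rw [sq_cons i _ (K + 3)] at this
    exact this
  · intro j hj
    match j with
    | 0 => simpa using h0
    | j + 1 =>
      have := hp j (by omega)
      simp only
      push_cast
      rw [show i + ((j : ZMod (K + 4)) + 1) = i + 1 + j by ring]
      exact this
  · exact hl

lemma cons2_mem_F (hk : 4 ≤ k) (i : ZMod k) (p d : Fin n) (w : ℕ → Fin n) (h0 : A i p d)
    (h1 : A (i + 1) d (w 0))
    (hp : Pth A (i + 2) w (k - 2)) (hl : A (i - 1) (w (k - 3)) p) :
    {(i, p)} + ({(i + 1, d)} + sq (i + 2) w (k - 2)) ∈ F A := by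
  obtain ⟨K, rfl⟩ : ∃ K, k = K + 4 := ⟨k - 4, by omega⟩
  have := cons_mem_F hk i p (fun j => match j with
    | 0 => d
    | j + 1 => w j) h0 ?_ hl
  · rw [show K + 4 - 1 = (K + 2) + 1 from rfl, sq_cons, show i + 1 + 1 = i + 2 by ring] at this
    exact this
  · intro j hj
    match j with
    | 0 => simpa using h1
    | j + 1 =>
      have := hp j (by omega)
      simp only
      push_cast
      rw [show i + 1 + ((j : ZMod (K + 4)) + 1) = i + 2 + j by ring]
      exact this

lemma cons3_mem_F (hk : 4 ≤ k) (i : ZMod k) (p d e : Fin n) (w : ℕ → Fin n) (h0 : A i p d)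
    (h1 : A (i + 1) d (w 0))
    (hp : Pth A (i + 2) w (k - 3)) (h2 : A (i - 2) (w (k - 4)) e) (hl : A (i - 1) e p) :
    {(i, p)} + ({(i + 1, d)} + (sq (i + 2) w (k - 3) + {(i - 1, e)})) ∈ F A := by
  obtain ⟨K, rfl⟩ : ∃ K, k = K + 4 := ⟨k - 4, by omega⟩
  have hK : ((K : ZMod (K + 4))) = - 4 := by
    have : ((K + 4 : ℕ) : ZMod (K + 4)) = 0 := ZMod.natCast_self _
    push_cast at this
    linear_combination this
  have := cons2_mem_F hk i p d (fun j => if j = K + 1 then e else w j) h0 ?_ ?_ ?_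
  · rw [show K + 4 - 2 = (K + 1) + 1 from rfl, sq_snoc] at this
    have e1 : sq (i + 2) (fun j => if j = K + 1 then e else w j) (K + 1)
        = sq (i + 2) w (K + 1) := by
      apply Finset.sum_congr rfl
      intro j hj
      have : j ≠ K + 1 := by have := Finset.mem_range.1 hj; omega
      simp [this]
    rw [e1] at this
    have e2 : i + 2 + ((K + 1 : ℕ) : ZMod (K + 4)) = i - 1 := by
      push_cast; rw [hK]; ring
    rw [e2] at this
    simpa using this
  · simpa using h1
  · intro j hj
    by_cases hj' : j = K
    · subst hj'
      have e2 : i + 2 + ((j : ℕ) : ZMod (j + 4)) = i - 2 := by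
        rw [hK]; ring
      rw [e2]
      simpa using h2
    · have := hp j (by omega)
      have h3 : j ≠ K + 1 := by omega
      have h4 : j + 1 ≠ K + 1 := by omega
      simp only [h3, h4, if_false]
      exact this
  · simpa using hl

lemma exists_cyc (hk : 4 ≤ k) {a : ℕ} (hA : Hole A a) (i : ZMod k) (Q : ℕ → Finset (Fin n))
    (hQ : ∀ j < k - 1, 2 * a + 1 ≤ (Q j).card) :
    ∃ w : ℕ → Fin n, (∀ j < k - 1, w j ∈ Q j) ∧ ∀ p, Q 0 ⊆ outN A i p → Q (k - 2) ⊆ inN A i p →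
      {(i, p)} + sq (i + 1) w (k - 1) ∈ F A := by
  have e : k - 1 = (k - 2) + 1 := by omega
  obtain ⟨w, h1, h2⟩ := exists_path hA (i + 1) Q (k - 2) (by rw [← e]; exact hQ)
  rw [← e] at h1 h2
  refine ⟨w, h1, ?_⟩
  intro p hp0 hp1
  apply cons_mem_F hk
  · have := hp0 (h1 0 (by omega))
    simpa [outN] using this
  · exact h2
  · have := hp1 (h1 (k - 2) (by omega))
    simpa [inN] using this

/-- common neighbourhoods of size at least `q` on both sides -/
def Ec (A : ZMod k → Fin n → Fin n → Prop) (q : ℕ) (i : ZMod k) (p p' : Fin n) : Prop :=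
  q ≤ (outN A i p ∩ outN A i p').card ∧ q ≤ (inN A i p ∩ inN A i p').card

lemma step1 (hk : 4 ≤ k) {a B q : ℕ} (hA : Hole A a) (hq : 2 * a + 1 + B ≤ q) (hn : q ≤ n)
    (i : ZMod k) (p p' : Fin n) (h : Ec A q i p p') : Sw A B k (i, p) (i, p') := by
  classical
  intro W hW
  obtain ⟨w, h1, h2⟩ := exists_cyc hk hA i (fun j => (if j = 0 then outN A i p ∩ outN A i p' else
    if j = k - 2 then inN A i p ∩ inN A i p' else univ).filter
      (fun v => (i + 1 + (j : ZMod k), v) ∉ W)) (by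
      intro j hj
      refine Nat.le_of_add_le_add_right (le_trans ?_ (card_avoid W _ _))
      split_ifs
      · have := h.1; omega
      · have := h.2; omega
      · simp; omega)
  refine ⟨sq (i + 1) w (k - 1), ?_, ?_, ?_, ?_, ?_⟩
  · rw [card_sq]; omega
  · exact nodup_sq _ _ _ (by omega)
  · intro v hv
    obtain ⟨j, hj, rfl⟩ := mem_sq.1 hv
    exact (Finset.mem_filter.1 (h1 j hj)).2
  · apply h2
    · intro v hv
      simp at hv; exact hv.1.1
    · have : k - 2 ≠ 0 := by omega
      intro v hv
      simp [this] at hv; exact hv.1.1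
  · apply h2
    · intro v hv
      simp at hv; exact hv.1.2
    · have : k - 2 ≠ 0 := by omega
      intro v hv
      simp [this] at hv; exact hv.1.2

/-- all parameters used in the reachability argument -/
structure Par (A : ZMod k → Fin n → Fin n → Prop) (a B D m q h g : ℕ) : Prop where
  hk : 4 ≤ k
  hA : Hole A a
  hDo : ∀ i p, D ≤ (outN A i p).card
  hDi : ∀ i p, D ≤ (inN A i p).card
  hh : h + m * (q * n) ≤ D * D
  hm : n * n < m * h
  hq : 2 * a + 1 + B ≤ q
  hqn : q ≤ n
  hgD : 3 ^ m * g ≤ D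
  hg : 3 * B + 10 * a + 10 ≤ g

lemma closed_aux {a B D m q h g : ℕ} (P : Par A a B D m q h g) (i : ZMod k) :
    ∀ (r j : ℕ) (T : Finset (Fin n)) (Q : Finset (Fin n × Fin n)), r + j = m →
      j * h ≤ Q.card → (∀ p ∈ T, ((outN A i p ×ˢ inN A i p) ∩ Q).card ≤ j * (q * n)) →
      ∃ T' ⊆ T, T.card ≤ 3 ^ r * T'.card ∧ ∀ x ∈ T', ∀ y ∈ T', ∃ C ⊆ T', T'.card ≤ 3 * C.card ∧
        ∀ z ∈ C, Ec A q i x z ∧ Ec A q i y z := by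
  classical
  intro r
  induction r with
  | zero =>
    intro j T Q hj hQ hT
    exfalso
    have h1 := P.hm
    have h2 : Q.card ≤ n * n := by
      simpa using Finset.card_le_univ Q
    have : j = m := by omega
    subst this
    omega
  | succ r ih =>
    intro j T Q hj hQ hT
    by_cases hx : ∃ x ∈ T, T.card ≤ 3 * (T.filter (fun z => ¬ Ec A q i x z)).card
    · obtain ⟨x, hxT, hx⟩ := hx
      have H1 : (j + 1) * h ≤ (Q ∪ (outN A i x ×ˢ inN A i x)).card := by
        have e1 := Finset.card_union_add_card_inter Q (outN A i x ×ˢ inN A i x)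
        have e2 := hT x hxT
        rw [Finset.inter_comm] at e2
        rw [Finset.card_product] at e1
        have e3 := Nat.mul_le_mul (P.hDo i x) (P.hDi i x)
        have e4 := P.hh
        have e5 : j * (q * n) ≤ m * (q * n) := Nat.mul_le_mul_right _ (by omega)
        rw [add_mul, one_mul]
        omega
      have H2 : ∀ p ∈ T.filter (fun z => ¬ Ec A q i x z),
          ((outN A i p ×ˢ inN A i p) ∩ (Q ∪ (outN A i x ×ˢ inN A i x))).card
            ≤ (j + 1) * (q * n) := by
        intro p hp
        obtain ⟨hpT, hp⟩ := Finset.mem_filter.1 hp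
        rw [Finset.inter_union_distrib_left]
        refine (Finset.card_union_le _ _).trans ?_
        rw [add_mul, one_mul]
        refine add_le_add (hT p hpT) ?_
        rw [Finset.product_inter_product, Finset.card_product]
        have l1 : (outN A i p ∩ outN A i x).card ≤ n := by
          simpa using Finset.card_le_univ (outN A i p ∩ outN A i x)
        have l2 : (inN A i p ∩ inN A i x).card ≤ n := by
          simpa using Finset.card_le_univ (inN A i p ∩ inN A i x)
        unfold Ec at hp
        rw [Finset.inter_comm (outN A i x), Finset.inter_comm (inN A i x)] at hp
        by_cases hc : q ≤ (outN A i p ∩ outN A i x).card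
        · have : (inN A i p ∩ inN A i x).card ≤ q := by
            by_contra h'
            exact hp ⟨hc, by omega⟩
          rw [mul_comm q n]
          exact Nat.mul_le_mul l1 this
        · exact Nat.mul_le_mul (by omega) l2
      obtain ⟨T', h1, h2, h3⟩ := ih (j + 1) (T.filter (fun z => ¬ Ec A q i x z))
        (Q ∪ (outN A i x ×ˢ inN A i x)) (by omega) H1 H2
      refine ⟨T', h1.trans (Finset.filter_subset _ _), ?_, h3⟩
      rw [pow_succ]
      calc T.card ≤ _ := hx
        _ ≤ 3 * (3 ^ r * T'.card) := by gcongr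
        _ = _ := by ring
    · push Not at hx
      refine ⟨T, subset_rfl, ?_, ?_⟩
      · exact Nat.le_mul_of_pos_left _ (by positivity)
      · intro x hxT y hyT
        refine ⟨T.filter (fun z => Ec A q i x z ∧ Ec A q i y z), Finset.filter_subset _ _, ?_, ?_⟩
        · have e1 := hx x hxT
          have e2 := hx y hyT
          have e3 := Finset.card_filter_add_card_filter_not (s := T)
            (fun z => Ec A q i x z ∧ Ec A q i y z)
          have e4 : (T.filter (fun z => ¬ (Ec A q i x z ∧ Ec A q i y z))).card ≤
              (T.filter (fun z => ¬ Ec A q i x z)).card +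
              (T.filter (fun z => ¬ Ec A q i y z)).card := by
            refine le_trans (Finset.card_le_card ?_) (Finset.card_union_le _ _)
            intro z hz
            simp only [Finset.mem_filter, Finset.mem_union] at hz ⊢
            tauto
          omega
        · intro z hz
          exact (Finset.mem_filter.1 hz).2

lemma closed {a B D m q h g : ℕ} (P : Par A a B D m q h g) (i : ZMod k) (T : Finset (Fin n))
    (hT : D ≤ T.card) : ∃ T' ⊆ T, g ≤ T'.card ∧ ∀ x ∈ T', ∀ y ∈ T',
      Sw A B (3 * k + 5) (i, x) (i, y) := by
  classical
  obtain ⟨T', h1, h2, h3⟩ := closed_aux P i m 0 T ∅ (by omega) (by simp) (by simp)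
  have hg : g ≤ T'.card := by
    have e := P.hgD.trans (hT.trans h2)
    exact Nat.le_of_mul_le_mul_left e (by positivity)
  refine ⟨T', h1, hg, ?_⟩
  intro x hx y hy
  obtain ⟨C, hC, hC1, hC2⟩ := h3 x hx y hy
  apply Sw.comp (C.map ⟨fun p => (i, p), fun p q h => by simpa using h⟩)
  · rw [Finset.card_map]
    have := P.hg
    omega
  · intro w hw
    obtain ⟨z, hz, rfl⟩ := Finset.mem_map.1 hw
    exact ⟨step1 P.hk P.hA P.hq P.hqn i x z (hC2 z hz).1,
      (step1 P.hk P.hA P.hq P.hqn i y z (hC2 z hz).2).symm⟩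

lemma greedy {ι : Type*} (E : Finset ι) (P : ι → Multiset (ZMod k × Fin n) → Prop) (s B : ℕ)
    (h : ∀ e ∈ E, ∀ W : Finset (ZMod k × Fin n), W.card + s ≤ B → ∃ S : Multiset (ZMod k × Fin n),
      S.card ≤ s ∧ S.Nodup ∧ (∀ v ∈ S, v ∉ W) ∧ P e S) :
    ∀ W : Finset (ZMod k × Fin n), W.card + E.card * s ≤ B →
      ∃ S : ι → Multiset (ZMod k × Fin n), (∀ e ∈ E, P e (S e)) ∧ (∑ e ∈ E, S e).Nodup ∧
        (∀ v ∈ ∑ e ∈ E, S e, v ∉ W) ∧ (∑ e ∈ E, S e).card ≤ E.card * s := by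
  classical
  induction E using Finset.induction_on with
  | empty => intro W _; exact ⟨fun _ => 0, by simp⟩
  | insert e E he ih =>
    intro W hW
    rw [Finset.card_insert_of_notMem he, add_mul, one_mul] at hW
    obtain ⟨S, h1, h2, h3, h4⟩ := ih (fun e' he' => h e' (Finset.mem_insert_of_mem he')) W
      (by omega)
    have c1 := Finset.card_union_le W (∑ e ∈ E, S e).toFinset
    have c2 := Multiset.toFinset_card_le (∑ e ∈ E, S e)
    obtain ⟨T, g1, g2, g3, g4⟩ := h e (Finset.mem_insert_self _ _) (W ∪ (∑ e ∈ E, S e).toFinset)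
      (by omega)
    have hs : ∑ e' ∈ E, (if e' = e then T else S e') = ∑ e' ∈ E, S e' := by
      apply Finset.sum_congr rfl
      intro e' he'
      have : e' ≠ e := by rintro rfl; exact he he'
      simp [this]
    refine ⟨fun e' => if e' = e then T else S e', ?_, ?_, ?_, ?_⟩
    · intro e' he'
      by_cases hh : e' = e
      · subst hh; simpa using g4
      · simp only [hh, if_false]
        exact h1 e' (by simpa [hh] using he')
    · rw [Finset.sum_insert he, hs]
      simp only [if_true]
      rw [Multiset.nodup_add]
      refine ⟨g2, h2, ?_⟩
      rw [Multiset.disjoint_left]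
      intro v hv hv'
      exact g3 v hv (Finset.mem_union_right _ (Multiset.mem_toFinset.2 hv'))
    · rw [Finset.sum_insert he, hs]
      simp only [if_true]
      intro v hv hvW
      rcases Multiset.mem_add.1 hv with hv | hv
      · exact g3 v hv (by simp [hvW])
      · exact h3 v hv hvW
    · rw [Finset.sum_insert he, hs, Finset.card_insert_of_notMem he]
      simp only [if_true]
      rw [Multiset.card_add, add_mul]; omega

lemma multiSw {B s : ℕ} (m : ℕ) (x y : Fin m → ZMod k × Fin n) (h : ∀ e, Sw A B s (x e) (y e))
    (W : Finset (ZMod k × Fin n)) (hW : W.card + m * s ≤ B) :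
    ∃ S : Fin m → Multiset (ZMod k × Fin n), (∀ e, {x e} + S e ∈ F A ∧ {y e} + S e ∈ F A) ∧
      (∑ e, S e).Nodup ∧ (∀ v ∈ ∑ e, S e, v ∉ W) ∧ (∑ e, S e).card ≤ m * s := by
  obtain ⟨S, h1, h2⟩ := greedy (Finset.univ : Finset (Fin m))
    (fun e S => {x e} + S ∈ F A ∧ {y e} + S ∈ F A) s B
    (fun e _ W hW => h e W hW) W (by simpa using hW)
  exact ⟨S, fun e => h1 e (by simp), by simpa using h2⟩

/-- Add switches to a core. -/
lemma core_ext {B s : ℕ} (m : ℕ) (x y : Fin m → ZMod k × Fin n) (h : ∀ e, Sw A B s (x e) (y e))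
    (W : Finset (ZMod k × Fin n)) (C : Multiset (ZMod k × Fin n)) (hC : C.Nodup)
    (hCW : ∀ v ∈ C, v ∉ W) (hW : W.card + C.card + m * s ≤ B) :
    ∃ S : Fin m → Multiset (ZMod k × Fin n), (∀ e, {x e} + S e ∈ F A ∧ {y e} + S e ∈ F A) ∧
      (C + ∑ e, S e).Nodup ∧ (∀ v ∈ C + ∑ e, S e, v ∉ W) ∧
      (C + ∑ e, S e).card ≤ C.card + m * s := by
  classical
  have c1 := Finset.card_union_le W C.toFinset
  have c2 := Multiset.toFinset_card_le C
  obtain ⟨S, h1, h2, h3, h4⟩ := multiSw m x y h (W ∪ C.toFinset) (by omega)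
  refine ⟨S, h1, ?_, ?_, ?_⟩
  · rw [Multiset.nodup_add]
    refine ⟨hC, h2, ?_⟩
    rw [Multiset.disjoint_right]
    intro v hv hv'
    exact h3 v hv (by simp [hv'])
  · intro v hv hvW
    rcases Multiset.mem_add.1 hv with hv | hv
    · exact hCW v hv hvW
    · exact h3 v hv (by simp [hvW])
  · rw [Multiset.card_add]; omega

lemma split2 (g : ℕ) (S T : Finset (Fin n)) (hS : g ≤ S.card) (hT : g ≤ T.card) :
    ∃ S' ⊆ S, ∃ T' ⊆ T, Disjoint S' T' ∧ g ≤ 2 * S'.card + 1 ∧ g ≤ 2 * T'.card + 1 := by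
  classical
  obtain ⟨S', h1, h2⟩ := Finset.exists_subset_card_eq (s := S) (n := g / 2) (by omega)
  refine ⟨S', h1, T \ S', Finset.sdiff_subset, Finset.disjoint_sdiff, by omega, ?_⟩
  have := Finset.le_card_sdiff S' T
  omega

end Abs

namespace Abs

open Finset

variable {k n : ℕ} [NeZero k] {A : ZMod k → Fin n → Fin n → Prop}

lemma Par.gD {a B D m q h g : ℕ} (P : Par A a B D m q h g) : g ≤ D :=
  le_trans (Nat.le_mul_of_pos_left _ (by positivity)) P.hgD

lemma Par.Dn {a B D m q h g : ℕ} (P : Par A a B D m q h g) : D ≤ n := by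
  have h1 := P.hq
  have h2 := P.hqn
  have h3 := P.hDo 0 ⟨0, by omega⟩
  exact h3.trans (by simpa using Finset.card_le_univ (outN A 0 ⟨0, by omega⟩))

lemma filter_imp_le {Q : Finset (Fin n)} {c : Prop} {P : Fin n → Prop} [DecidablePred P]
    [DecidablePred fun v => c → P v] : (Q.filter P).card ≤ (Q.filter (fun v => c → P v)).card := by
  apply Finset.card_le_card
  intro v hv
  obtain ⟨h1, h2⟩ := Finset.mem_filter.1 hv
  exact Finset.mem_filter.2 ⟨h1, fun _ => h2⟩

lemma exists_path_ends {a : ℕ} (hA : Hole A a) (i : ZMod k)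
    (Q : ℕ → Finset (Fin n)) (m : ℕ) (hQ : ∀ j < m + 1, 6 * a + 1 ≤ (Q j).card)
    (TA TB TC TD : Finset (Fin n)) (hTA : a ≤ TA.card) (hTB : a ≤ TB.card) (hTC : a ≤ TC.card)
    (hTD : a ≤ TD.card) :
    ∃ w : ℕ → Fin n, (∀ j < m + 1, w j ∈ Q j) ∧ Pth A i w (m + 1) ∧
      (∃ t ∈ TA, A (i - 1) t (w 0)) ∧ (∃ t ∈ TB, A (i - 1) t (w 0)) ∧
      (∃ t ∈ TC, A (i + (m : ZMod k)) (w m) t) ∧ (∃ t ∈ TD, A (i + (m : ZMod k)) (w m) t) := by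
  classical
  obtain ⟨w, h1, h2⟩ := exists_path hA i (fun j =>
    ((((Q j).filter (fun v => j = 0 → ∃ t ∈ TA, A (i - 1) t v)).filter
      (fun v => j = 0 → ∃ t ∈ TB, A (i - 1) t v)).filter
      (fun v => j = m → ∃ t ∈ TC, A (i + (m : ZMod k)) v t)).filter
      (fun v => j = m → ∃ t ∈ TD, A (i + (m : ZMod k)) v t)) m (by
      intro j hj
      have e := hQ j hj
      have e1 := (hole_in hA (i - 1) (Q j) TA hTA).trans (Nat.add_le_add_right
        (filter_imp_le (c := j = 0)) a)
      have e2 := (hole_in hA (i - 1)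
        ((Q j).filter (fun v => j = 0 → ∃ t ∈ TA, A (i - 1) t v)) TB hTB).trans
        (Nat.add_le_add_right (filter_imp_le (c := j = 0)) a)
      have e3 := (hole_out hA (i + (m : ZMod k))
        (((Q j).filter (fun v => j = 0 → ∃ t ∈ TA, A (i - 1) t v)).filter
        (fun v => j = 0 → ∃ t ∈ TB, A (i - 1) t v)) TC hTC).trans
        (Nat.add_le_add_right (filter_imp_le (c := j = m)) a)
      have e4 := (hole_out hA (i + (m : ZMod k))
        ((((Q j).filter (fun v => j = 0 → ∃ t ∈ TA, A (i - 1) t v)).filter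
        (fun v => j = 0 → ∃ t ∈ TB, A (i - 1) t v)).filter
        (fun v => j = m → ∃ t ∈ TC, A (i + (m : ZMod k)) v t)) TD hTD).trans
        (Nat.add_le_add_right (filter_imp_le (c := j = m)) a)
      omega)
  have h0 := h1 0 (by omega)
  have hm := h1 m (by omega)
  simp only [Finset.mem_filter] at h0 hm
  refine ⟨w, ?_, h2, h0.1.1.1.2 trivial, h0.1.1.2 trivial, hm.1.2 trivial, hm.2 trivial⟩
  intro j hj
  have := h1 j hj
  simp only [Finset.mem_filter] at this
  exact this.1.1.1.1

lemma star {a B D m q h g : ℕ} (P : Par A a B D m q h g) (i : ZMod k) (T1 T2 : Finset (Fin n))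
    (hT1 : D ≤ T1.card) (hT2 : D ≤ T2.card) :
    ∃ T1' ⊆ T1, ∃ T2' ⊆ T2, g ≤ T1'.card ∧ g ≤ T2'.card ∧ ∀ x ∈ T1', ∀ y ∈ T2',
      Sw A B (10 * k + 17) (i, x) (i, y) := by
  classical
  obtain ⟨T1', s1, c1, cl1⟩ := closed P i T1 hT1
  obtain ⟨T2', s2, c2, cl2⟩ := closed P i T2 hT2
  refine ⟨T1', s1, T2', s2, c1, c2, ?_⟩
  intro x hx y hy W hW
  have hk := P.hk
  have hA := P.hA
  have hg := P.hg
  have hgD := P.gD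
  have hDn := P.Dn
  -- the dense vertex
  obtain ⟨u, hu⟩ : ∃ u : Fin n, (i + 2, u) ∉ W := by
    have := card_avoid W (i + 2) (univ : Finset (Fin n))
    simp only [Finset.card_univ, Fintype.card_fin] at this
    obtain ⟨u, hu⟩ := Finset.card_pos.1
      (show 0 < ((univ : Finset (Fin n)).filter (fun p => (i + 2, p) ∉ W)).card by omega)
    exact ⟨u, (Finset.mem_filter.1 hu).2⟩
  obtain ⟨D', sD, cD, clD⟩ := closed P (i + 1) (inN A (i + 2) u) (P.hDi _ _)
  obtain ⟨D1, hD1, D2, hD2, hD12, cD1, cD2⟩ := split2 g D' D' cD cD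
  obtain ⟨A1, hA1, B1, hB1, hAB, cA1, cB1⟩ := split2 g T1' T2' c1 c2
  have aD1 := card_avoid W (i + 1) D1
  have aD2 := card_avoid W (i + 1) D2
  have aA1 := card_avoid W i A1
  have aB1 := card_avoid W i B1
  have fA := hole_out hA i (A1.filter (fun p => (i, p) ∉ W))
    (D1.filter (fun p => (i + 1, p) ∉ W)) (by omega)
  have fB := hole_out hA i (B1.filter (fun p => (i, p) ∉ W))
    (D2.filter (fun p => (i + 1, p) ∉ W)) (by omega)
  set A2 := (A1.filter (fun p => (i, p) ∉ W)).filter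
    (fun p => ∃ t ∈ D1.filter (fun p => (i + 1, p) ∉ W), A i p t) with hA2
  set B2 := (B1.filter (fun p => (i, p) ∉ W)).filter
    (fun p => ∃ t ∈ D2.filter (fun p => (i + 1, p) ∉ W), A i p t) with hB2
  have hkc : i + 2 + 1 + ((k - 4 : ℕ) : ZMod k) = i - 1 := by
    rw [Nat.cast_sub hk, ZMod.natCast_self]; push_cast; ring
  obtain ⟨p, hp1, hp2, -, -, ⟨aa, haA, hla⟩, ⟨bb, hbB, hlb⟩⟩ := exists_path_ends hA (i + 2 + 1)
    (fun j => (if j = 0 then outN A (i + 2) u else univ).filter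
        (fun v => (i + 2 + 1 + (j : ZMod k), v) ∉ W)) (k - 4) (by
      intro j hj
      have e1 : D ≤ (if j = 0 then outN A (i + 2) u else univ).card := by
        split_ifs
        · exact P.hDo _ _
        · simpa using hDn
      have e2 := card_avoid W (i + 2 + 1 + (j : ZMod k))
        (if j = 0 then outN A (i + 2) u else univ)
      omega) univ univ A2 B2 (by simp; omega) (by simp; omega) (by omega) (by omega)
  rw [hkc] at hla hlb
  have hpW : ∀ j < k - 3, (i + 2 + 1 + (j : ZMod k), p j) ∉ W := by
    intro j hj
    exact (Finset.mem_filter.1 (hp1 j (by omega))).2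
  have hup : A (i + 2) u (p 0) := by
    have := (Finset.mem_filter.1 (hp1 0 (by omega))).1
    simpa [outN] using this
  obtain ⟨haA, d, hd, had⟩ := Finset.mem_filter.1 haA
  obtain ⟨hbB, d', hd', hbd⟩ := Finset.mem_filter.1 hbB
  obtain ⟨haA, haW⟩ := Finset.mem_filter.1 haA
  obtain ⟨hbB, hbW⟩ := Finset.mem_filter.1 hbB
  obtain ⟨hd, hdW⟩ := Finset.mem_filter.1 hd
  obtain ⟨hd', hdW'⟩ := Finset.mem_filter.1 hd'
  have hab : aa ≠ bb := fun h => (Finset.disjoint_left.1 hAB haA) (h ▸ hbB)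
  have hdd : d ≠ d' := fun h => (Finset.disjoint_left.1 hD12 hd) (h ▸ hd')
  have adj_u : ∀ e ∈ D', A (i + 1) e u := by
    intro e he
    have := sD he
    simp only [inN, Finset.mem_filter, Finset.mem_univ, true_and] at this
    rwa [show i + 2 - 1 = i + 1 by ring] at this
  -- the path with `u` in front
  set w : ℕ → Fin n := fun j => match j with
    | 0 => u
    | j + 1 => p j with hw
  have hwP : Pth A (i + 2) w (k - 2) := by
    intro j hj
    match j with
    | 0 => simpa [hw] using hup
    | j + 1 =>
      have := hp2 j (by omega)
      simp only [hw]
      push_cast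
      rw [show i + 2 + ((j : ZMod k) + 1) = i + 2 + 1 + j by ring]
      exact this
  have hwW : ∀ v ∈ sq (i + 2) w (k - 2), v ∉ W := by
    intro v hv
    obtain ⟨j, hj, rfl⟩ := mem_sq.1 hv
    match j with
    | 0 => simpa [hw] using hu
    | j + 1 =>
      have := hpW j (by omega)
      simp only [hw]
      push_cast
      rw [show i + 2 + ((j : ZMod k) + 1) = i + 2 + 1 + j by ring]
      exact this
  have hwl : w (k - 3) = p (k - 4) := by
    rw [show k - 3 = (k - 4) + 1 by omega]
  have cyc1 := cons2_mem_F hk i aa d w had (adj_u d (hD1 hd)) hwP (by rw [hwl]; exact hla)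
  have cyc2 := cons2_mem_F hk i bb d' w hbd (adj_u d' (hD2 hd')) hwP (by rw [hwl]; exact hlb)
  have hi1 : i ≠ i + 1 := by
    have := off_ne i (c := 0) (d := 1) (by omega) (by omega) (by omega)
    simpa using this
  have n0 : ∀ e, (i, e) ∉ sq (i + 2) w (k - 2) := by
    intro e he
    obtain ⟨j, hj, h⟩ := mem_sq.1 he
    have h := congrArg Prod.fst h
    have := off_ne i (c := 0) (d := j + 2) (by omega) (by omega) (by omega)
    apply this
    simp only at h
    push_cast
    linear_combination h
  have n1 : ∀ e, (i + 1, e) ∉ sq (i + 2) w (k - 2) := by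
    intro e he
    obtain ⟨j, hj, h⟩ := mem_sq.1 he
    have h := congrArg Prod.fst h
    have := off_ne i (c := 1) (d := j + 2) (by omega) (by omega) (by omega)
    apply this
    simp only at h
    push_cast
    linear_combination h
  -- the core
  obtain ⟨S, hS, hSn, hSW, hSc⟩ := core_ext (A := A) (B := B) (s := 3 * k + 5) 3
    ![(i, x), (i + 1, d), (i, bb)] ![(i, aa), (i + 1, d'), (i, y)]
    (by
      intro e
      fin_cases e
      · exact cl1 x hx aa (hA1 haA)
      · exact clD d (hD1 hd) d' (hD2 hd')
      · exact cl2 bb (hB1 hbB) y hy) W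
    ({(i, aa)} + ({(i, bb)} + ({(i + 1, d)} + ({(i + 1, d')} + sq (i + 2) w (k - 2)))))
    (by
      simp only [Multiset.nodup_add, Multiset.nodup_singleton, true_and,
        Multiset.singleton_disjoint, nodup_sq (i + 2) w (k - 2) (by omega), Multiset.mem_add,
        Multiset.mem_singleton, Prod.mk.injEq, n0, n1, hab, hdd, hi1]
      simp)
    (by
      intro v hv
      simp only [Multiset.mem_add, Multiset.mem_singleton] at hv
      rcases hv with rfl | rfl | rfl | rfl | hv
      · exact haW
      · exact hbW
      · exact hdW
      · exact hdW'
      · exact hwW v hv)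
    (by simp only [Multiset.card_add, Multiset.card_singleton, card_sq]; omega)
  refine ⟨_, ?_, hSn, hSW, ?_, ?_⟩
  · refine hSc.trans ?_
    simp only [Multiset.card_add, Multiset.card_singleton, card_sq]; omega
  · rw [Fin.sum_univ_three]
    have e0 := (hS 0).1
    have e1 := (hS 1).2
    have e2 := (hS 2).1
    simp only [Matrix.cons_val] at e0 e1 e2
    have := add_mem (add_mem e0 e1) (add_mem e2 cyc1)
    convert this using 1
    abel
  · rw [Fin.sum_univ_three]
    have e0 := (hS 0).2
    have e1 := (hS 1).1
    have e2 := (hS 2).2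
    simp only [Matrix.cons_val] at e0 e1 e2
    have := add_mem (add_mem e0 e1) (add_mem e2 cyc2)
    convert this using 1
    abel

end Abs

namespace Abs

open Finset

variable {k n : ℕ} [NeZero k] {A : ZMod k → Fin n → Fin n → Prop}

lemma reach {a B D m q h g : ℕ} (P : Par A a B D m q h g) (i : ZMod k) (x y : Fin n) :
    Sw A B (30 * k + 50) (i, x) (i, y) := by
  classical
  obtain ⟨T1, s1, T2, s2, c1, c2, sw⟩ := star P (i + 1) (outN A i x) (outN A i y)
    (P.hDo _ _) (P.hDo _ _)
  obtain ⟨T1', s1', T2', s2', c1', c2', sw'⟩ := star P (i - 1) (inN A i x) (inN A i y)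
    (P.hDi _ _) (P.hDi _ _)
  intro W hW
  have hk := P.hk
  have hA := P.hA
  have hg := P.hg
  have hgD := P.gD
  have hDn := P.Dn
  obtain ⟨A1, hA1, B1, hB1, hAB, cA1, cB1⟩ := split2 g T1 T2 c1 c2
  obtain ⟨A2, hA2, B2, hB2, hAB', cA2, cB2⟩ := split2 g T1' T2' c1' c2'
  have aA1 := card_avoid W (i + 1) A1
  have aB1 := card_avoid W (i + 1) B1
  have aA2 := card_avoid W (i - 1) A2
  have aB2 := card_avoid W (i - 1) B2
  have hkc : i + 2 + ((k - 4 : ℕ) : ZMod k) = i - 2 := by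
    rw [Nat.cast_sub hk, ZMod.natCast_self]; push_cast; ring
  obtain ⟨w, hp1, hp2, ⟨a1, ha1, e1⟩, ⟨b1, hb1, e2⟩, ⟨a2, ha2, e3⟩, ⟨b2, hb2, e4⟩⟩ :=
    exists_path_ends hA (i + 2)
    (fun j => univ.filter
        (fun v => (i + 2 + (j : ZMod k), v) ∉ W)) (k - 4) (by
      intro j hj
      have e2 := card_avoid W (i + 2 + (j : ZMod k)) univ
      simp only [Finset.card_univ, Fintype.card_fin] at e2
      omega) (A1.filter (fun p => (i + 1, p) ∉ W)) (B1.filter (fun p => (i + 1, p) ∉ W))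
      (A2.filter (fun p => (i - 1, p) ∉ W)) (B2.filter (fun p => (i - 1, p) ∉ W))
      (by omega) (by omega) (by omega) (by omega)
  rw [hkc] at e3 e4
  rw [show i + 2 - 1 = i + 1 by ring] at e1 e2
  obtain ⟨ha1, wa1⟩ := Finset.mem_filter.1 ha1
  obtain ⟨hb1, wb1⟩ := Finset.mem_filter.1 hb1
  obtain ⟨ha2, wa2⟩ := Finset.mem_filter.1 ha2
  obtain ⟨hb2, wb2⟩ := Finset.mem_filter.1 hb2
  have hab : a1 ≠ b1 := fun h => (Finset.disjoint_left.1 hAB ha1) (h ▸ hb1)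
  have hdd : a2 ≠ b2 := fun h => (Finset.disjoint_left.1 hAB' ha2) (h ▸ hb2)
  have hwW : ∀ v ∈ sq (i + 2) w (k - 3), v ∉ W := by
    intro v hv
    obtain ⟨j, hj, rfl⟩ := mem_sq.1 hv
    exact (Finset.mem_filter.1 (hp1 j (by omega))).2
  have hwP : Pth A (i + 2) w (k - 3) := by
    rw [show k - 3 = k - 4 + 1 by omega]; exact hp2
  have o1 : ∀ t ∈ outN A i x, A i x t := by intro t ht; simpa [outN] using ht
  have o2 : ∀ t ∈ outN A i y, A i y t := by intro t ht; simpa [outN] using ht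
  have o3 : ∀ t ∈ inN A i x, A (i - 1) t x := by intro t ht; simpa [inN] using ht
  have o4 : ∀ t ∈ inN A i y, A (i - 1) t y := by intro t ht; simpa [inN] using ht
  have cyc1 := cons3_mem_F hk i x a1 a2 w (o1 _ (s1 (hA1 ha1))) e1 hwP e3 (o3 _ (s1' (hA2 ha2)))
  have cyc2 := cons3_mem_F hk i y b1 b2 w (o2 _ (s2 (hB1 hb1))) e2 hwP e4 (o4 _ (s2' (hB2 hb2)))
  have hm1 : ((k - 1 : ℕ) : ZMod k) = -1 := by
    rw [Nat.cast_sub (by omega), ZMod.natCast_self]; push_cast; ring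
  have hi1 : i + 1 ≠ i - 1 := by
    have := off_ne i (c := 1) (d := k - 1) (by omega) (by omega) (by omega)
    rw [hm1] at this
    push_cast at this
    rwa [← sub_eq_add_neg] at this
  have n0 : ∀ e, (i + 1, e) ∉ sq (i + 2) w (k - 3) := by
    intro e he
    obtain ⟨j, hj, h⟩ := mem_sq.1 he
    have h := congrArg Prod.fst h
    have := off_ne i (c := 1) (d := j + 2) (by omega) (by omega) (by omega)
    apply this
    simp only at h
    push_cast
    linear_combination h
  have n1 : ∀ e, (i - 1, e) ∉ sq (i + 2) w (k - 3) := by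
    intro e he
    obtain ⟨j, hj, h⟩ := mem_sq.1 he
    have h := congrArg Prod.fst h
    have := off_ne i (c := k - 1) (d := j + 2) (by omega) (by omega) (by omega)
    apply this
    simp only at h
    rw [hm1]
    push_cast
    linear_combination h
  obtain ⟨S, hS, hSn, hSW, hSc⟩ := core_ext (A := A) (B := B) (s := 10 * k + 17) 2
    ![(i + 1, a1), (i - 1, a2)] ![(i + 1, b1), (i - 1, b2)]
    (by
      intro e
      fin_cases e
      · exact sw a1 (hA1 ha1) b1 (hB1 hb1)
      · exact sw' a2 (hA2 ha2) b2 (hB2 hb2)) W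
    ({(i + 1, a1)} + ({(i + 1, b1)} + ({(i - 1, a2)} + ({(i - 1, b2)} + sq (i + 2) w (k - 3)))))
    (by
      simp only [Multiset.nodup_add, Multiset.nodup_singleton, true_and,
        Multiset.singleton_disjoint, nodup_sq (i + 2) w (k - 3) (by omega), Multiset.mem_add,
        Multiset.mem_singleton, Prod.mk.injEq, n0, n1, hab, hdd, hi1]
      simp)
    (by
      intro v hv
      simp only [Multiset.mem_add, Multiset.mem_singleton] at hv
      rcases hv with rfl | rfl | rfl | rfl | hv
      · exact wa1
      · exact wb1
      · exact wa2
      · exact wb2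
      · exact hwW v hv)
    (by simp only [Multiset.card_add, Multiset.card_singleton, card_sq]; omega)
  refine ⟨_, ?_, hSn, hSW, ?_, ?_⟩
  · refine hSc.trans ?_
    simp only [Multiset.card_add, Multiset.card_singleton, card_sq]; omega
  · rw [Fin.sum_univ_two]
    have e0 := (hS 0).2
    have e1 := (hS 1).2
    simp only [Matrix.cons_val] at e0 e1
    have := add_mem (add_mem e0 e1) cyc1
    convert this using 1
    abel
  · rw [Fin.sum_univ_two]
    have e0 := (hS 0).1
    have e1 := (hS 1).1
    simp only [Matrix.cons_val] at e0 e1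
    have := add_mem (add_mem e0 e1) cyc2
    convert this using 1
    abel

end Abs

namespace Abs

open Finset

variable {k n : ℕ} [NeZero k] {A : ZMod k → Fin n → Fin n → Prop}

lemma tr_eq_sq (c : ZMod k → Fin n) : tr c = sq 0 (fun j => c j) k := by
  unfold sq tr
  refine Finset.sum_bij' (fun x _ => x.val) (fun j _ => (j : ZMod k)) ?_ ?_ ?_ ?_ ?_
  · intro x _; simpa using ZMod.val_lt _
  · simp
  · intro x _; simp
  · intro j hj
    rw [ZMod.val_natCast, Nat.mod_eq_of_lt (by simpa using hj)]
  · intro x hx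
    simp

/-- the size of an absorber -/
def absSize (k : ℕ) : ℕ := k + k * (30 * k + 50)

lemma absorber {a B D m q h g : ℕ} (P : Par A a B D m q h g) (κ : ZMod k → Fin n)
    (W : Finset (ZMod k × Fin n)) (hW : W.card + absSize k ≤ B) :
    ∃ M : Multiset (ZMod k × Fin n), M.card ≤ absSize k ∧ M.Nodup ∧ (∀ v ∈ M, v ∉ W) ∧
      (M ∈ F A ∧ M + tr κ ∈ F A) := by
  classical
  have hk := P.hk
  have hA := P.hA
  have hg := P.hg
  have hgD := P.gD
  have hDn := P.Dn
  obtain ⟨u, hu⟩ : ∃ u : Fin n, (0, u) ∉ W := by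
    have := card_avoid W 0 (univ : Finset (Fin n))
    simp only [Finset.card_univ, Fintype.card_fin] at this
    obtain ⟨u, hu⟩ := Finset.card_pos.1
      (show 0 < ((univ : Finset (Fin n)).filter (fun p => (0, p) ∉ W)).card by omega)
    exact ⟨u, (Finset.mem_filter.1 hu).2⟩
  obtain ⟨w, h1, h2⟩ := exists_cyc hk hA 0 (fun j => (if j = 0 then outN A 0 u else
    if j = k - 2 then inN A 0 u else univ).filter
      (fun v => (0 + 1 + (j : ZMod k), v) ∉ W)) (by
      intro j hj
      refine Nat.le_of_add_le_add_right (le_trans ?_ (card_avoid W _ _))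
      split_ifs
      · have := P.hDo 0 u; omega
      · have := P.hDi 0 u; omega
      · simp; omega)
  have hF := h2 u (by intro v hv; simp at hv; exact hv.1) (by
    have : k - 2 ≠ 0 := by omega
    intro v hv
    simp [this] at hv; exact hv.1)
  set w' : ℕ → Fin n := fun j => match j with
    | 0 => u
    | j + 1 => w j with hw'
  have hC : {((0 : ZMod k), u)} + sq (0 + 1) w (k - 1) = sq 0 w' k := by
    have := sq_cons (0 : ZMod k) w' (k - 1)
    rw [Nat.sub_add_cancel (by omega)] at this
    exact this.symm
  rw [hC] at hF
  have hCW : ∀ v ∈ sq 0 w' k, v ∉ W := by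
    rw [← hC]
    intro v hv
    rcases Multiset.mem_add.1 hv with hv | hv
    · rw [Multiset.mem_singleton] at hv; rw [hv]; exact hu
    · obtain ⟨j, hj, rfl⟩ := mem_sq.1 hv
      exact (Finset.mem_filter.1 (h1 j hj)).2
  obtain ⟨S, hS, hSn, hSW, hSc⟩ := core_ext (A := A) (B := B) (s := 30 * k + 50) k
    (fun e => ((0 : ZMod k) + ((e : ℕ) : ZMod k), κ (e : ℕ)))
    (fun e => ((0 : ZMod k) + ((e : ℕ) : ZMod k), w' e))
    (fun e => reach P _ _ _) W (sq 0 w' k) (nodup_sq _ _ _ le_rfl) hCW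
    (by rw [card_sq]; unfold absSize at hW; omega)
  refine ⟨_, ?_, hSn, hSW, ?_, ?_⟩
  · refine hSc.trans ?_
    rw [card_sq]; rfl
  · have : sq 0 w' k = ∑ e : Fin k, {((0 : ZMod k) + ((e : ℕ) : ZMod k), w' e)} := by
      unfold sq
      rw [Fin.sum_univ_eq_sum_range (fun j => ({((0 : ZMod k) + (j : ZMod k), w' j)} : Multiset _))]
    rw [this, ← Finset.sum_add_distrib]
    exact sum_mem (fun e _ => (hS e).2)
  · have : tr κ = ∑ e : Fin k, {((0 : ZMod k) + ((e : ℕ) : ZMod k), κ (e : ℕ))} := by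
      rw [tr_eq_sq]
      unfold sq
      rw [Fin.sum_univ_eq_sum_range
        (fun j => ({((0 : ZMod k) + (j : ZMod k), κ j)} : Multiset _))]
    rw [this, add_assoc, ← Finset.sum_add_distrib]
    refine add_mem hF (sum_mem (fun e _ => ?_))
    rw [add_comm]
    exact (hS e).1

end Abs

namespace Abs

open Finset

/-! ## Expanders by counting and the template -/

lemma self_pow_le (s : ℕ) : s ^ s ≤ 3 ^ s * s.factorial := by
  have h1 := Real.pow_div_factorial_le_exp (s : ℝ) (by positivity) s
  have h2 : Real.exp (s : ℝ) ≤ 3 ^ s := by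
    rw [← Real.exp_one_pow]
    have := Real.exp_one_lt_three
    gcongr
  have h3 : (0 : ℝ) < s.factorial := by positivity
  rw [div_le_iff₀ h3] at h1
  have h4 : (s : ℝ) ^ s ≤ 3 ^ s * s.factorial := h1.trans (by gcongr)
  exact_mod_cast h4

lemma choose_pow_le (A s : ℕ) : A.choose s * s ^ s ≤ (3 * A) ^ s := by
  have h1 := self_pow_le s
  have h2 : A.choose s * s.factorial ≤ A ^ s := by
    rw [mul_comm, ← Nat.descFactorial_eq_factorial_mul_choose]
    exact Nat.descFactorial_le_pow A s
  calc A.choose s * s ^ s ≤ A.choose s * (3 ^ s * s.factorial) := by gcongr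
    _ = 3 ^ s * (A.choose s * s.factorial) := by ring
    _ ≤ 3 ^ s * A ^ s := by gcongr
    _ = _ := by rw [mul_pow]

lemma term_le (A B s : ℕ) (hA : A ≤ 2 * B) (hs : 3 * s ≤ 2 * B) :
    4 ^ s * (A.choose s * B.choose s * (s ^ 13) ^ s) ≤ (B ^ 13) ^ s := by
  have h1 := choose_pow_le A s
  have h2 := choose_pow_le B s
  have h3 : (3 * s) ^ 11 ≤ (2 * B) ^ 11 := by gcongr
  have h4 : 72 * s ^ 11 ≤ B ^ 11 := by
    rw [mul_pow, mul_pow] at h3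
    norm_num at h3
    omega
  calc 4 ^ s * (A.choose s * B.choose s * (s ^ 13) ^ s)
      = (A.choose s * s ^ s) * (B.choose s * s ^ s) * (4 * s ^ 11) ^ s := by
        rw [mul_pow, ← pow_mul, ← pow_mul]; ring
    _ ≤ (3 * (2 * B)) ^ s * (3 * B) ^ s * (4 * s ^ 11) ^ s := by
        gcongr
        exact h1.trans (by gcongr)
    _ = (B ^ 2 * (72 * s ^ 11)) ^ s := by rw [← mul_pow, ← mul_pow]; ring_nf
    _ ≤ (B ^ 2 * B ^ 11) ^ s := by gcongr
    _ = _ := by ring_nf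

lemma geom_le (m : ℕ) : ∑ s ∈ Icc 1 m, (1 / 4 : ℝ) ^ s ≤ (1 - (1 / 4) ^ m) / 3 := by
  induction m with
  | zero => simp
  | succ m ih =>
    rw [Finset.sum_Icc_succ_top (by omega)]
    rw [pow_succ]
    linarith

lemma expander (A B : ℕ) (hA : A ≤ 2 * B) : ∃ H : Fin A → Fin 13 → Fin B,
    ∀ S : Finset (Fin A), 3 * S.card ≤ 2 * B →
      S.card ≤ (S.biUnion fun a => univ.image (H a)).card := by
  classical
  by_contra hcon
  push Not at hcon
  rcases Nat.eq_zero_or_pos B with rfl | hB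
  · have : A = 0 := by omega
    subst this
    obtain ⟨S, h1, h2⟩ := hcon (fun a => a.elim0)
    rw [Finset.eq_empty_of_isEmpty S] at h2
    simp at h2
  let bad : Finset (Fin A) → Finset (Fin B) → Finset (Fin A → Fin 13 → Fin B) := fun S T =>
    Fintype.piFinset (fun a => if a ∈ S then Fintype.piFinset (fun _ => T) else univ)
  have hcard : ∀ s, ∀ S ∈ powersetCard s (univ : Finset (Fin A)),
      ∀ T ∈ powersetCard s (univ : Finset (Fin B)),
      (bad S T).card = (s ^ 13) ^ s * (B ^ 13) ^ (A - s) := by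
    intro s S hS T hT
    have hS := (Finset.mem_powersetCard.1 hS).2
    have hT := (Finset.mem_powersetCard.1 hT).2
    simp only [bad, Fintype.card_piFinset]
    have : ∀ a, (if a ∈ S then Fintype.piFinset (fun _ : Fin 13 => T) else univ).card
        = if a ∈ S then s ^ 13 else B ^ 13 := by
      intro a
      split_ifs <;> simp [hT]
    simp only [this]
    rw [Finset.prod_ite]
    simp only [Finset.prod_const]
    have e1 : (univ.filter (fun a => a ∈ S)).card = s := by simp [hS]
    have e2 : (univ.filter (fun a => a ∉ S)).card = A - s := by
      have := Finset.card_filter_add_card_filter_not (s := (univ : Finset (Fin A))) (fun a => a ∈ S)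
      rw [e1] at this
      simp only [Finset.card_univ, Fintype.card_fin] at this
      omega
    rw [e1, e2]
  have hcov : (univ : Finset (Fin A → Fin 13 → Fin B)) ⊆
      (Icc 1 (2 * B / 3)).biUnion fun s => (powersetCard s (univ : Finset (Fin A))).biUnion
        fun S => (powersetCard s (univ : Finset (Fin B))).biUnion fun T => bad S T := by
    intro H _
    obtain ⟨S, h1, h2⟩ := hcon H
    obtain ⟨T, hT1, -, hT2⟩ := Finset.exists_subsuperset_card_eq
      (Finset.subset_univ (S.biUnion fun a => univ.image (H a))) h2.le (by simp; omega)
    simp only [Finset.mem_biUnion, Finset.mem_Icc, Finset.mem_powersetCard]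
    refine ⟨S.card, ⟨by omega, by omega⟩, S, ⟨by simp, rfl⟩, T, ⟨by simp, hT2⟩, ?_⟩
    simp only [bad, Fintype.mem_piFinset]
    intro a
    split_ifs with ha
    · rw [Fintype.mem_piFinset]
      intro j
      exact hT1 (Finset.mem_biUnion.2 ⟨a, ha, by simp⟩)
    · simp
  have h1 : (B ^ 13) ^ A ≤ ∑ s ∈ Icc 1 (2 * B / 3),
      A.choose s * B.choose s * ((s ^ 13) ^ s * (B ^ 13) ^ (A - s)) := by
    have e0 := Finset.card_le_card hcov
    have e1 : (univ : Finset (Fin A → Fin 13 → Fin B)).card = (B ^ 13) ^ A := by simp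
    rw [e1] at e0
    refine e0.trans (Finset.card_biUnion_le.trans (Finset.sum_le_sum ?_))
    intro s hs
    refine Finset.card_biUnion_le.trans ?_
    have : ∀ S ∈ powersetCard s (univ : Finset (Fin A)),
        ((powersetCard s (univ : Finset (Fin B))).biUnion fun T => bad S T).card ≤
        B.choose s * ((s ^ 13) ^ s * (B ^ 13) ^ (A - s)) := by
      intro S hS
      refine Finset.card_biUnion_le.trans ?_
      rw [Finset.sum_congr rfl (hcard s S hS)]
      simp
    refine (Finset.sum_le_sum this).trans ?_
    simp [mul_assoc]
  have h2 : ∀ s ∈ Icc 1 (2 * B / 3),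
      ((A.choose s * B.choose s * ((s ^ 13) ^ s * (B ^ 13) ^ (A - s)) : ℕ) : ℝ) ≤
        (1 / 4) ^ s * ((B : ℝ) ^ 13) ^ A := by
    intro s hs
    have hs := Finset.mem_Icc.1 hs
    have hpos : (0 : ℝ) ≤ (1 / 4) ^ s * ((B : ℝ) ^ 13) ^ A := by positivity
    by_cases hsA : s ≤ A
    · have t := term_le A B s hA (by omega)
      have t' : 4 ^ s * (A.choose s * B.choose s * ((s ^ 13) ^ s * (B ^ 13) ^ (A - s)))
          ≤ (B ^ 13) ^ A := by
        calc _ = (4 ^ s * (A.choose s * B.choose s * (s ^ 13) ^ s)) * (B ^ 13) ^ (A - s) := by ring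
          _ ≤ (B ^ 13) ^ s * (B ^ 13) ^ (A - s) := by gcongr
          _ = _ := by rw [← pow_add]; congr 1; omega
      have t'' : (4 : ℝ) ^ s *
          ((A.choose s * B.choose s * ((s ^ 13) ^ s * (B ^ 13) ^ (A - s)) : ℕ) : ℝ)
          ≤ ((B : ℝ) ^ 13) ^ A := by exact_mod_cast t'
      rw [one_div, inv_pow, inv_mul_eq_div, le_div_iff₀ (by positivity), mul_comm]
      exact t''
    · rw [Nat.choose_eq_zero_of_lt (by omega)]
      simpa using hpos
  have h3 : ((B : ℝ) ^ 13) ^ A ≤ ∑ s ∈ Icc 1 (2 * B / 3), (1 / 4) ^ s * ((B : ℝ) ^ 13) ^ A := by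
    refine le_trans ?_ (Finset.sum_le_sum h2)
    exact_mod_cast h1
  rw [← Finset.sum_mul] at h3
  have h4 := geom_le (2 * B / 3)
  have h5 : (0 : ℝ) < ((B : ℝ) ^ 13) ^ A := by positivity
  have h6 : (0 : ℝ) < (1 / 4) ^ (2 * B / 3) := by positivity
  nlinarith

lemma template (x r : ℕ) (hx : 2 ≤ x) (hr : r ≤ x) :
    ∃ E : Finset ((Fin x ⊕ Fin (3 * x + r)) × Fin (4 * x)), E.card ≤ 117 * x ∧
      ∀ X' : Finset (Fin x), X'.card + r = x →
        ∃ φ : Fin (4 * x) → Fin x ⊕ Fin (3 * x + r), Function.Injective φ ∧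
          (∀ z, (φ z, z) ∈ E) ∧ ∀ l, (∃ z, φ z = l) ↔ (∀ p, l = Sum.inl p → p ∈ X') := by
  classical
  obtain ⟨f, hf⟩ := expander (4 * x) (3 * x + r) (by omega)
  obtain ⟨g', hg'⟩ := expander (x + (3 * x + r)) (4 * x) (by omega)
  set g : Fin x ⊕ Fin (3 * x + r) → Fin 13 → Fin (4 * x) := fun l => g' (finSumFinEquiv l) with hgdef
  have hg : ∀ S : Finset (Fin x ⊕ Fin (3 * x + r)), 3 * S.card ≤ 2 * (4 * x) →
      S.card ≤ (S.biUnion fun a => univ.image (g a)).card := by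
    intro S hS
    have := hg' (S.map finSumFinEquiv.toEmbedding) (by rwa [Finset.card_map])
    rw [Finset.card_map] at this
    refine this.trans (Finset.card_le_card ?_)
    intro v hv
    simp only [Finset.mem_biUnion, Finset.mem_map, Finset.mem_image] at hv ⊢
    obtain ⟨_, ⟨l, hl, rfl⟩, j, _, rfl⟩ := hv
    exact ⟨l, hl, j, by simp, rfl⟩
  refine ⟨univ.image (fun p : Fin (4 * x) × Fin 13 => (Sum.inr (f p.1 p.2), p.1)) ∪
    univ.image (fun p : (Fin x ⊕ Fin (3 * x + r)) × Fin 13 => (p.1, g p.1 p.2)), ?_, ?_⟩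
  · refine (Finset.card_union_le _ _).trans ?_
    have e1 := Finset.card_image_le (s := (univ : Finset (Fin (4 * x) × Fin 13)))
      (f := fun p => ((Sum.inr (f p.1 p.2) : Fin x ⊕ Fin (3 * x + r)), p.1))
    have e2 := Finset.card_image_le
      (s := (univ : Finset ((Fin x ⊕ Fin (3 * x + r)) × Fin 13)))
      (f := fun p => (p.1, g p.1 p.2))
    simp only [Finset.card_univ, Fintype.card_prod, Fintype.card_fin, Fintype.card_sum] at e1 e2
    omega
  intro X' hX'
  set E := univ.image (fun p : Fin (4 * x) × Fin 13 =>
      ((Sum.inr (f p.1 p.2) : Fin x ⊕ Fin (3 * x + r)), p.1)) ∪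
    univ.image (fun p : (Fin x ⊕ Fin (3 * x + r)) × Fin 13 => (p.1, g p.1 p.2)) with hE
  set L' : Finset (Fin x ⊕ Fin (3 * x + r)) := X'.disjSum univ with hL'
  have hL'c : L'.card = 4 * x := by
    rw [hL', Finset.card_disjSum]; simp; omega
  have hall := (Finset.all_card_le_biUnion_card_iff_exists_injective
    (fun z : Fin (4 * x) => L'.filter (fun l => (l, z) ∈ E))).1 (by
    intro S
    by_cases hS : 3 * S.card ≤ 2 * (3 * x + r)
    · have := hf S hS
      refine this.trans ?_
      rw [← Finset.card_map (⟨Sum.inr, Sum.inr_injective⟩ :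
        Fin (3 * x + r) ↪ Fin x ⊕ Fin (3 * x + r))]
      refine Finset.card_le_card ?_
      intro v hv
      simp only [Finset.mem_biUnion, Finset.mem_map, Finset.mem_image,
        Function.Embedding.coeFn_mk] at hv
      obtain ⟨_, ⟨z, hz, j, -, rfl⟩, rfl⟩ := hv
      simp only [Finset.mem_biUnion, Finset.mem_filter]
      refine ⟨z, hz, by simp [hL'], ?_⟩
      rw [hE]
      exact Finset.mem_union_left _ (Finset.mem_image.2 ⟨(z, j), by simp, rfl⟩)
    · set NS := S.biUnion (fun z : Fin (4 * x) => L'.filter (fun l => (l, z) ∈ E)) with hNS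
      have hNSL : NS ⊆ L' := by
        intro l hl
        obtain ⟨z, _, hl⟩ := Finset.mem_biUnion.1 hl
        exact (Finset.mem_filter.1 hl).1
      have key : ∀ T ⊆ L' \ NS, 3 * T.card ≤ 2 * (4 * x) → T.card + S.card ≤ 4 * x := by
        intro T hT hTc
        have h1 := hg T hTc
        have h2 : Disjoint (T.biUnion fun a => univ.image (g a)) S := by
          rw [Finset.disjoint_left]
          intro z hz hzS
          simp only [Finset.mem_biUnion, Finset.mem_image] at hz
          obtain ⟨l, hl, j, -, rfl⟩ := hz
          have hl' := Finset.mem_sdiff.1 (hT hl)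
          apply hl'.2
          rw [hNS]
          refine Finset.mem_biUnion.2 ⟨_, hzS, Finset.mem_filter.2 ⟨hl'.1, ?_⟩⟩
          rw [hE]
          exact Finset.mem_union_right _ (Finset.mem_image.2 ⟨(l, j), by simp, rfl⟩)
        have h3 := Finset.card_union_of_disjoint h2
        have h4 := Finset.card_le_univ ((T.biUnion fun a => univ.image (g a)) ∪ S)
        rw [Fintype.card_fin] at h4
        omega
      have hsd := Finset.card_sdiff_add_card_eq_card hNSL
      by_cases hT : 3 * (L' \ NS).card ≤ 2 * (4 * x)
      · have := key _ subset_rfl hT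
        omega
      · obtain ⟨T, hT1, hT2⟩ := Finset.exists_subset_card_eq (s := L' \ NS) (n := 2 * x)
          (by omega)
        have := key T hT1 (by omega)
        omega)
  obtain ⟨φ, h1, h2⟩ := hall
  have h3 : ∀ z, φ z ∈ L' := fun z => (Finset.mem_filter.1 (h2 z)).1
  have h4 : univ.image φ = L' := by
    apply Finset.eq_of_subset_of_card_le
    · intro l hl
      obtain ⟨z, _, rfl⟩ := Finset.mem_image.1 hl
      exact h3 z
    · rw [Finset.card_image_of_injective _ h1, hL'c]; simp
  refine ⟨φ, h1, fun z => (Finset.mem_filter.1 (h2 z)).2, ?_⟩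
  intro l
  have : (∃ z, φ z = l) ↔ l ∈ L' := by rw [← h4]; simp
  rw [this, hL']
  rcases l with p | p <;> simp

end Abs

namespace Abs

open Finset

variable {k n : ℕ} [NeZero k] {A : ZMod k → Fin n → Fin n → Prop}

lemma F_bal {m : Multiset (ZMod k × Fin n)} (hm : m ∈ F A) :
    ∃ N : ℕ, (∀ j : ZMod k, m.countP (fun v => v.1 = j) = N) ∧ m.card = k * N := by
  classical
  induction hm using AddSubmonoid.closure_induction with
  | mem m hm =>
    obtain ⟨c, -, rfl⟩ := hm
    refine ⟨1, ?_, ?_⟩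
    · intro j
      unfold tr
      rw [← Multiset.coe_countPAddMonoidHom, map_sum]
      rw [Finset.sum_eq_single j]
      · simp [Multiset.countP_eq_card_filter, Multiset.filter_singleton]
      · intro i _ hi
        simp [Multiset.countP_eq_card_filter, Multiset.filter_singleton, hi]
      · simp
    · unfold tr
      simp [ZMod.card]
  | zero => exact ⟨0, by simp⟩
  | add m m' _ _ h h' =>
    obtain ⟨N, h1, h2⟩ := h
    obtain ⟨N', h1', h2'⟩ := h'
    refine ⟨N + N', ?_, ?_⟩
    · intro j
      rw [Multiset.countP_add, h1, h1']
    · rw [Multiset.card_add, h2, h2']; ring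

/-- Cover a set greedily by cycles whose remaining vertices lie in `X`. -/
lemma cover (hk : 4 ≤ k) {a : ℕ} (hA : Hole A a) (X : ZMod k → Finset (Fin n)) (T : ℕ)
    (ho : ∀ i p, 2 * a + 1 + T ≤ (outN A i p ∩ X (i + 1)).card)
    (hi : ∀ i p, 2 * a + 1 + T ≤ (inN A i p ∩ X (i - 1)).card)
    (hX : ∀ i, 2 * a + 1 + T ≤ (X i).card) (U : Finset (ZMod k × Fin n))
    (hU : (k - 1) * U.card ≤ T) :
    ∃ D : Finset (ZMod k × Fin n), D.card = (k - 1) * U.card ∧ (∀ v ∈ D, v.2 ∈ X v.1) ∧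
      U.val + D.val ∈ F A := by
  classical
  induction U using Finset.induction_on with
  | empty => exact ⟨∅, by simp⟩
  | insert u U hu ih =>
    rw [Finset.card_insert_of_notMem hu, mul_add, mul_one] at hU
    obtain ⟨D, h1, h2, h3⟩ := ih (by omega)
    obtain ⟨i, p⟩ := u
    have hk2 : i + 1 + ((k - 2 : ℕ) : ZMod k) = i - 1 := by
      rw [Nat.cast_sub (by omega), ZMod.natCast_self]; push_cast; ring
    have hk2' : k - 2 ≠ 0 := by omega
    obtain ⟨w, w1, w2⟩ := exists_cyc hk hA i (fun j => ((if j = 0 then outN A i p else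
      if j = k - 2 then inN A i p else univ) ∩ X (i + 1 + (j : ZMod k))).filter
      (fun v => (i + 1 + (j : ZMod k), v) ∉ D)) (by
      intro j hj
      refine Nat.le_of_add_le_add_right (le_trans ?_ (card_avoid D _ _))
      have : 2 * a + 1 + T ≤ ((if j = 0 then outN A i p else
          if j = k - 2 then inN A i p else univ) ∩ X (i + 1 + (j : ZMod k))).card := by
        split_ifs with hj0 hj1
        · subst hj0; simpa using ho i p
        · subst hj1; rw [hk2]; exact hi i p
        · simpa using hX _
      omega)
    have hF := w2 p (by intro v hv; simp at hv; exact hv.1.1) (by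
      intro v hv
      simp [hk2'] at hv; exact hv.1.1)
    have hnd := nodup_sq (i + 1) w (k - 1) (by omega)
    have hdis : Disjoint D (sq (i + 1) w (k - 1)).toFinset := by
      rw [Finset.disjoint_right]
      intro v hv
      obtain ⟨j, hj, rfl⟩ := mem_sq.1 (Multiset.mem_toFinset.1 hv)
      exact (Finset.mem_filter.1 (w1 j hj)).2
    refine ⟨D.disjUnion (sq (i + 1) w (k - 1)).toFinset hdis, ?_, ?_, ?_⟩
    · rw [Finset.card_disjUnion, Multiset.toFinset_card_of_nodup hnd, card_sq, h1,
        Finset.card_insert_of_notMem hu, mul_add, mul_one]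
    · intro v hv
      rcases Finset.mem_disjUnion.1 hv with hv | hv
      · exact h2 v hv
      · obtain ⟨j, hj, rfl⟩ := mem_sq.1 (Multiset.mem_toFinset.1 hv)
        exact (Finset.mem_inter.1 (Finset.mem_filter.1 (w1 j hj)).1).2
    · have e1 : (D.disjUnion (sq (i + 1) w (k - 1)).toFinset hdis).val
          = D.val + sq (i + 1) w (k - 1) := by
        rw [Finset.disjUnion_val, Multiset.toFinset_val, hnd.dedup]
      have e2 : (insert (i, p) U).val = {(i, p)} + U.val := by
        rw [Finset.insert_val_of_notMem hu, Multiset.singleton_add]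
      rw [e1, e2]
      have := add_mem h3 hF
      convert this using 1
      abel

/-- A small set meeting many given large sets in many points. -/
lemma sample {ι : Type*} [Fintype ι] (b h D : ℕ) (hb : 0 < b) (N : ι → Finset (Fin n))
    (hD : ∀ e, D ≤ (N e).card) (hh : 4 * b * h ≤ D)
    (hexp : (Fintype.card ι : ℝ) * b * Real.exp (-(D / (4 * b))) < 1) :
    ∃ X : Finset (Fin n), b * X.card ≤ n ∧ ∀ e, h ≤ (N e ∩ X).card := by
  classical
  have hbR : (0 : ℝ) < b := by exact_mod_cast hb
  let fib : (Fin n → Fin b) → Fin b → Finset (Fin n) := fun χ c => univ.filter (fun p => χ p = c)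
  -- the exponential moment
  have mom : ∀ (e : ι) (c : Fin b),
      ∑ χ : Fin n → Fin b, ((1 : ℝ) / 2) ^ (N e ∩ fib χ c).card ≤
        (b : ℝ) ^ n * Real.exp (-(D / (2 * b))) := by
    intro e c
    have e1 : ∀ χ : Fin n → Fin b, ((1 : ℝ) / 2) ^ (N e ∩ fib χ c).card =
        ∏ p, (if p ∈ N e ∧ χ p = c then (1 / 2 : ℝ) else 1) := by
      intro χ
      rw [Finset.prod_ite]
      have e0 : N e ∩ fib χ c = univ.filter (fun p => p ∈ N e ∧ χ p = c) := by
        ext p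
        simp [fib]
      rw [e0]
      simp [Finset.prod_const]
    simp only [e1]
    have e2 := Finset.prod_univ_sum (fun _ : Fin n => (univ : Finset (Fin b)))
      (fun p c' => if p ∈ N e ∧ c' = c then (1 / 2 : ℝ) else 1)
    rw [Fintype.piFinset_univ] at e2
    rw [← e2]
    have e3 : ∀ p : Fin n, ∑ c' : Fin b, (if p ∈ N e ∧ c' = c then (1 / 2 : ℝ) else 1) =
        b * (if p ∈ N e then (1 - 1 / (2 * b) : ℝ) else 1) := by
      intro p
      by_cases hp : p ∈ N e
      · simp only [hp, true_and, if_true]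
        have : ∀ c' : Fin b, (if c' = c then (1 / 2 : ℝ) else 1) =
            1 - (if c' = c then (1 / 2 : ℝ) else 0) := by
          intro c'; split_ifs <;> norm_num
        simp only [this]
        rw [Finset.sum_sub_distrib]
        simp
        field_simp
      · simp [hp]
    simp only [e3]
    rw [Finset.prod_mul_distrib, Finset.prod_ite]
    simp only [Finset.prod_const, one_pow, mul_one, Finset.card_univ, Fintype.card_fin]
    have e4 : (univ.filter (fun p => p ∈ N e)) = N e := by ext; simp
    rw [e4]
    gcongr
    have hb1 : (1 : ℝ) ≤ b := by exact_mod_cast hb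
    have e5 : (0 : ℝ) ≤ 1 - 1 / (2 * b) := by
      rw [sub_nonneg, div_le_one (by positivity)]; linarith
    have e6 : 1 - 1 / (2 * (b : ℝ)) ≤ Real.exp (-(1 / (2 * b))) := by
      have := Real.add_one_le_exp (-(1 / (2 * (b : ℝ))))
      linarith
    calc (1 - 1 / (2 * (b : ℝ))) ^ (N e).card ≤ Real.exp (-(1 / (2 * b))) ^ (N e).card := by
          gcongr
      _ = Real.exp (-((N e).card / (2 * b))) := by
          rw [← Real.exp_nat_mul]; congr 1; ring
      _ ≤ _ := by
          apply Real.exp_le_exp.2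
          have : (D : ℝ) ≤ (N e).card := by exact_mod_cast hD e
          gcongr
  obtain ⟨χ, hχ⟩ : ∃ χ : Fin n → Fin b, ∀ e c, h ≤ (N e ∩ fib χ c).card := by
    by_contra hcon
    push Not at hcon
    have key : (b : ℝ) ^ n * (1 / 2) ^ h ≤
        ∑ χ : Fin n → Fin b, ∑ ec : ι × Fin b, ((1 : ℝ) / 2) ^ (N ec.1 ∩ fib χ ec.2).card := by
      have : ∀ χ ∈ (univ : Finset (Fin n → Fin b)), ((1 : ℝ) / 2) ^ h ≤
          ∑ ec : ι × Fin b, ((1 : ℝ) / 2) ^ (N ec.1 ∩ fib χ ec.2).card := by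
        intro χ _
        obtain ⟨e, c, hec⟩ := hcon χ
        refine le_trans ?_ (Finset.single_le_sum (f := fun ec : ι × Fin b =>
          ((1 : ℝ) / 2) ^ (N ec.1 ∩ fib χ ec.2).card) (fun _ _ => by positivity)
          (Finset.mem_univ (e, c)))
        exact pow_le_pow_of_le_one (by norm_num) (by norm_num) hec.le
      have := Finset.sum_le_sum this
      simpa using this
    rw [Finset.sum_comm] at key
    have key2 := key.trans (Finset.sum_le_sum (fun ec _ => mom ec.1 ec.2))
    simp only [Finset.sum_const, Finset.card_univ, Fintype.card_prod, Fintype.card_fin,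
      nsmul_eq_mul] at key2
    push_cast at key2
    have hpow : (0 : ℝ) < (b : ℝ) ^ n := by positivity
    have key3 : ((1 : ℝ) / 2) ^ h ≤ Fintype.card ι * b * Real.exp (-(D / (2 * b))) := by
      have : (b : ℝ) ^ n * (1 / 2) ^ h ≤
          (b : ℝ) ^ n * (Fintype.card ι * b * Real.exp (-(D / (2 * b)))) := by
        linarith
      exact le_of_mul_le_mul_left this hpow
    have hh' : (4 * b * h : ℝ) ≤ D := by exact_mod_cast hh
    have k4 : Real.exp (-(D / (4 * b))) ≤ ((1 : ℝ) / 2) ^ h := by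
      have : Real.exp (-1) ≤ 1 / 2 := by
        have h1 := Real.add_one_le_exp (1 : ℝ)
        rw [Real.exp_neg, ← one_div]
        apply one_div_le_one_div_of_le <;> linarith
      calc Real.exp (-(D / (4 * b))) ≤ Real.exp (-h) := by
            apply Real.exp_le_exp.2
            rw [neg_le_neg_iff, le_div_iff₀ (by positivity)]
            linarith
        _ = Real.exp (-1) ^ h := by rw [← Real.exp_nat_mul]; congr 1; ring
        _ ≤ _ := by gcongr
    have k5 : Real.exp (-((D : ℝ) / (2 * b))) =
        Real.exp (-(D / (4 * b))) * Real.exp (-(D / (4 * b))) := by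
      rw [← Real.exp_add]; congr 1; field_simp; ring
    rw [k5] at key3
    have k6 := Real.exp_pos (-((D : ℝ) / (4 * b)))
    nlinarith
  obtain ⟨c, hc⟩ : ∃ c, b * (fib χ c).card ≤ n := by
    by_contra hcon
    push Not at hcon
    have e1 : ∑ c : Fin b, (fib χ c).card = n := by
      have := Finset.card_eq_sum_card_fiberwise (f := χ) (s := univ) (t := univ) (by simp)
      simpa using this.symm
    have e2 : ∑ c : Fin b, (n + 1) ≤ ∑ c : Fin b, b * (fib χ c).card :=
      Finset.sum_le_sum (fun c _ => hcon c)
    rw [← Finset.mul_sum, e1] at e2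
    simp only [Finset.sum_const, Finset.card_univ, Fintype.card_fin, smul_eq_mul] at e2
    nlinarith
  exact ⟨fib χ c, hc, fun e => hχ e c⟩

end Abs

namespace Abs

open Finset

variable {k n : ℕ} [NeZero k] {A : ZMod k → Fin n → Fin n → Prop}

lemma countP_val (U : Finset (ZMod k × Fin n)) (j : ZMod k) :
    U.val.countP (fun v => v.1 = j) = (U.filter (fun v => v.1 = j)).card := by
  rw [Multiset.countP_eq_card_filter]
  rfl

lemma exact_cover (hk : 4 ≤ k) {a : ℕ} (hA : Hole A a) (X : ZMod k → Finset (Fin n)) (r : ℕ)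
    (ho : ∀ i p, 2 * a + 1 + 2 * k * r ≤ (outN A i p ∩ X (i + 1)).card)
    (hi : ∀ i p, 2 * a + 1 + 2 * k * r ≤ (inN A i p ∩ X (i - 1)).card)
    (hX : ∀ i, 2 * a + 1 + 2 * k * r ≤ (X i).card) (U : Finset (ZMod k × Fin n))
    (hUX : ∀ v ∈ U, v.2 ∉ X v.1) (u0 : ℕ) (hu0 : ∀ j, (U.filter (fun v => v.1 = j)).card = u0)
    (hU : U.card ≤ r) :
    ∃ D : Finset (ZMod k × Fin n), (∀ v ∈ D, v.2 ∈ X v.1) ∧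
      (∀ j, (D.filter (fun v => v.1 = j)).card = r) ∧ U.val + D.val ∈ F A := by
  classical
  have hUc : U.card = k * u0 := by
    have := Finset.card_eq_sum_card_fiberwise (f := fun v : ZMod k × Fin n => v.1) (s := U)
      (t := univ) (by simp)
    rw [this, Finset.sum_congr rfl (fun j _ => hu0 j)]
    simp [ZMod.card]
  obtain ⟨K, hK⟩ : ∃ K, k = K + 1 := ⟨k - 1, by omega⟩
  have hKu : K * u0 ≤ r := by
    have : k * u0 = K * u0 + u0 := by rw [hK]; ring
    omega
  obtain ⟨e, he⟩ : ∃ e, K * u0 + e = r := ⟨r - K * u0, by omega⟩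
  have hkr : 2 * k * r = 2 * (K * r) + 2 * r := by rw [hK]; ring
  obtain ⟨Xp0, hXp, hXpc⟩ := Finset.exists_subset_card_eq (s := X 0) (n := e) (by
    have := hX 0; omega)
  let emb : Fin n ↪ ZMod k × Fin n := ⟨fun p => (0, p), fun p q h => by simpa using h⟩
  set Xp := Xp0.map emb with hXpdef
  have hXpX : ∀ v ∈ Xp, v.2 ∈ X v.1 := by
    intro v hv
    obtain ⟨p, hp, rfl⟩ := Finset.mem_map.1 hv
    exact hXp hp
  have hXpcard : Xp.card = e := by rw [hXpdef, Finset.card_map, hXpc]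
  have hdis : Disjoint U Xp := by
    rw [Finset.disjoint_left]
    intro v hv hv'
    exact hUX v hv (hXpX v hv')
  have hU'c : (U.disjUnion Xp hdis).card = U.card + e := by
    rw [Finset.card_disjUnion, hXpcard]
  have hbound : K * (U.card + e) + e ≤ 2 * k * r := by
    have h1 : U.card + e ≤ 2 * r := by omega
    have h2 := Nat.mul_le_mul_left K h1
    have h3 : K * (2 * r) = 2 * (K * r) := by ring
    omega
  have hk1 : k - 1 = K := by omega
  obtain ⟨D, d1, d2, d3⟩ := cover hk hA (fun j => (X j).filter (fun p => (j, p) ∉ Xp))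
    (K * (U.card + e))
    (by
      intro i p
      rw [Finset.inter_filter]
      have := card_avoid Xp (i + 1) (outN A i p ∩ X (i + 1))
      have := ho i p
      omega)
    (by
      intro i p
      rw [Finset.inter_filter]
      have := card_avoid Xp (i - 1) (inN A i p ∩ X (i - 1))
      have := hi i p
      omega)
    (by
      intro i
      have := card_avoid Xp i (X i)
      have := hX i
      omega) (U.disjUnion Xp hdis) (by rw [hU'c, hk1])
  have hdis2 : Disjoint D Xp := by
    rw [Finset.disjoint_left]
    intro v hv hv'
    exact (Finset.mem_filter.1 (d2 v hv)).2 hv'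
  rw [hU'c, hk1] at d1
  have hF : U.val + (D.disjUnion Xp hdis2).val ∈ F A := by
    rw [Finset.disjUnion_val] at d3 ⊢
    convert d3 using 1
    abel
  refine ⟨D.disjUnion Xp hdis2, ?_, ?_, hF⟩
  · intro v hv
    rcases Finset.mem_disjUnion.1 hv with hv | hv
    · exact (Finset.mem_filter.1 (d2 v hv)).1
    · exact hXpX v hv
  · obtain ⟨N, n1, n2⟩ := F_bal hF
    intro j
    have h1 := n1 j
    rw [Multiset.countP_add, countP_val, countP_val, hu0] at h1
    rw [Multiset.card_add, Finset.card_val, Finset.card_val, Finset.card_disjUnion, d1, hXpcard,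
      hUc] at n2
    have h2 : k * N = k * (u0 + r) := by
      rw [← n2, ← he, hK]; ring
    have h3 := Nat.eq_of_mul_eq_mul_left (by omega) h2
    omega

lemma embed {x : ℕ} (y : ℕ) (β : Type*) [Fintype β] (X : Finset (Fin n)) (hX : X.card = x)
    (hc : x + (y + Fintype.card β) ≤ n) :
    ∃ (gl : Fin x ⊕ Fin y → Fin n) (gz : β → Fin n), Function.Injective gl ∧
      Function.Injective gz ∧ (∀ l z, gl l ≠ gz z) ∧ ∀ v, v ∈ X ↔ ∃ p, gl (Sum.inl p) = v := by
  classical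
  obtain ⟨f⟩ : Nonempty ((Fin y ⊕ β) ↪ {p // p ∉ X}) := by
    apply Function.Embedding.nonempty_of_card_le
    rw [Fintype.card_sum, Fintype.card_fin, Fintype.card_subtype_compl]
    simp [hX]
    omega
  let e := X.equivFinOfCardEq hX
  refine ⟨Sum.elim (fun p => (e.symm p : Fin n)) (fun q => (f (Sum.inl q) : Fin n)),
    fun z => (f (Sum.inr z) : Fin n), ?_, ?_, ?_, ?_⟩
  · apply Function.Injective.sumElim
    · intro p q h
      exact e.symm.injective (Subtype.ext h)
    · intro p q h
      exact Sum.inl_injective (f.injective (Subtype.ext h))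
    · intro p q h
      have h1 := (e.symm p).2
      have h2 := (f (Sum.inl q)).2
      rw [h] at h1
      exact h2 h1
  · intro p q h
    exact Sum.inr_injective (f.injective (Subtype.ext h))
  · rintro (p | q) z h
    · have h1 := (e.symm p).2
      have h2 := (f (Sum.inr z)).2
      simp only [Sum.elim_inl] at h
      rw [h] at h1
      exact h2 h1
    · simp only [Sum.elim_inr] at h
      have := f.injective (Subtype.ext h)
      simp at this
  · intro v
    constructor
    · intro hv
      exact ⟨e ⟨v, hv⟩, by simp⟩
    · rintro ⟨p, rfl⟩
      exact (e.symm p).2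

/-- the cost of the construction per flexible vertex -/
def cost (k : ℕ) : ℕ := k * (5 + 4 * k) + 117 * k * absSize k

end Abs

namespace Abs

open Finset

variable {k n : ℕ} [NeZero k] {A : ZMod k → Fin n → Fin n → Prop}

lemma sum_single_map {ι V : Type*} (f : ι ↪ V) (s : Finset ι) :
    ∑ c ∈ s, ({f c} : Multiset V) = (s.map f).val := by
  rw [Finset.map_val, ← Finset.sum_multiset_singleton, ← Multiset.coe_mapAddMonoidHom, map_sum]
  simp

lemma assemble {a B D m q h g : ℕ} (P : Par A a B D m q h g) (X : ZMod k → Finset (Fin n))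
    (x r : ℕ) (hx : 2 ≤ x) (hr : r ≤ x) (hXc : ∀ j, (X j).card = x)
    (ho : ∀ i p, 2 * a + 1 + 2 * k * r ≤ (outN A i p ∩ X (i + 1)).card)
    (hi : ∀ i p, 2 * a + 1 + 2 * k * r ≤ (inN A i p ∩ X (i - 1)).card)
    (hX : 2 * a + 1 + 2 * k * r ≤ x) (hB : cost k * x ≤ B) :
    ∃ R : Finset (ZMod k × Fin n), R.card ≤ cost k * x ∧
      ∀ U : Finset (ZMod k × Fin n), Disjoint U R →
        (∃ u0, ∀ j, (U.filter (fun v => v.1 = j)).card = u0) → U.card ≤ r →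
        R.val + U.val ∈ F A := by
  classical
  have hk := P.hk
  obtain ⟨E, hEc, hE⟩ := template x r hx hr
  have hBn : B ≤ n := by
    have := P.hq; have := P.hqn; omega
  have hcost : cost k * x = k * (5 * x + 4 * (k * x)) + k * (117 * x) * absSize k := by
    unfold cost; ring
  have hroom : x + ((3 * x + r) + Fintype.card (ZMod k × Fin (4 * x))) ≤ n := by
    rw [Fintype.card_prod, ZMod.card, Fintype.card_fin]
    have h1 : k * (4 * x) = 4 * (k * x) := by ring
    have h2 : 1 * (5 * x + 4 * (k * x)) ≤ k * (5 * x + 4 * (k * x)) :=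
      Nat.mul_le_mul_right _ (by omega)
    omega
  choose gl gz hgl hgz hglz hglX using fun j => embed (3 * x + r) (ZMod k × Fin (4 * x)) (X j)
    (hXc j) hroom
  -- all base vertices
  let f : ZMod k × ((Fin x ⊕ Fin (3 * x + r)) ⊕ (ZMod k × Fin (4 * x))) ↪ ZMod k × Fin n :=
    ⟨fun c => (c.1, Sum.elim (gl c.1) (gz c.1) c.2), by
      rintro ⟨j, c⟩ ⟨j', c'⟩ h
      simp only [Prod.mk.injEq] at h
      obtain ⟨rfl, h⟩ := h
      have := Function.Injective.sumElim (hgl j) (hgz j) (hglz j) h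
      rw [this]⟩
  let s0 : Finset (ZMod k × ((Fin x ⊕ Fin (3 * x + r)) ⊕ (ZMod k × Fin (4 * x)))) :=
    univ.filter (fun c => ∀ z, c.2 ≠ Sum.inr (c.1, z))
  set R0 := s0.map f with hR0
  set W0 := (univ : Finset (ZMod k × ((Fin x ⊕ Fin (3 * x + r)) ⊕ (ZMod k × Fin (4 * x))))).map f
    with hW0
  have hW0c : W0.card ≤ k * (5 * x + 4 * (k * x)) := by
    rw [hW0, Finset.card_map, Finset.card_univ]
    simp only [Fintype.card_prod, Fintype.card_sum, ZMod.card, Fintype.card_fin]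
    apply Nat.mul_le_mul_left
    have h1 : k * (4 * x) = 4 * (k * x) := by ring
    omega
  have hR0W0 : R0 ⊆ W0 := Finset.map_subset_map.2 (Finset.subset_univ _)
  -- the tuples
  let κ : ZMod k × ((Fin x ⊕ Fin (3 * x + r)) × Fin (4 * x)) → ZMod k → Fin n := fun e j =>
    if j = e.1 then gl j e.2.1 else gz j (e.1, e.2.2)
  let EE : Finset (ZMod k × ((Fin x ⊕ Fin (3 * x + r)) × Fin (4 * x))) := univ ×ˢ E
  have hEEc : EE.card ≤ k * (117 * x) := by
    simp only [EE, Finset.card_product, Finset.card_univ, ZMod.card]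
    exact Nat.mul_le_mul_left _ hEc
  have hEEs := Nat.mul_le_mul_right (absSize k) hEEc
  obtain ⟨M, hM1, hM2, hM3, hM4⟩ := greedy EE (fun e S => S ∈ F A ∧ S + tr (κ e) ∈ F A)
    (absSize k) B (fun e _ W hW => absorber P (κ e) W hW) W0 (by omega)
  have hdisj : Disjoint R0 (∑ e ∈ EE, M e).toFinset := by
    rw [Finset.disjoint_left]
    intro v hv hv'
    exact hM3 v (Multiset.mem_toFinset.1 hv') (hR0W0 hv)
  refine ⟨R0.disjUnion (∑ e ∈ EE, M e).toFinset hdisj, ?_, ?_⟩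
  · rw [Finset.card_disjUnion]
    have h1 := Finset.card_le_card hR0W0
    have h2 := Multiset.toFinset_card_le (∑ e ∈ EE, M e)
    omega
  intro U hU ⟨u0, hu0⟩ hUr
  obtain ⟨D, d1, d2, d3⟩ := exact_cover hk P.hA X r ho hi (fun i => by rw [hXc]; exact hX) U
    (by
      intro v hv hvX
      refine Finset.disjoint_left.1 hU hv (Finset.mem_disjUnion.2 (Or.inl ?_))
      obtain ⟨p, hp⟩ := (hglX v.1 v.2).1 hvX
      rw [hR0]
      refine Finset.mem_map.2 ⟨(v.1, Sum.inl (Sum.inl p)), by simp [s0], ?_⟩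
      exact Prod.ext rfl hp) u0 hu0 hUr
  -- the used flexible vertices
  let Xu : ZMod k → Finset (Fin x) := fun j => univ.filter (fun p => (j, gl j (Sum.inl p)) ∈ D)
  let fx : ZMod k → (Fin x ↪ ZMod k × Fin n) := fun j => ⟨fun p => (j, gl j (Sum.inl p)), by
    intro p p' h
    simp only [Prod.mk.injEq, true_and] at h
    exact Sum.inl_injective (hgl j h)⟩
  have hXu : ∀ j, (Xu j).map (fx j) = D.filter (fun v => v.1 = j) := by
    intro j
    ext ⟨i, v⟩
    simp only [Finset.mem_map, Finset.mem_filter]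
    constructor
    · rintro ⟨p, hp, hpe⟩
      simp only [fx, Function.Embedding.coeFn_mk, Prod.mk.injEq] at hpe
      obtain ⟨rfl, rfl⟩ := hpe
      exact ⟨(Finset.mem_filter.1 hp).2, rfl⟩
    · rintro ⟨hv, rfl⟩
      obtain ⟨p, hp⟩ := (hglX i v).1 (d1 _ hv)
      refine ⟨p, ?_, ?_⟩
      · simp only [Xu, Finset.mem_filter, Finset.mem_univ, true_and, hp]; exact hv
      · exact Prod.ext rfl hp
  have hXuc : ∀ j, (Xu j).card = r := by
    intro j
    rw [← d2 j, ← hXu j, Finset.card_map]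
  have hDval : D.val = ∑ j : ZMod k, ∑ p ∈ Xu j, {(j, gl j (Sum.inl p))} := by
    have e1 : ∀ j : ZMod k, ∑ p ∈ Xu j, ({(j, gl j (Sum.inl p))} : Multiset (ZMod k × Fin n)) =
        ∑ v ∈ D.filter (fun v => v.1 = j), {v} := by
      intro j
      rw [← hXu j, Finset.sum_map]
      rfl
    rw [Finset.sum_congr rfl (fun j _ => e1 j), Finset.sum_fiberwise, Finset.sum_multiset_singleton]
  choose φ hφ1 hφ2 hφ3 using fun j => hE (Xu j)ᶜ (by
    rw [Finset.card_compl, Fintype.card_fin, hXuc]; omega)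
  -- splitting off the matched vertices
  have hL : ∀ j, ∑ l, ({(j, gl j l)} : Multiset (ZMod k × Fin n)) =
      ∑ z, {(j, gl j (φ j z))} + ∑ p ∈ Xu j, {(j, gl j (Sum.inl p))} := by
    intro j
    rw [← Finset.sum_add_sum_compl (univ.image (φ j)), Finset.sum_image (by
      intro z _ z' _ h; exact hφ1 j h)]
    congr 1
    have : (univ.image (φ j))ᶜ = (Xu j).map ⟨Sum.inl, Sum.inl_injective⟩ := by
      ext l
      have h3 := hφ3 j l
      simp only [Finset.mem_compl, Finset.mem_image, Finset.mem_univ, true_and, Finset.mem_map,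
        Function.Embedding.coeFn_mk]
      rw [h3]
      push Not
      constructor
      · rintro ⟨p, rfl, hp⟩
        exact ⟨p, by simpa using hp, rfl⟩
      · rintro ⟨p, hp, rfl⟩
        exact ⟨p, rfl, by simpa using hp⟩
    rw [this, Finset.sum_map]
    rfl
  have hR0val : R0.val = ∑ j : ZMod k, ∑ l, {(j, gl j l)} +
      ∑ i : ZMod k, ∑ z, ∑ j : ZMod k, (if j = i then 0 else {(j, gz j (i, z))}) := by
    rw [hR0, ← sum_single_map, Finset.sum_filter, Fintype.sum_prod_type]
    simp only [Fintype.sum_sum_type, Finset.sum_add_distrib]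
    have e1 : ∀ j : ZMod k, ∀ c : ZMod k × Fin (4 * x),
        (if ∀ z, (Sum.inr c : (Fin x ⊕ Fin (3 * x + r)) ⊕ (ZMod k × Fin (4 * x))) ≠
          Sum.inr (j, z) then ({f (j, Sum.inr c)} : Multiset (ZMod k × Fin n)) else 0) =
        if j = c.1 then 0 else {(j, gz j c)} := by
      rintro j ⟨i, z⟩
      by_cases hij : j = i
      · subst hij
        rw [if_neg (by push Not; exact ⟨z, rfl⟩)]; simp
      · rw [if_pos (by
          intro z' hz
          simp only [Sum.inr.injEq, Prod.mk.injEq] at hz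
          exact hij hz.1.symm), if_neg hij]
        rfl
    simp only [e1, Fintype.sum_prod_type]
    congr 1
    · simp [Fintype.sum_sum_type, Finset.sum_add_distrib]
      rfl
    · rw [Finset.sum_comm]
      refine Finset.sum_congr rfl (fun i _ => ?_)
      rw [Finset.sum_comm]
  have htr : ∀ i z, tr (κ (i, (φ i z, z))) = {(i, gl i (φ i z))} +
      ∑ j : ZMod k, (if j = i then 0 else {(j, gz j (i, z))}) := by
    intro i z
    unfold tr
    have e1 : ∀ j : ZMod k, ({(j, κ (i, (φ i z, z)) j)} : Multiset (ZMod k × Fin n)) =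
        (if j = i then {(j, gl j (φ i z))} else 0) +
        (if j = i then 0 else {(j, gz j (i, z))}) := by
      intro j
      simp only [κ]
      split_ifs <;> simp
    rw [Finset.sum_congr rfl (fun j _ => e1 j), Finset.sum_add_distrib]
    simp
  have htot : R0.val = D.val + ∑ c : ZMod k × Fin (4 * x), tr (κ (c.1, (φ c.1 c.2, c.2))) := by
    rw [Fintype.sum_prod_type]
    simp only [htr, Finset.sum_add_distrib]
    rw [hR0val, hDval]
    simp only [hL, Finset.sum_add_distrib]
    abel
  -- matched edges
  let fe : ZMod k × Fin (4 * x) ↪ ZMod k × ((Fin x ⊕ Fin (3 * x + r)) × Fin (4 * x)) :=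
    ⟨fun c => (c.1, (φ c.1 c.2, c.2)), by
      rintro ⟨i, z⟩ ⟨i', z'⟩ h
      simp only [Prod.mk.injEq] at h
      rw [h.1, h.2.2]⟩
  have hfe : univ.map fe ⊆ EE := by
    intro e he
    obtain ⟨⟨i, z⟩, -, rfl⟩ := Finset.mem_map.1 he
    simp only [EE, fe, Function.Embedding.coeFn_mk, Finset.mem_product, Finset.mem_univ, true_and]
    exact hφ2 i z
  have hsum : ∑ c : ZMod k × Fin (4 * x), tr (κ (c.1, (φ c.1 c.2, c.2))) =
      ∑ e ∈ univ.map fe, tr (κ e) := by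
    rw [Finset.sum_map]; rfl
  have hMF : ∑ e ∈ univ.map fe, tr (κ e) + ∑ e ∈ EE, M e ∈ F A := by
    rw [← Finset.sum_sdiff hfe, add_comm, add_assoc, ← Finset.sum_add_distrib]
    refine add_mem (sum_mem fun e he => ?_) (sum_mem fun e he => ?_)
    · exact (hM1 e (Finset.mem_sdiff.1 he).1).1
    · exact (hM1 e (hfe he)).2
  rw [Finset.disjUnion_val, Multiset.toFinset_val, hM2.dedup, htot, hsum]
  have := add_mem d3 hMF
  convert this using 1
  abel

end Abs

namespace Abs

open Finset

variable {k n : ℕ} [NeZero k] {A : ZMod k → Fin n → Fin n → Prop}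

lemma F_family {M : Multiset (ZMod k × Fin n)} (hM : M ∈ F A) :
    ∃ (t : ℕ) (c : Fin t → ZMod k → Fin n), (∀ j, IsCyc A (c j)) ∧ M = ∑ j, tr (c j) := by
  unfold F at hM
  induction hM using AddSubmonoid.closure_induction with
  | mem x hx =>
    obtain ⟨c, hc, rfl⟩ := hx
    exact ⟨1, fun _ => c, fun _ => hc, by simp⟩
  | zero => exact ⟨0, Fin.elim0, fun j => j.elim0, by simp⟩
  | add x y _ _ hx hy =>
    obtain ⟨t, c, hc, rfl⟩ := hx
    obtain ⟨t', c', hc', rfl⟩ := hy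
    refine ⟨t + t', Fin.append c c', fun j => ?_, ?_⟩
    · induction j using Fin.addCases with
      | left j => rw [Fin.append_left]; exact hc j
      | right j => rw [Fin.append_right]; exact hc' j
    · rw [Fin.sum_univ_add]
      simp

lemma mem_tr {c : ZMod k → Fin n} {i : ZMod k} {v : Fin n} : (i, v) ∈ tr c ↔ c i = v := by
  unfold tr
  rw [Multiset.mem_sum]
  simp only [Finset.mem_univ, true_and, Multiset.mem_singleton, Prod.mk.injEq]
  constructor
  · rintro ⟨j, rfl, rfl⟩; rfl
  · rintro rfl; exact ⟨i, rfl, rfl⟩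

lemma factor_of_F {M : Multiset (ZMod k × Fin n)} (hM : M ∈ F A) (hnd : M.Nodup) :
    ∃ (m : ℕ) (c : Fin m → ZMod k → Fin n),
    (∀ (j : Fin m) (i : ZMod k), A i (c j i) (c j (i + 1))) ∧
    (∀ i : ZMod k, Function.Injective fun j => c j i) ∧
    (∀ i : ZMod k, Set.range (fun j => c j i) = {a : Fin n | (i, a) ∈ M}) := by
  classical
  obtain ⟨t, c, hc, rfl⟩ := F_family hM
  refine ⟨t, c, hc, ?_, ?_⟩
  · intro i j j' hjj
    by_contra hne
    simp only at hjj
    rw [← Finset.add_sum_erase _ _ (Finset.mem_univ j), Multiset.nodup_add] at hnd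
    refine Multiset.disjoint_left.1 hnd.2.2 (mem_tr (i := i).2 rfl) ?_
    rw [Multiset.mem_sum]
    exact ⟨j', by simp [Ne.symm hne], mem_tr.2 hjj.symm⟩
  · intro i
    ext v
    simp only [Set.mem_range, Set.mem_setOf_eq, Multiset.mem_sum, Finset.mem_univ, true_and, mem_tr]

lemma core {a B D m q h g : ℕ} (P : Par A a B D m q h g) (b s r : ℕ) (hb : 0 < b)
    (hs : 4 * b * s ≤ D) (hexp : (2 * n : ℝ) * b * Real.exp (-(D / (4 * b))) < 1)
    (hx : 2 ≤ n / b) (hr : r ≤ n / b) (hsr : 2 * a + 1 + 2 * k * r ≤ s) (hsx : s ≤ n / b)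
    (hB : cost k * (n / b) ≤ B) :
    ∃ R : Finset (ZMod k × Fin n), R.card ≤ cost k * (n / b) ∧
      ∀ U : Finset (ZMod k × Fin n), Disjoint U R →
        (∃ u0, ∀ j, (U.filter (fun v => v.1 = j)).card = u0) → U.card ≤ r →
        R.val + U.val ∈ F A := by
  classical
  have hex : ∀ j : ZMod k, ∃ X : Finset (Fin n), X.card = n / b ∧
      (∀ p, s ≤ (outN A (j - 1) p ∩ X).card) ∧ (∀ p, s ≤ (inN A (j + 1) p ∩ X).card) := by
    intro j
    obtain ⟨X, hX1, hX2⟩ := sample (ι := Fin n ⊕ Fin n) b s D hb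
      (Sum.elim (fun p => outN A (j - 1) p) (fun p => inN A (j + 1) p))
      (by
        rintro (p | p)
        · exact P.hDo _ _
        · exact P.hDi _ _) hs (by
        have : (Fintype.card (Fin n ⊕ Fin n) : ℝ) = 2 * n := by
          simp; ring
        rw [this]; exact hexp)
    have h1 : X.card ≤ n / b := by
      rw [Nat.le_div_iff_mul_le hb, mul_comm]; exact hX1
    obtain ⟨Y, hXY, hY⟩ := Finset.exists_superset_card_eq h1
      (by rw [Fintype.card_fin]; exact Nat.div_le_self _ _)
    refine ⟨Y, hY, fun p => ?_, fun p => ?_⟩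
    · exact (hX2 (Sum.inl p)).trans (Finset.card_le_card (Finset.inter_subset_inter_left hXY))
    · exact (hX2 (Sum.inr p)).trans (Finset.card_le_card (Finset.inter_subset_inter_left hXY))
  choose X hX1 hX2 hX3 using hex
  refine assemble P X (n / b) r hx hr hX1 (fun i p => ?_) (fun i p => ?_) (hsr.trans hsx) hB
  · have := hX2 (i + 1) p
    rw [add_sub_cancel_right] at this
    exact hsr.trans this
  · have := hX3 (i - 1) p
    rw [sub_add_cancel] at this
    exact hsr.trans this

lemma ncard_slice (R : Finset (ZMod k × Fin n)) (i : ZMod k) :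
    ({a : Fin n | (i, a) ∈ R}).ncard = (R.filter (fun v => v.1 = i)).card := by
  classical
  rw [← Set.ncard_coe_finset]
  rw [← Set.ncard_image_of_injective _ (Prod.mk_right_injective i)]
  congr 1
  ext ⟨j, v⟩
  simp only [Set.mem_image, Set.mem_setOf_eq, Finset.coe_filter, Prod.mk.injEq]
  constructor
  · rintro ⟨w, hw, rfl, rfl⟩; exact ⟨hw, rfl⟩
  · rintro ⟨hw, rfl⟩; exact ⟨v, hw, rfl, rfl⟩

/-- passing from the multiset formulation to sets of vertices -/
lemma finish (r : ℕ) (R : Finset (ZMod k × Fin n))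
    (hR : ∀ U : Finset (ZMod k × Fin n), Disjoint U R →
        (∃ u0, ∀ j, (U.filter (fun v => v.1 = j)).card = u0) → U.card ≤ r →
        R.val + U.val ∈ F A) :
    (∀ i j : ZMod k, ({a : Fin n | (i, a) ∈ (R : Set (ZMod k × Fin n))}).ncard =
      ({a : Fin n | (j, a) ∈ (R : Set (ZMod k × Fin n))}).ncard) ∧
    ∀ U : Set (ZMod k × Fin n), Disjoint U R →
      (∀ i j : ZMod k, ({a : Fin n | (i, a) ∈ U}).ncard = ({a : Fin n | (j, a) ∈ U}).ncard) →
      U.ncard ≤ r → ∃ (m : ℕ) (c : Fin m → ZMod k → Fin n),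
      (∀ (j : Fin m) (i : ZMod k), A i (c j i) (c j (i + 1))) ∧
      (∀ i : ZMod k, Function.Injective fun j => c j i) ∧
      (∀ i : ZMod k, Set.range (fun j => c j i) =
        {a : Fin n | (i, a) ∈ (R : Set (ZMod k × Fin n)) ∪ U}) := by
  classical
  constructor
  · have h0 := hR ∅ (Finset.disjoint_empty_left _) ⟨0, by simp⟩ (by simp)
    rw [Finset.empty_val, add_zero] at h0
    obtain ⟨N, hN, -⟩ := F_bal h0
    intro i j
    simp only [Finset.mem_coe]
    rw [ncard_slice, ncard_slice, ← countP_val, ← countP_val]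
    exact (hN i).trans (hN j).symm
  · intro U hU hbal hUr
    lift U to Finset (ZMod k × Fin n) using Set.toFinite U
    rw [Finset.disjoint_coe] at hU
    rw [Set.ncard_coe_finset] at hUr
    simp only [Finset.mem_coe, ncard_slice] at hbal
    have hF := hR U hU ⟨_, fun j => hbal j 0⟩ hUr
    have hnd : (R.val + U.val).Nodup := by
      rw [Multiset.nodup_add]
      exact ⟨R.nodup, U.nodup, Finset.disjoint_val.2 hU.symm⟩
    obtain ⟨m, c, h1, h2, h3⟩ := factor_of_F hF hnd
    refine ⟨m, c, h1, h2, fun i => ?_⟩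
    rw [h3]
    ext v
    simp

end Abs

namespace Abs

set_option maxHeartbeats 1000000 in
/-- choice of the parameters -/
lemma params (k C : ℕ) (hk : 4 ≤ k) (d γ : ℝ) (hd : 0 < d) (hd1 : d ≤ 1) (hγ : 0 < γ) :
    ∃ (α ξ : ℝ) (m b n₀ : ℕ), 0 < α ∧ 0 < ξ ∧ 0 < b ∧ ∀ n : ℕ, n₀ ≤ n →
      ∃ a B D q h g s r : ℕ, a = ⌈α * n⌉₊ ∧ D = ⌈d * n⌉₊ ∧ r = ⌊ξ * n⌋₊ ∧
        h + m * (q * n) ≤ D * D ∧ n * n < m * h ∧ 2 * a + 1 + B ≤ q ∧ q ≤ n ∧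
        3 ^ m * g ≤ D ∧ 3 * B + 10 * a + 10 ≤ g ∧
        4 * b * s ≤ D ∧ (2 * n : ℝ) * b * Real.exp (-(D / (4 * b))) < 1 ∧ 2 ≤ n / b ∧
        r ≤ n / b ∧ 2 * a + 1 + 2 * k * r ≤ s ∧ s ≤ n / b ∧ C * (n / b) ≤ B ∧
        ((C * (n / b) : ℕ) : ℝ) ≤ γ * n := by
  obtain ⟨m, hm⟩ := exists_nat_ge (4 / d ^ 2)
  have hm4 : 4 ≤ m * d ^ 2 := by rwa [div_le_iff₀ (by positivity)] at hm
  have hm0 : (0 : ℝ) < m := lt_of_lt_of_le (by positivity) hm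
  have hm1 : (1 : ℝ) ≤ m := by exact_mod_cast (by exact_mod_cast hm0 : 0 < m)
  obtain ⟨θ, hθ0, hθ1, hθ2⟩ : ∃ θ : ℝ, 0 < θ ∧ θ ≤ d ^ 2 / (2 * m) ∧ θ ≤ d / 3 ^ m :=
    ⟨min (d ^ 2 / (2 * m)) (d / 3 ^ m), by positivity, min_le_left _ _, min_le_right _ _⟩
  obtain ⟨b, hb⟩ := exists_nat_ge (1 + 10 * C / θ + C / γ)
  have hb1 : (1 : ℝ) ≤ b := by
    have h1 : 0 ≤ 10 * C / θ := by positivity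
    have h2 : 0 ≤ C / γ := by positivity
    linarith
  have hbθ : 10 * C ≤ b * θ := by
    have h2 : 0 ≤ C / γ := by positivity
    have : 10 * C / θ ≤ b := by linarith
    rwa [div_le_iff₀ hθ0] at this
  have hbγ : C ≤ b * γ := by
    have h1 : 0 ≤ 10 * C / θ := by positivity
    have : C / γ ≤ b := by linarith
    rwa [div_le_iff₀ hγ] at this
  have hb0 : (0 : ℝ) < b := by linarith
  have hbn : 0 < b := by exact_mod_cast hb0
  have hk0 : (0 : ℝ) < k := by exact_mod_cast (by omega : 0 < k)
  obtain ⟨c, hc⟩ : ∃ c, c = d / (4 * b) := ⟨_, rfl⟩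
  have hc0 : 0 < c := by rw [hc]; positivity
  have hcb : 4 * b * c = d := by rw [hc]; field_simp
  obtain ⟨α, hα0, hα1, hα2⟩ : ∃ α : ℝ, 0 < α ∧ α ≤ θ / 100 ∧ α ≤ c / 8 :=
    ⟨min (θ / 100) (c / 8), by positivity, min_le_left _ _, min_le_right _ _⟩
  obtain ⟨ξ, hξ⟩ : ∃ ξ, ξ = c / (8 * k) := ⟨_, rfl⟩
  have hξ0 : 0 < ξ := by rw [hξ]; positivity
  have hξk : 8 * k * ξ = c := by rw [hξ]; field_simp
  obtain ⟨n₀, hn₀⟩ := exists_nat_ge (1 + m + 2 * b + 40 / θ + 8 / c + 4 * b / c ^ 2)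
  refine ⟨α, ξ, m, b, n₀, hα0, hξ0, hbn, fun n hn => ?_⟩
  have hnR : (n₀ : ℝ) ≤ n := by exact_mod_cast hn
  have p1 : 0 < 40 / θ := by positivity
  have p2 : 0 < 8 / c := by positivity
  have p3 : 0 < 4 * b / c ^ 2 := by positivity
  have n1 : (1 : ℝ) ≤ n := by linarith
  have n2 : (m : ℝ) < n := by linarith
  have n3 : 2 * (b : ℝ) ≤ n := by linarith
  have n4 : 40 ≤ n * θ := by
    have : 40 / θ ≤ n := by linarith
    rwa [div_le_iff₀ hθ0] at this
  have n5 : 8 ≤ n * c := by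
    have : 8 / c ≤ n := by linarith
    rwa [div_le_iff₀ hc0] at this
  have n6 : 4 * b < n * c ^ 2 := by
    have : 4 * b / c ^ 2 < n := by linarith
    rwa [div_lt_iff₀ (by positivity)] at this
  have n0 : (0 : ℝ) < n := by linarith
  have hdiv : ((n / b : ℕ) : ℝ) ≤ n / b := Nat.cast_div_le
  have hdivb : ((n / b : ℕ) : ℝ) * b ≤ n := by rwa [le_div_iff₀ hb0] at hdiv
  -- floors and ceilings
  have fa : (⌈α * n⌉₊ : ℝ) < α * n + 1 := Nat.ceil_lt_add_one (by positivity)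
  have fD : d * n ≤ (⌈d * n⌉₊ : ℝ) := Nat.le_ceil _
  have fB : (⌊θ * n / 10⌋₊ : ℝ) ≤ θ * n / 10 := Nat.floor_le (by positivity)
  have fB' : θ * n / 10 < (⌊θ * n / 10⌋₊ : ℝ) + 1 := Nat.lt_floor_add_one _
  have fq : (⌊d ^ 2 / (2 * m) * n⌋₊ : ℝ) ≤ d ^ 2 / (2 * m) * n := Nat.floor_le (by positivity)
  have fq' : d ^ 2 / (2 * m) * n < (⌊d ^ 2 / (2 * m) * n⌋₊ : ℝ) + 1 := Nat.lt_floor_add_one _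
  have fh : (⌊d ^ 2 / 2 * (n * n)⌋₊ : ℝ) ≤ d ^ 2 / 2 * (n * n) := Nat.floor_le (by positivity)
  have fh' : d ^ 2 / 2 * (n * n) < (⌊d ^ 2 / 2 * (n * n)⌋₊ : ℝ) + 1 := Nat.lt_floor_add_one _
  have fg : (⌊d / 3 ^ m * n⌋₊ : ℝ) ≤ d / 3 ^ m * n := Nat.floor_le (by positivity)
  have fg' : d / 3 ^ m * n < (⌊d / 3 ^ m * n⌋₊ : ℝ) + 1 := Nat.lt_floor_add_one _
  have fs : (⌊c * n⌋₊ : ℝ) ≤ c * n := Nat.floor_le (by positivity)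
  have fs' : c * n < (⌊c * n⌋₊ : ℝ) + 1 := Nat.lt_floor_add_one _
  have fr : (⌊ξ * n⌋₊ : ℝ) ≤ ξ * n := Nat.floor_le (by positivity)
  have θq : θ * n ≤ d ^ 2 / (2 * m) * n := by gcongr
  have θg : θ * n ≤ d / 3 ^ m * n := by gcongr
  have αθ : α * n ≤ θ / 100 * n := by gcongr
  have αc : α * n ≤ c / 8 * n := by gcongr
  refine ⟨⌈α * n⌉₊, ⌊θ * n / 10⌋₊, ⌈d * n⌉₊, ⌊d ^ 2 / (2 * m) * n⌋₊, ⌊d ^ 2 / 2 * (n * n)⌋₊,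
    ⌊d / 3 ^ m * n⌋₊, ⌊c * n⌋₊, ⌊ξ * n⌋₊, rfl, rfl, rfl, ?_⟩
  generalize ⌈α * n⌉₊ = a at *
  generalize ⌊θ * n / 10⌋₊ = B at *
  generalize ⌈d * n⌉₊ = D at *
  generalize ⌊d ^ 2 / (2 * m) * n⌋₊ = q at *
  generalize ⌊d ^ 2 / 2 * (n * n)⌋₊ = h at *
  generalize ⌊d / 3 ^ m * n⌋₊ = g at *
  generalize ⌊c * n⌋₊ = s at *
  generalize ⌊ξ * n⌋₊ = r at *
  have hcn : c * n * b ≤ n := by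
    have : c * n * b = d * n / 4 := by rw [← hcb]; ring
    have e : d * n ≤ 1 * n := by gcongr
    linarith
  have hξc : ξ ≤ c := by
    have hk4 : (4 : ℝ) ≤ k := by exact_mod_cast hk
    have e : 4 * ξ ≤ k * ξ := by gcongr
    linarith
  have hξn : ξ * n ≤ c * n := by gcongr
  refine ⟨?_, ?_, ?_, ?_, ?_, ?_, ?_, ?_, ?_, ?_, ?_, ?_, ?_, ?_⟩
  · have e1 : (m : ℝ) * (q * n) ≤ m * (d ^ 2 / (2 * m) * n * n) := by gcongr
    have e2 : (m : ℝ) * (d ^ 2 / (2 * m) * n * n) = d ^ 2 / 2 * (n * n) := by field_simp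
    have e3 : d * n * (d * n) ≤ D * D := by gcongr
    have : (h : ℝ) + m * (q * n) ≤ D * D := by
      have e4 : d * n * (d * n) = d ^ 2 / 2 * (n * n) + d ^ 2 / 2 * (n * n) := by ring
      linarith [e1.trans (le_of_eq e2)]
    exact_mod_cast this
  · have e1 : (m : ℝ) * (d ^ 2 / 2 * (n * n)) < m * (h + 1) := by gcongr
    have e2 : 4 * ((n : ℝ) * n) ≤ m * d ^ 2 * (n * n) := by gcongr
    have e3 : (n : ℝ) * 1 ≤ n * n := by gcongr
    have : (n : ℝ) * n < m * h := by
      have e4 : (m : ℝ) * (d ^ 2 / 2 * (n * n)) = m * d ^ 2 * (n * n) / 2 := by ring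
      have e5 : (m : ℝ) * (h + 1) = m * h + m := by ring
      linarith
    exact_mod_cast this
  · have : 2 * (a : ℝ) + 1 + B ≤ q := by linarith
    exact_mod_cast this
  · have e : d ^ 2 / (2 * m) ≤ 1 := by
      rw [div_le_one (by positivity)]
      have : d ^ 2 ≤ 1 := pow_le_one₀ hd.le hd1
      linarith
    have e2 : d ^ 2 / (2 * m) * n ≤ 1 * n := by gcongr
    have : (q : ℝ) ≤ n := by linarith
    exact_mod_cast this
  · have e1 : (3 : ℝ) ^ m * g ≤ 3 ^ m * (d / 3 ^ m * n) := by gcongr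
    have e2 : (3 : ℝ) ^ m * (d / 3 ^ m * n) = d * n := by field_simp
    have : (3 : ℝ) ^ m * g ≤ D := by linarith
    exact_mod_cast this
  · have : 3 * (B : ℝ) + 10 * a + 10 ≤ g := by linarith
    exact_mod_cast this
  · have e1 : 4 * (b : ℝ) * s ≤ 4 * b * (c * n) := by gcongr
    have e2 : 4 * (b : ℝ) * (c * n) = d * n := by rw [← hcb]; ring
    have : 4 * (b : ℝ) * s ≤ D := by linarith
    exact_mod_cast this
  · have e1 : c * n ≤ D / (4 * b) := by
      rw [le_div_iff₀ (by positivity)]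
      have e2 : c * n * (4 * b) = d * n := by rw [← hcb]; ring
      linarith
    have e3 : Real.exp (-(D / (4 * b))) ≤ Real.exp (-(c * n)) := Real.exp_le_exp.2 (by linarith)
    have e4 := Real.quadratic_le_exp_of_nonneg (x := c * n) (by positivity)
    have e5 : 2 * (n : ℝ) * b < Real.exp (c * n) := by
      have : (n : ℝ) * (4 * b) < n * (n * c ^ 2) := by gcongr
      have : 0 < c * n := by positivity
      have e6 : (c * n) ^ 2 = n * (n * c ^ 2) := by ring
      linarith
    calc (2 * n : ℝ) * b * Real.exp (-(D / (4 * b)))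
        ≤ (2 * n : ℝ) * b * Real.exp (-(c * n)) := by gcongr
      _ < Real.exp (c * n) * Real.exp (-(c * n)) :=
          mul_lt_mul_of_pos_right e5 (Real.exp_pos _)
      _ = 1 := by rw [← Real.exp_add]; simp
  · rw [Nat.le_div_iff_mul_le hbn]
    exact_mod_cast n3
  · rw [Nat.le_div_iff_mul_le hbn]
    have : (r : ℝ) * b ≤ c * n * b := by gcongr; linarith
    exact_mod_cast this.trans hcn
  · have e1 : 2 * (k : ℝ) * r ≤ 2 * k * (ξ * n) := by gcongr
    have e2 : 2 * (k : ℝ) * (ξ * n) = c * n / 4 := by rw [← hξk]; ring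
    have : 2 * (a : ℝ) + 1 + 2 * k * r < s + 1 := by linarith
    have h3 : 2 * a + 1 + 2 * k * r < s + 1 := by exact_mod_cast this
    omega
  · rw [Nat.le_div_iff_mul_le hbn]
    have : (s : ℝ) * b ≤ c * n * b := by gcongr
    exact_mod_cast this.trans hcn
  · have e1 : 10 * (C : ℝ) * (n / b : ℕ) ≤ b * θ * (n / b : ℕ) := by gcongr
    have e2 : θ * (((n / b : ℕ) : ℝ) * b) ≤ θ * n := by gcongr
    have : (C : ℝ) * (n / b : ℕ) < B + 1 := by linarith
    have h3 : C * (n / b) < B + 1 := by exact_mod_cast this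
    omega
  · have e1 : (C : ℝ) * (n / b : ℕ) ≤ b * γ * (n / b : ℕ) := by gcongr
    have e2 : γ * (((n / b : ℕ) : ℝ) * b) ≤ γ * n := by gcongr
    rw [Nat.cast_mul]
    linarith

end Abs

/-- **Lemma 3 (Absorbing Lemma).** Given an integer `k ≥ 4` and constants `δ > 2/k`,
`0 < γ ≤ δ/2`, there exist `α, ξ > 0` such that for all sufficiently large `n`: every spanning
subgraph `G` of the `n`-blow-up of `C_k` with `δ̄(G) ≥ δn` and `α*_b(G) < αn` contains a
`ξ`-absorbing set `R` of size at most `γn`, i.e., a balanced set `R` such that for every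
balanced set `U ⊆ V(G) \ R` with `|U| ≤ ξn` the induced graph on `R ∪ U` has a transversal
`C_k`-factor. -/
theorem absorbing_lemma
    (k : ℕ) (hk : 4 ≤ k) (δ γ : ℝ) (hδ : 2 / k < δ) (hγ0 : 0 < γ) (hγ : γ ≤ δ / 2) :
    ∃ α ξ : ℝ, 0 < α ∧ 0 < ξ ∧ ∃ n₀ : ℕ, ∀ n : ℕ, n₀ ≤ n →
      ∀ G : SimpleGraph (ZMod k × Fin n),
        (∀ u v : ZMod k × Fin n, G.Adj u v → v.1 = u.1 + 1 ∨ u.1 = v.1 + 1) →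
        (∀ (i : ZMod k) (a : Fin n),
          δ * n ≤ (({b : Fin n | G.Adj (i, a) (i + 1, b)}).ncard : ℝ) ∧
          δ * n ≤ (({b : Fin n | G.Adj (i, a) (i - 1, b)}).ncard : ℝ)) →
        (∀ (i : ZMod k) (S T : Finset (Fin n)), S.card = T.card →
          α * n ≤ (S.card : ℝ) → ∃ a ∈ S, ∃ b ∈ T, G.Adj (i, a) (i + 1, b)) →
        ∃ R : Set (ZMod k × Fin n),
          (R.ncard : ℝ) ≤ γ * n ∧
          (∀ i j : ZMod k,
            ({a : Fin n | (i, a) ∈ R}).ncard = ({a : Fin n | (j, a) ∈ R}).ncard) ∧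
          ∀ U : Set (ZMod k × Fin n), Disjoint U R →
            (∀ i j : ZMod k,
              ({a : Fin n | (i, a) ∈ U}).ncard = ({a : Fin n | (j, a) ∈ U}).ncard) →
            (U.ncard : ℝ) ≤ ξ * n →
            HasTransversalCkFactorOn G (R ∪ U) := by
  classical
  have : NeZero k := ⟨by omega⟩
  have hδ0 : 0 < δ := lt_of_le_of_lt (by positivity) hδ
  obtain ⟨α, ξ, m, b, n₀, hα, hξ, hb, hpar⟩ := Abs.params k (Abs.cost k) hk (min δ 1) γ
    (lt_min hδ0 one_pos) (min_le_right _ _) hγ0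
  refine ⟨α, ξ, hα, hξ, n₀, fun n hn G _ hdeg hhole => ?_⟩
  obtain ⟨a, B, D, q, h, g, s, r, ha, hD, hr, h1, h2, h3, h4, h5, h6, h7, h8, h9, h10, h11, h12,
    h13, h14⟩ := hpar n hn
  have hDle : ∀ N : ℕ, δ * n ≤ (N : ℝ) → D ≤ N := by
    intro N hN
    rw [hD]
    refine Nat.ceil_le.2 (le_trans ?_ hN)
    gcongr
    exact min_le_left _ _
  have P : Abs.Par (fun i p q => G.Adj (i, p) (i + 1, q)) a B D m q h g :=
    { hk := hk
      hA := by
        intro i S T hS hT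
        obtain ⟨S', hS', hSc⟩ := Finset.exists_subset_card_eq hS
        obtain ⟨T', hT', hTc⟩ := Finset.exists_subset_card_eq hT
        obtain ⟨p, hp, t, ht, hpt⟩ := hhole i S' T' (hSc.trans hTc.symm) (by
          rw [hSc, ha]; exact Nat.le_ceil _)
        exact ⟨p, hS' hp, t, hT' ht, hpt⟩
      hDo := by
        intro i p
        refine hDle _ ((hdeg i p).1.trans (le_of_eq ?_))
        rw [← Set.ncard_coe_finset]
        congr 2
        ext v
        simp [Abs.outN]
      hDi := by
        intro i p
        refine hDle _ ((hdeg i p).2.trans (le_of_eq ?_))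
        rw [← Set.ncard_coe_finset]
        congr 2
        ext v
        simp [Abs.inN, G.adj_comm]
      hh := h1
      hm := h2
      hq := h3
      hqn := h4
      hgD := h5
      hg := h6 }
  obtain ⟨R, hRc, hR⟩ := Abs.core P b s r hb h7 h8 h9 h10 h11 h12 h13
  obtain ⟨f1, f2⟩ := Abs.finish r R hR
  refine ⟨R, ?_, f1, fun U hU hbal hUc => f2 U hU hbal ?_⟩
  · rw [Set.ncard_coe_finset]
    exact le_trans (by exact_mod_cast hRc) h14
  · rw [hr]
    exact Nat.le_floor hUc
end

section
/- Given a positive integer k divisible by 4 and constants δ, ζ > 0 with δ > 2/k, there exists α > 0 such that the following holds for all sufficiently large n: if G = (V₁, …, V_k, E) is a spanning subgraph of the n-blow-up of C_k with δ̄(G) ≥ δn and α*_b(G) < αn, then G contains a collection of pairwise vertex-disjoint transversal copies of C_k covering all but at most ζn vertices of G. -/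
namespace TransTiling
open Finset

lemma avg_subset {α : Type*} [DecidableEq α] (f : α → ℝ) (ρ : ℝ) (m : ℕ) :
    ∀ (d : ℕ) (X : Finset α), X.card = m + d → ρ * X.card ≤ ∑ x ∈ X, f x →
      ∃ Y ⊆ X, Y.card = m ∧ ρ * m ≤ ∑ x ∈ Y, f x := by
  intro d
  induction d with
  | zero =>
    intro X hX h
    refine ⟨X, subset_rfl, by simpa using hX, ?_⟩
    rw [hX] at h
    simpa using h
  | succ d ih =>
    intro X hX h
    by_cases hx : ∃ x ∈ X, f x ≤ ρ
    · obtain ⟨x, hxX, hxρ⟩ := hx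
      have hc : (X.erase x).card = m + d := by
        rw [card_erase_of_mem hxX, hX]; omega
      obtain ⟨Y, hY, hYc, hYs⟩ := ih (X.erase x) hc (by
        have h1 := add_sum_erase X f hxX
        have h2 : (X.card : ℝ) = (X.erase x).card + 1 := by
          rw [hc, hX]; push_cast; ring
        rw [h2] at h
        linarith)
      exact ⟨Y, hY.trans (erase_subset _ _), hYc, hYs⟩
    · push Not at hx
      obtain ⟨Y, hY, hYc⟩ := exists_subset_card_eq (s := X) (n := m) (by omega)
      refine ⟨Y, hY, hYc, ?_⟩
      have := card_nsmul_le_sum Y f ρ (fun x hx' => (hx x (hY hx')).le)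
      rw [hYc, nsmul_eq_mul] at this
      linarith

lemma avg_subset' {α : Type*} [DecidableEq α] (f : α → ℝ) (ρ : ℝ) (m : ℕ)
    (X : Finset α) (hm : m ≤ X.card) (h : ρ * X.card ≤ ∑ x ∈ X, f x) :
      ∃ Y ⊆ X, Y.card = m ∧ ρ * m ≤ ∑ x ∈ Y, f x :=
  avg_subset f ρ m (X.card - m) X (by omega) h

lemma shrink_box {α : Type*} [DecidableEq α] (f : α → α → α → ℝ) (τ : ℝ) (m : ℕ)
    (B A C : Finset α) (hB : m ≤ B.card) (hA : m ≤ A.card) (hC : m ≤ C.card)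
    (h : τ * (B.card * A.card * C.card) ≤ ∑ b ∈ B, ∑ a ∈ A, ∑ c ∈ C, f b a c) :
    ∃ B' ⊆ B, ∃ A' ⊆ A, ∃ C' ⊆ C, B'.card = m ∧ A'.card = m ∧ C'.card = m ∧
      τ * (m * m * m) ≤ ∑ b ∈ B', ∑ a ∈ A', ∑ c ∈ C', f b a c := by
  obtain ⟨B', hB', hBc, h1⟩ := avg_subset' (fun b => ∑ a ∈ A, ∑ c ∈ C, f b a c)
    (τ * (A.card * C.card)) m B hB (by linarith)
  rw [sum_comm] at h1
  obtain ⟨A', hA', hAc, h2⟩ := avg_subset' (fun a => ∑ b ∈ B', ∑ c ∈ C, f b a c)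
    (τ * (m * C.card)) m A hA (by linarith)
  rw [sum_comm] at h2
  have h3 : ∀ C : Finset α,
      ∑ b ∈ B', ∑ a ∈ A', ∑ c ∈ C, f b a c = ∑ c ∈ C, ∑ b ∈ B', ∑ a ∈ A', f b a c :=
    fun C => (sum_congr rfl fun b _ => sum_comm).trans sum_comm
  rw [h3] at h2
  obtain ⟨C', hC', hCc, h4⟩ := avg_subset' (fun c => ∑ b ∈ B', ∑ a ∈ A', f b a c)
    (τ * (m * m)) m C hC (by linarith)
  refine ⟨B', hB', A', hA', C', hC', hBc, hAc, hCc, ?_⟩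
  rw [h3]
  linarith

lemma box_increment {α : Type*} [DecidableEq α] (f : α → α → α → ℝ)
    (hf1 : ∀ a b c, f a b c ≤ 1) (τ : ℝ) (hτ : 0 < τ) (R m0 : ℕ) (hR : 2 ≤ R) (hm0 : 0 < m0) :
    ∀ (J : ℕ) (τ' : ℝ), τ ≤ τ' → 1 < τ' + J * (τ / (2 * R ^ 3)) →
    ∀ (B A C : Finset α), R ^ J * m0 ≤ B.card → R ^ J * m0 ≤ A.card → R ^ J * m0 ≤ C.card →
    τ' * (B.card * A.card * C.card) ≤ ∑ b ∈ B, ∑ a ∈ A, ∑ c ∈ C, f b a c →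
    ∃ m : ℕ, m0 ≤ m ∧ R * m ≤ R ^ J * m0 ∧ ∃ B' ⊆ B, ∃ A' ⊆ A, ∃ C' ⊆ C,
      B'.card = R * m ∧ A'.card = R * m ∧ C'.card = R * m ∧
      ∀ B'' ⊆ B', ∀ A'' ⊆ A', ∀ C'' ⊆ C', B''.card = m → A''.card = m → C''.card = m →
        (τ / 2) * (m * m * m) ≤ ∑ b ∈ B'', ∑ a ∈ A'', ∑ c ∈ C'', f b a c := by
  intro J
  induction J with
  | zero =>
    intro τ' hτ' h1 B A C hB hA hC h
    exfalso
    have hle : ∑ b ∈ B, ∑ a ∈ A, ∑ c ∈ C, f b a c ≤ ∑ b ∈ B, ∑ a ∈ A, ∑ c ∈ C, (1 : ℝ) :=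
      sum_le_sum fun b _ => sum_le_sum fun a _ => sum_le_sum fun c _ => hf1 b a c
    simp at hle h1 hB hA hC
    have hp : (0 : ℝ) < B.card * A.card * C.card := by
      have h1 : (0 : ℝ) < B.card := by exact_mod_cast (by omega : 0 < B.card)
      have h2 : (0 : ℝ) < A.card := by exact_mod_cast (by omega : 0 < A.card)
      have h3 : (0 : ℝ) < C.card := by exact_mod_cast (by omega : 0 < C.card)
      positivity
    nlinarith
  | succ J ih =>
    intro τ' hτ' h1 B A C hB hA hC h
    obtain ⟨B1, hB1, A1, hA1, C1, hC1, hBc, hAc, hCc, hT⟩ :=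
      shrink_box f τ' (R ^ (J + 1) * m0) B A C hB hA hC h
    set m := R ^ J * m0 with hm
    have hs : R ^ (J + 1) * m0 = R * m := by rw [hm]; ring
    rw [hs] at hT hBc hAc hCc ⊢
    have hmm0 : m0 ≤ m := Nat.le_mul_of_pos_left _ (by positivity)
    by_cases hgood : ∀ B'' ⊆ B1, ∀ A'' ⊆ A1, ∀ C'' ⊆ C1,
        B''.card = m → A''.card = m → C''.card = m →
        (τ / 2) * (m * m * m) ≤ ∑ b ∈ B'', ∑ a ∈ A'', ∑ c ∈ C'', f b a c
    · exact ⟨m, hmm0, le_rfl, B1, hB1, A1, hA1, C1, hC1, hBc, hAc, hCc, hgood⟩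
    · push Not at hgood
      obtain ⟨B2, hB2, A2, hA2, C2, hC2, hB2c, hA2c, hC2c, hlow⟩ := hgood
      have h2m : 2 * m ≤ R * m := Nat.mul_le_mul_right _ hR
      have hcard : ∀ X Y : Finset α, Y ⊆ X → X.card = R * m → Y.card = m →
          m ≤ (X \ Y).card ∧ ((X \ Y).card : ℝ) = R * m - m := by
        intro X Y hYX hX hY
        have := card_sdiff_add_card_eq_card hYX
        refine ⟨by omega, ?_⟩
        have h' : ((X \ Y).card : ℝ) + Y.card = X.card := by exact_mod_cast this
        rw [hX, hY] at h'
        push_cast at h'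
        linarith
      have fin : ∀ B3 ⊆ B1, ∀ A3 ⊆ A1, ∀ C3 ⊆ C1, m ≤ B3.card → m ≤ A3.card → m ≤ C3.card →
          (τ' + τ / (2 * R ^ 3)) * (B3.card * A3.card * C3.card)
            ≤ ∑ b ∈ B3, ∑ a ∈ A3, ∑ c ∈ C3, f b a c → 
        ∃ m : ℕ, m0 ≤ m ∧ R * m ≤ R * (R ^ J * m0) ∧ ∃ B' ⊆ B, ∃ A' ⊆ A, ∃ C' ⊆ C,
          B'.card = R * m ∧ A'.card = R * m ∧ C'.card = R * m ∧
          ∀ B'' ⊆ B', ∀ A'' ⊆ A', ∀ C'' ⊆ C', B''.card = m → A''.card = m → C''.card = m →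
          (τ / 2) * (m * m * m) ≤ ∑ b ∈ B'', ∑ a ∈ A'', ∑ c ∈ C'', f b a c := by
        intro B3 hB3 A3 hA3 C3 hC3 b1 b2 b3 hd
        obtain ⟨m', e1, e2, B', e3, A', e4, C', e5, e6⟩ := ih (τ' + τ / (2 * R ^ 3))
          (by have : 0 ≤ τ / (2 * (R:ℝ) ^ 3) := by positivity
              linarith) (by push_cast at h1; linarith) B3 A3 C3 b1 b2 b3 hd
        refine ⟨m', e1, e2.trans (Nat.le_mul_of_pos_left _ (by omega)), B', e3.trans (hB3.trans hB1), A', e4.trans (hA3.trans hA1), C', e5.trans (hC3.trans hC1), e6⟩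
      by_contra hcon
      have n1 := mt (fin (B1 \ B2) sdiff_subset A1 subset_rfl C1 subset_rfl
        (hcard _ _ hB2 hBc hB2c).1 (by omega) (by omega)) hcon
      have n2 := mt (fin B2 hB2 (A1 \ A2) sdiff_subset C1 subset_rfl (by omega)
        (hcard _ _ hA2 hAc hA2c).1 (by omega)) hcon
      have n3 := mt (fin B2 hB2 A2 hA2 (C1 \ C2) sdiff_subset (by omega) (by omega)
        (hcard _ _ hC2 hCc hC2c).1) hcon
      push Not at n1 n2 n3
      rw [(hcard _ _ hB2 hBc hB2c).2, hAc, hCc] at n1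
      rw [(hcard _ _ hA2 hAc hA2c).2, hB2c, hCc] at n2
      rw [(hcard _ _ hC2 hCc hC2c).2, hB2c, hA2c] at n3
      have s1 : ∑ b ∈ B1, ∑ a ∈ A1, ∑ c ∈ C1, f b a c
        = ∑ b ∈ B1 \ B2, ∑ a ∈ A1, ∑ c ∈ C1, f b a c + ∑ b ∈ B2, ∑ a ∈ A1, ∑ c ∈ C1, f b a c :=
        (sum_sdiff hB2).symm
      have s2 : ∑ b ∈ B2, ∑ a ∈ A1, ∑ c ∈ C1, f b a c = 
        ∑ b ∈ B2, ∑ a ∈ A1 \ A2, ∑ c ∈ C1, f b a c + ∑ b ∈ B2, ∑ a ∈ A2, ∑ c ∈ C1, f b a c := by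
        rw [← sum_add_distrib]
        exact sum_congr rfl fun b _ => (sum_sdiff hA2).symm
      have s3 : ∑ b ∈ B2, ∑ a ∈ A2, ∑ c ∈ C1, f b a c = 
        ∑ b ∈ B2, ∑ a ∈ A2, ∑ c ∈ C1 \ C2, f b a c + ∑ b ∈ B2, ∑ a ∈ A2, ∑ c ∈ C2, f b a c := by
        rw [← sum_add_distrib]
        refine sum_congr rfl fun b _ => ?_
        rw [← sum_add_distrib]
        exact sum_congr rfl fun b _ => (sum_sdiff hC2).symm
      have hRp : (0 : ℝ) < R := by exact_mod_cast (by omega : 0 < R)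
      have hmp : (0 : ℝ) < m := by exact_mod_cast (by omega : 0 < m)
      have hη : τ / (2 * (R : ℝ) ^ 3) * (R ^ 3 * (m * m * m)) = τ / 2 * (m * m * m) := by
        field_simp
      have hηp : 0 < τ / (2 * (R : ℝ) ^ 3) * (m * m * m) := by positivity
      have hττ : τ * (m * m * m : ℝ) ≤ τ' * (m * m * m) := by gcongr
      generalize τ / (2 * (R : ℝ) ^ 3) = η at *
      push_cast at *
      nlinarith

end TransTiling

namespace TransTiling
open Finset

lemma path_lemma {α : Type*} [DecidableEq α] (F : ℕ → α → α → Prop) (h : ℕ)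
    (hF : ∀ (l : ℕ) (S T : Finset α), S.card = h → T.card = h → ∃ a ∈ S, ∃ b ∈ T, F l a b)
    (S : ℕ → Finset α) (hS : ∀ l, 2 * h ≤ (S l).card) (L : ℕ) :
    ∃ R ⊆ S L, h ≤ R.card ∧ ∀ y ∈ R, ∃ q : ℕ → α, q L = y ∧ (∀ l ≤ L, q l ∈ S l) ∧
      ∀ l < L, F l (q l) (q (l + 1)) := by
  classical
  induction L with
  | zero =>
    refine ⟨S 0, subset_rfl, by have := hS 0; omega, fun y hy => ⟨fun _ => y, rfl, ?_, ?_⟩⟩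
    · intro l hl
      obtain rfl : l = 0 := by omega
      exact hy
    · intro l hl; omega
  | succ L ih =>
    obtain ⟨R, hRS, hRc, hR⟩ := ih
    refine ⟨(S (L + 1)).filter (fun y => ∃ x ∈ R, F L x y), filter_subset _ _, ?_, ?_⟩
    · by_contra hlt
      push Not at hlt
      have hsum := card_filter_add_card_filter_not (s := S (L + 1)) (fun y => ∃ x ∈ R, F L x y)
      have := hS (L + 1)
      obtain ⟨X, hX, hXc⟩ := exists_subset_card_eq hRc
      obtain ⟨Y, hY, hYc⟩ := exists_subset_card_eq
        (s := (S (L + 1)).filter (fun y => ¬ ∃ x ∈ R, F L x y)) (n := h) (by omega)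
      obtain ⟨a, ha, b, hb, hab⟩ := hF L X Y hXc hYc
      exact (mem_filter.1 (hY hb)).2 ⟨a, hX ha, hab⟩
    · intro y hy
      obtain ⟨hyS, x, hx, hxy⟩ := mem_filter.1 hy
      obtain ⟨q, hq, hqS, hqF⟩ := hR x hx
      refine ⟨fun l => if l = L + 1 then y else q l, by simp, ?_, ?_⟩
      · intro l hl
        by_cases hlL : l = L + 1
        · subst hlL; simpa using hyS
        · simp only [hlL, if_false]; exact hqS l (by omega)
      · intro l hl
        by_cases hlL : l = L
        · subst hlL; simp [hq, hxy]
        · have h1 : l ≠ L + 1 := by omega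
          simp only [h1, hlL, if_false, add_left_inj]
          exact hqF l (by omega)

/-- every sub-box with all sides at least `m` contains a transversal cycle -/
def Good {k n : ℕ} (E : ZMod k → Fin n → Fin n → Prop) (A : ZMod k → Finset (Fin n)) (m : ℕ) :
    Prop :=
  ∀ B : ZMod k → Finset (Fin n), (∀ i, B i ⊆ A i) → (∀ i, m ≤ (B i).card) →
    ∃ c : ZMod k → Fin n, (∀ i, c i ∈ B i) ∧ ∀ i, E i (c i) (c (i + 1))

lemma close_cycle {k n : ℕ} [NeZero k] (E : ZMod k → Fin n → Fin n → Prop)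
    (B : ZMod k → Finset (Fin n)) (i0 : ZMod k) (q : ℕ → Fin n)
    (hq : ∀ l < k, q l ∈ B (i0 + l)) (hE : ∀ l, l + 1 < k → E (i0 + l) (q l) (q (l + 1)))
    (hlast : E (i0 + (k - 1 : ℕ)) (q (k - 1)) (q 0)) :
    ∃ c : ZMod k → Fin n, (∀ i, c i ∈ B i) ∧ ∀ i, E i (c i) (c (i + 1)) := by
  have hk : 0 < k := NeZero.pos k
  refine ⟨fun i => q (i - i0).val, fun i => ?_, fun i => ?_⟩
  · have := hq (i - i0).val (ZMod.val_lt _)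
    simpa using this
  · have hl := ZMod.val_lt (i - i0)
    have hi : i = i0 + ((i - i0).val : ℕ) := by simp
    generalize hlv : (i - i0).val = l at *
    have h1 : i + 1 - i0 = ((l + 1 : ℕ) : ZMod k) := by rw [hi]; push_cast; ring
    change E i (q (i - i0).val) (q (i + 1 - i0).val)
    rw [h1, ZMod.val_natCast, hlv, hi]
    by_cases hlk : l + 1 < k
    · rw [Nat.mod_eq_of_lt hlk]
      exact hE l hlk
    · have h2 : l + 1 = k := by omega
      have h3 : l = k - 1 := by omega
      rw [h2, Nat.mod_self, h3]
      exact hlast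

lemma cherry_cycle {k n : ℕ} [NeZero k] (hk : 4 ≤ k) (E : ZMod k → Fin n → Fin n → Prop) (h : ℕ)
    (hh : 0 < h)
    (hE : ∀ (i : ZMod k) (S T : Finset (Fin n)), S.card = h → T.card = h →
      ∃ a ∈ S, ∃ b ∈ T, E i a b)
    (B : ZMod k → Finset (Fin n)) (hB : ∀ i, 2 * h ≤ (B i).card) (i0 : ZMod k) (b : Fin n)
    (hb : b ∈ B i0) (X Y : Finset (Fin n)) (hX : X ⊆ B (i0 - 1)) (hY : Y ⊆ B (i0 + 1))
    (hXc : 2 * h ≤ X.card) (hYc : 2 * h ≤ Y.card) (hXE : ∀ a ∈ X, E (i0 - 1) a b)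
    (hYE : ∀ c ∈ Y, E i0 b c) :
    ∃ c : ZMod k → Fin n, (∀ i, c i ∈ B i) ∧ ∀ i, E i (c i) (c (i + 1)) := by
  obtain ⟨R, hRS, hRc, hR⟩ := path_lemma (fun l => E (i0 + 1 + l)) h
    (fun l S T => hE _ S T)
    (fun l => if l = 0 then Y else if l = k - 2 then X else B (i0 + 1 + l))
    (by
      intro l
      split_ifs
      · exact hYc
      · exact hXc
      · exact hB _) (k - 2)
  obtain ⟨y, hy⟩ := card_pos.1 (lt_of_lt_of_le hh hRc)
  obtain ⟨q, hqy, hqS, hqE⟩ := hR y hy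
  have hlastz : i0 + ((k - 1 : ℕ) : ZMod k) = i0 - 1 := by
    rw [Nat.cast_sub (by omega)]; simp; ring
  have q0 : q 0 ∈ Y := by simpa using hqS 0 (by omega)
  have ql : q (k - 2) ∈ X := by
    have := hqS (k - 2) le_rfl
    have h2 : k - 2 ≠ 0 := by omega
    simpa [h2] using this
  refine close_cycle E B i0 (fun l => if l = 0 then b else q (l - 1)) ?_ ?_ ?_
  · intro l hl
    rcases l with _ | l
    · simpa using hb
    · simp only [Nat.add_eq_zero_iff, one_ne_zero, and_false, if_false, Nat.add_sub_cancel]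
      by_cases hl0 : l = 0
      · subst hl0; simpa using hY q0
      · by_cases hl2 : l = k - 2
        · have h3 : l + 1 = k - 1 := by omega
          rw [h3, hlastz, hl2]
          exact hX ql
        · have := hqS l (by omega)
          simp only [hl0, hl2, if_false] at this
          have e : i0 + ((l + 1 : ℕ) : ZMod k) = i0 + 1 + l := by push_cast; ring
          rw [e]; exact this
  · intro l hl
    rcases l with _ | l
    · simpa using hYE _ q0
    · have := hqE l (by omega)
      have e : i0 + ((l + 1 : ℕ) : ZMod k) = i0 + 1 + l := by push_cast; ring
      rw [e]
      simpa using this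
  · rw [hlastz]
    have h1 : k - 1 ≠ 0 := by omega
    have h2 : k - 1 - 1 = k - 2 := by omega
    simp only [h1, if_false, if_true, h2]
    exact hXE _ ql

lemma lowest {α : Type*} [Fintype α] [DecidableEq α] (f : α → ℝ) (m : ℕ)
    (hm : m ≤ Fintype.card α) :
    ∃ Y : Finset α, Y.card = m ∧ ∀ x ∈ Y, ∀ y ∉ Y, f x ≤ f y := by
  induction m with
  | zero => exact ⟨∅, by simp, by simp⟩
  | succ m ih =>
    obtain ⟨Y, hYc, hY⟩ := ih (by omega)
    have hne : (Yᶜ).Nonempty := by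
      rw [← card_pos, card_compl]; omega
    obtain ⟨y, hy, hmin⟩ := exists_min_image Yᶜ f hne
    rw [mem_compl] at hy
    refine ⟨insert y Y, by rw [card_insert_of_notMem hy, hYc], ?_⟩
    intro x hx z hz
    rw [mem_insert, not_or] at hz
    rcases mem_insert.1 hx with rfl | hx
    · exact hmin z (mem_compl.2 hz.2)
    · exact hY x hx z hz.2

lemma lowest' {α : Type*} [Fintype α] [DecidableEq α] (f : α → ℝ) (hf : ∀ x, 0 ≤ f x) (m : ℕ)
    (hm : m ≤ Fintype.card α) (hm0 : 0 < m) :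
    ∃ (Y : Finset α) (μ : ℝ), Y.card = m ∧ 0 ≤ μ ∧ (∀ x ∈ Y, f x ≤ μ) ∧ ∀ y ∉ Y, μ ≤ f y := by
  obtain ⟨Y, hYc, hY⟩ := lowest f m hm
  obtain ⟨x, hx, hmax⟩ := exists_max_image Y f (card_pos.1 (by omega))
  exact ⟨Y, f x, hYc, hf x, hmax, fun y hy => hY x hx y hy⟩

end TransTiling

namespace TransTiling
open Finset

open Classical in
lemma good_of_dense {k n : ℕ} [NeZero k] (hk : 4 ≤ k) (E : ZMod k → Fin n → Fin n → Prop) (h : ℕ)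
    (hh : 0 < h)
    (hE : ∀ (i : ZMod k) (S T : Finset (Fin n)), S.card = h → T.card = h →
      ∃ a ∈ S, ∃ b ∈ T, E i a b) (τ : ℝ) (m : ℕ) (hτm : 4 * (h : ℝ) < τ * m) (hhm : 2 * h ≤ m)
    (i0 : ZMod k) (A : ZMod k → Finset (Fin n))
    (hd : ∀ B'' ⊆ A i0, ∀ A'' ⊆ A (i0 - 1), ∀ C'' ⊆ A (i0 + 1),
        B''.card = m → A''.card = m → C''.card = m →
        (τ / 2) * (m * m * m) ≤ ∑ b ∈ B'', ∑ a ∈ A'', ∑ c ∈ C'',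
          (if E (i0 - 1) a b then (1 : ℝ) else 0) * (if E i0 b c then 1 else 0)) :
    Good E A m := by
  intro B hBA hBm
  obtain ⟨B2, hB2, hB2c⟩ := exists_subset_card_eq (hBm i0)
  obtain ⟨A2, hA2, hA2c⟩ := exists_subset_card_eq (hBm (i0 - 1))
  obtain ⟨C2, hC2, hC2c⟩ := exists_subset_card_eq (hBm (i0 + 1))
  have hd := hd B2 (hB2.trans (hBA _)) A2 (hA2.trans (hBA _)) C2 (hC2.trans (hBA _)) hB2c hA2c hC2c
  have hprod : ∀ b, ∑ a ∈ A2, ∑ c ∈ C2,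
      (if E (i0 - 1) a b then (1 : ℝ) else 0) * (if E i0 b c then 1 else 0)
      = (A2.filter (fun a => E (i0 - 1) a b)).card * (C2.filter (fun c => E i0 b c)).card := by
    intro b
    rw [← sum_mul_sum]
    simp
  simp only [hprod] at hd
  have hmp : (0 : ℝ) < m := by exact_mod_cast (by omega : 0 < m)
  have hex : ∃ b ∈ B2, 2 * h ≤ (A2.filter (fun a => E (i0 - 1) a b)).card ∧
      2 * h ≤ (C2.filter (fun c => E i0 b c)).card := by
    by_contra hno
    push Not at hno
    have hle : ∑ b ∈ B2, ((A2.filter (fun a => E (i0 - 1) a b)).card : ℝ)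
        * (C2.filter (fun c => E i0 b c)).card ≤ ∑ b ∈ B2, (2 * h * m : ℝ) := by
      refine sum_le_sum fun b hb => ?_
      have h1 : (A2.filter (fun a => E (i0 - 1) a b)).card ≤ m :=
        (card_filter_le _ _).trans hA2c.le
      have h2 : (C2.filter (fun c => E i0 b c)).card ≤ m :=
        (card_filter_le _ _).trans hC2c.le
      have h3 := hno b hb
      have : (A2.filter (fun a => E (i0 - 1) a b)).card * (C2.filter (fun c => E i0 b c)).card
        ≤ 2 * h * m := by
        by_cases h4 : 2 * h ≤ (A2.filter (fun a => E (i0 - 1) a b)).card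
        · rw [mul_comm]
          exact Nat.mul_le_mul (h3 h4).le h1
        · exact Nat.mul_le_mul (by omega) h2
      exact_mod_cast this
    rw [sum_const, hB2c, nsmul_eq_mul] at hle
    have : (m * m : ℝ) * (4 * h) < (m * m) * (τ * m) := by
      apply mul_lt_mul_of_pos_left hτm; positivity
    nlinarith
  obtain ⟨b, hb, hb1, hb2⟩ := hex
  exact cherry_cycle hk E h hh hE B (fun i => hhm.trans (hBm i)) i0 b (hB2 hb)
    (A2.filter (fun a => E (i0 - 1) a b)) (C2.filter (fun c => E i0 b c))
    ((filter_subset _ _).trans hA2) ((filter_subset _ _).trans hC2) hb1 hb2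
    (fun a ha => (mem_filter.1 ha).2) (fun a ha => (mem_filter.1 ha).2)

/-- Markov: few points of large value -/
lemma markov {n : ℕ} (f : Fin n → ℝ) (hf : ∀ x, 0 ≤ f x) (ρ : ℝ) (hρ : 0 < ρ) :
    ((univ.filter (fun x => (∑ y, f y) / ρ < f x)).card : ℝ) ≤ ρ := by
  set P := (∑ y, f y) / ρ with hP
  have hP0 : 0 ≤ P := div_nonneg (sum_nonneg fun x _ => hf x) hρ.le
  have hW : ∑ y, f y = P * ρ := by rw [hP]; field_simp
  rcases hP0.eq_or_lt with h0 | hpos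
  · rw [← h0, zero_mul] at hW
    have : ∀ x, f x = 0 := fun x => (sum_eq_zero_iff_of_nonneg (fun x _ => hf x)).1 hW x (mem_univ x)
    rw [← h0]
    simp [this, hρ.le]
  · have h1 : ((univ.filter (fun x => P < f x)).card : ℝ) * P ≤ ∑ x ∈ univ.filter (fun x => P < f x), f x := by
      rw [← nsmul_eq_mul]
      exact card_nsmul_le_sum _ _ _ fun x hx => (mem_filter.1 hx).2.le
    have h2 : ∑ x ∈ univ.filter (fun x => P < f x), f x ≤ ∑ y, f y :=
      sum_le_sum_of_subset_of_nonneg (filter_subset _ _) fun x _ _ => hf x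
    rw [hW] at h2
    have h3 : ((univ.filter (fun x => P < f x)).card : ℝ) * P ≤ ρ * P := by linarith
    exact le_of_mul_le_mul_right h3 hpos

lemma deg_inside {n : ℕ} (Q : Fin n → Prop) [DecidablePred Q] (f : Fin n → ℝ) (hf : ∀ x, 0 ≤ f x)
    (ρ g : ℝ) (hρ : 0 < ρ) (hQ : ρ + g ≤ ((univ.filter Q).card : ℝ)) :
    g ≤ (((univ.filter (fun x => f x ≤ (∑ y, f y) / ρ)).filter Q).card : ℝ) := by
  have h1 := markov f hf ρ hρ
  have h2 : (univ.filter Q).card ≤ ((univ.filter (fun x => f x ≤ (∑ y, f y) / ρ)).filter Q).card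
      + (univ.filter (fun x => (∑ y, f y) / ρ < f x)).card := by
    refine (card_le_card ?_).trans (card_union_le _ _)
    intro x hx
    simp only [mem_union, mem_filter, mem_univ, true_and] at hx ⊢
    rcases le_or_gt (f x) ((∑ y, f y) / ρ) with h | h
    · exact Or.inl ⟨h, hx⟩
    · exact Or.inr h
  have h3 : ((univ.filter Q).card : ℝ) ≤
    (((univ.filter (fun x => f x ≤ (∑ y, f y) / ρ)).filter Q).card : ℝ)
      + (univ.filter (fun x => (∑ y, f y) / ρ < f x)).card := by exact_mod_cast h2
  linarith

open Classical in
lemma key {k n : ℕ} [NeZero k] (hk : 4 ≤ k) (hn : 0 < n) (E : ZMod k → Fin n → Fin n → Prop)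
    (h m0 R J : ℕ) (γ σ : ℝ) (hγ : 0 < γ) 
    (hdp : ∀ i a, (2 / k + γ) * n ≤ ((univ.filter (fun b => E i a b)).card : ℝ))
    (hdm : ∀ i b, (2 / k + γ) * n ≤ ((univ.filter (fun a => E i a b)).card : ℝ))
    (hh : 0 < h)
    (hE : ∀ (i : ZMod k) (S T : Finset (Fin n)), S.card = h → T.card = h →
      ∃ a ∈ S, ∃ b ∈ T, E i a b)
    (hR : 2 ≤ R) (hJ : 1 < γ ^ 2 + J * (γ ^ 2 / (2 * R ^ 3)))
    (hs0 : ((R ^ J * m0 : ℕ) : ℝ) ≤ σ * n) (hσγ : σ ≤ γ) (hσ1 : σ < 1)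
    (h4 : 4 * (h : ℝ) < γ ^ 2 * m0) (h2 : 2 * h ≤ m0)
    (w : ZMod k → Fin n → ℝ) (hw : ∀ i x, 0 ≤ w i x) :
    ∃ (A : ZMod k → Finset (Fin n)) (m : ℕ), m0 ≤ m ∧ R * m ≤ R ^ J * m0 ∧
      (∀ i, (A i).card = R * m) ∧ Good E A m ∧
      ∑ i, ∑ x ∈ A i, w i x ≤ (R * m : ℕ) / ((1 - σ) * n) * ∑ i, ∑ x, w i x := by
  have hm0 : 0 < m0 := by omega
  have hnp : (0 : ℝ) < n := by exact_mod_cast hn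
  have hkp : (0 : ℝ) < k := by exact_mod_cast (by omega : 0 < k)
  set s0 := R ^ J * m0 with hs0def
  have hs0p : 0 < s0 := by positivity
  have hs0n : s0 ≤ n := by
    have : (s0 : ℝ) ≤ n := hs0.trans (by nlinarith)
    exact_mod_cast this
  choose Y μ hYc hμ0 hYle hYge using fun i => lowest' (w i) (hw i) s0 (by simpa using hs0n) hs0p
  set w' : ZMod k → Fin n → ℝ := fun i x => max (w i x - μ i) 0 with hw'
  have hw'0 : ∀ i x, 0 ≤ w' i x := fun i x => le_max_right _ _
  have hw'le : ∀ i x, w i x ≤ μ i + w' i x := fun i x => by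
    have := le_max_left (w i x - μ i) 0
    simp only [hw']; linarith
  set W : ZMod k → ℝ := fun i => ∑ x, w' i x with hW
  have hW0 : ∀ i, 0 ≤ W i := fun i => sum_nonneg fun x _ => hw'0 i x
  -- lower bound of total
  have htot : ∀ i, μ i * (n - s0) + W i ≤ ∑ x, w i x := by
    intro i
    have e1 : μ i * (n - s0) = ∑ x ∈ (Y i)ᶜ, μ i := by
      rw [sum_const, card_compl, hYc, nsmul_eq_mul, Fintype.card_fin, Nat.cast_sub hs0n]; ring
    have e2 : W i = ∑ x ∈ (Y i)ᶜ, w' i x := by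
      simp only [hW]
      rw [← sum_add_sum_compl (Y i)]
      have : ∑ x ∈ Y i, w' i x = 0 := sum_eq_zero fun x hx => by
        simp only [hw']
        exact max_eq_right (by linarith [hYle i x hx])
      rw [this, zero_add]
    rw [e1, e2, ← sum_add_distrib, ← sum_add_sum_compl (Y i) (w i)]
    have e3 : 0 ≤ ∑ x ∈ Y i, w i x := sum_nonneg fun x _ => hw i x
    have e4 : ∑ x ∈ (Y i)ᶜ, (μ i + w' i x) = ∑ x ∈ (Y i)ᶜ, w i x := by
      refine sum_congr rfl fun x hx => ?_
      have := hYge i x (mem_compl.1 hx)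
      simp only [hw']
      rw [max_eq_left (by linarith)]; ring
    linarith
  -- choose the centre
  obtain ⟨i0, hi0⟩ : ∃ i, W (i - 1) + W (i + 1) ≤ 2 / k * ∑ j, W j := by
    have hsum : ∑ i, (W (i - 1) + W (i + 1)) ≤ ∑ i : ZMod k, 2 / k * ∑ j, W j := by
      rw [sum_add_distrib]
      have a1 : ∑ i, W (i - 1) = ∑ i, W i := Equiv.sum_comp (Equiv.subRight (1 : ZMod k)) W
      have a2 : ∑ i, W (i + 1) = ∑ i, W i := Equiv.sum_comp (Equiv.addRight (1 : ZMod k)) W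
      rw [a1, a2, sum_const, card_univ, ZMod.card, nsmul_eq_mul]
      apply le_of_eq
      field_simp
      ring
    obtain ⟨i, _, hi⟩ := exists_le_of_sum_le univ_nonempty hsum
    exact ⟨i, hi⟩
  set ρ : ℝ := 2 / k * n with hρ
  have hρp : 0 < ρ := by positivity
  set A0 := univ.filter (fun x => w' (i0 - 1) x ≤ W (i0 - 1) / ρ) with hA0
  set C0 := univ.filter (fun x => w' (i0 + 1) x ≤ W (i0 + 1) / ρ) with hC0
  have dA : ∀ b, γ * n ≤ ((A0.filter (fun a => E (i0 - 1) a b)).card : ℝ) := fun b =>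
    deg_inside (fun a => E (i0 - 1) a b) (w' (i0 - 1)) (hw'0 _) ρ (γ * n) hρp
      (by rw [hρ, ← add_mul]; exact hdm _ _)
  have dC : ∀ b, γ * n ≤ ((C0.filter (fun c => E i0 b c)).card : ℝ) := fun b =>
    deg_inside (fun c => E i0 b c) (w' (i0 + 1)) (hw'0 _) ρ (γ * n) hρp
      (by rw [hρ, ← add_mul]; exact hdp _ _)
  have x0 : Fin n := ⟨0, hn⟩
  have hs0γ : (s0 : ℝ) ≤ γ * n := hs0.trans (by gcongr)
  have cA : s0 ≤ A0.card := by
    have : (s0 : ℝ) ≤ A0.card := hs0γ.trans ((dA x0).trans (by exact_mod_cast card_filter_le _ _))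
    exact_mod_cast this
  have cC : s0 ≤ C0.card := by
    have : (s0 : ℝ) ≤ C0.card := hs0γ.trans ((dC x0).trans (by exact_mod_cast card_filter_le _ _))
    exact_mod_cast this
  have hprod : ∀ b, ∑ a ∈ A0, ∑ c ∈ C0,
      (if E (i0 - 1) a b then (1 : ℝ) else 0) * (if E i0 b c then 1 else 0)
      = (A0.filter (fun a => E (i0 - 1) a b)).card * (C0.filter (fun c => E i0 b c)).card := by
    intro b
    rw [← sum_mul_sum]
    simp
  have hdens : γ ^ 2 * ((Y i0).card * A0.card * C0.card) ≤ ∑ b ∈ Y i0, ∑ a ∈ A0, ∑ c ∈ C0,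
      (if E (i0 - 1) a b then (1 : ℝ) else 0) * (if E i0 b c then 1 else 0) := by
    simp only [hprod]
    have e1 : γ ^ 2 * (((Y i0).card : ℝ) * A0.card * C0.card) ≤ ∑ b ∈ Y i0, (γ * n) * (γ * n) := by
      rw [sum_const, nsmul_eq_mul]
      have a1 : (A0.card : ℝ) ≤ n := by
        have := card_le_univ A0
        rw [Fintype.card_fin] at this
        exact_mod_cast this
      have a2 : (C0.card : ℝ) ≤ n := by
        have := card_le_univ C0
        rw [Fintype.card_fin] at this
        exact_mod_cast this
      have a3 : (A0.card : ℝ) * C0.card ≤ n * n := by gcongr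
      have a4 : γ ^ 2 * ((Y i0).card : ℝ) * (A0.card * C0.card) ≤ γ ^ 2 * ((Y i0).card : ℝ) * (n * n) := by
        gcongr
      linarith
    refine e1.trans (sum_le_sum fun b _ => ?_)
    have := dA b
    have := dC b
    gcongr
  obtain ⟨m, hm, hmR, B', hB', A', hA', C', hC', hBc, hAc, hCc, hgood⟩ :=
    box_increment (fun b a c : Fin n =>
      (if E (i0 - 1) a b then (1 : ℝ) else 0) * (if E i0 b c then 1 else 0))
      (by intro a b c; split_ifs <;> simp) (γ ^ 2) (by positivity) R m0 hR hm0 J (γ ^ 2) le_rfl hJ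
      (Y i0) A0 C0 (hYc i0).ge cA cC hdens
  choose Z hZ hZc using fun i => exists_subset_card_eq (s := Y i) (n := R * m) (by rw [hYc]; exact hmR)
  -- distinctness
  have d1 : i0 - 1 ≠ i0 := by
    intro hc
    have : (1 : ZMod k) = 0 := by linear_combination -hc
    have := (ZMod.natCast_eq_zero_iff 1 k).1 (by simpa using this)
    have := Nat.le_of_dvd (by norm_num) this
    omega
  have d2 : i0 + 1 ≠ i0 := by
    intro hc
    have : (1 : ZMod k) = 0 := by linear_combination hc
    have := (ZMod.natCast_eq_zero_iff 1 k).1 (by simpa using this)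
    have := Nat.le_of_dvd (by norm_num) this
    omega
  have d3 : i0 + 1 ≠ i0 - 1 := by
    intro hc
    have : (2 : ZMod k) = 0 := by linear_combination hc
    have := (ZMod.natCast_eq_zero_iff 2 k).1 (by simpa using this)
    have := Nat.le_of_dvd (by norm_num) this
    omega
  set A : ZMod k → Finset (Fin n) := fun i =>
    if i = i0 then B' else if i = i0 - 1 then A' else if i = i0 + 1 then C' else Z i with hA
  have Ai0 : A i0 = B' := by simp [hA]
  have Aim : A (i0 - 1) = A' := by simp only [hA, if_neg d1, if_true]
  have Aip : A (i0 + 1) = C' := by simp only [hA, if_neg d2, if_neg d3, if_true]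
  refine ⟨A, m, hm, hmR, ?_, ?_, ?_⟩
  · intro i
    simp only [hA]
    split_ifs
    · exact hBc
    · exact hAc
    · exact hCc
    · exact hZc i
  · refine good_of_dense hk E h hh hE (γ ^ 2) m ?_ (h2.trans hm) i0 A ?_
    · refine h4.trans_le ?_
      have : (m0 : ℝ) ≤ m := by exact_mod_cast hm
      gcongr
    · rw [Ai0, Aim, Aip]
      exact hgood
  · set s : ℝ := ((R * m : ℕ) : ℝ) with hs
    have hs0' : 0 ≤ s := Nat.cast_nonneg _
    have gen : ∀ (X : Finset (Fin n)) (f : Fin n → ℝ) (c : ℝ), X.card = R * m → (∀ x ∈ X, f x ≤ c) →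
        ∑ x ∈ X, f x ≤ s * c := by
      intro X f c hX hf
      have := sum_le_card_nsmul X f c hf
      rwa [hX, nsmul_eq_mul] at this
    set e : ZMod k → ℝ := fun i => (if i = i0 - 1 then W (i0 - 1) / ρ else 0) +
      (if i = i0 + 1 then W (i0 + 1) / ρ else 0) with he
    have he0 : ∀ i, 0 ≤ e i := by
      intro i
      have := hW0 (i0 - 1)
      have := hW0 (i0 + 1)
      simp only [he]
      split_ifs <;> positivity
    have bd : ∀ i, ∑ x ∈ A i, w i x ≤ s * (μ i + e i) := by
      intro i
      by_cases c1 : i = i0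
      · subst c1
        rw [Ai0]
        refine gen _ _ _ hBc fun x hx => ?_
        linarith [hYle i x (hB' hx), he0 i]
      by_cases c2 : i = i0 - 1
      · subst c2
        rw [Aim]
        refine gen _ _ _ hAc fun x hx => ?_
        have t1 := (mem_filter.1 (hA' hx)).2
        have t2 : e (i0 - 1) = W (i0 - 1) / ρ := by simp [he, d3.symm]
        linarith [hw'le (i0 - 1) x]
      by_cases c3 : i = i0 + 1
      · subst c3
        rw [Aip]
        refine gen _ _ _ hCc fun x hx => ?_
        have t1 := (mem_filter.1 (hC' hx)).2
        have t2 : e (i0 + 1) = W (i0 + 1) / ρ := by simp [he, d3]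
        linarith [hw'le (i0 + 1) x]
      · have : A i = Z i := by simp only [hA, if_neg c1, if_neg c2, if_neg c3]
        rw [this]
        refine gen _ _ _ (hZc i) fun x hx => ?_
        linarith [hYle i x (hZ i hx), he0 i]
    have hesum : ∑ i, e i ≤ (∑ i, W i) / n := by
      have : ∑ i, e i = (W (i0 - 1) + W (i0 + 1)) / ρ := by
        simp only [he, sum_add_distrib, sum_ite_eq', mem_univ, if_true]
        ring
      rw [this, div_le_div_iff₀ hρp hnp, hρ]
      have := mul_le_mul_of_nonneg_right hi0 hnp.le
      linarith
    have t1 : ∑ i, ∑ x ∈ A i, w i x ≤ s * (∑ i, μ i + ∑ i, e i) := by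
      rw [← sum_add_distrib, mul_sum]
      exact sum_le_sum fun i _ => bd i
    have t2 : (∑ i, μ i) * (n - s0) + ∑ i, W i ≤ ∑ i, ∑ x, w i x := by
      rw [sum_mul, ← sum_add_distrib]
      exact sum_le_sum fun i _ => htot i
    have hM0 : 0 ≤ ∑ i, μ i := sum_nonneg fun i _ => hμ0 i
    have hWW0 : 0 ≤ ∑ i, W i := sum_nonneg fun i _ => hW0 i
    generalize ∑ i, μ i = M at *
    generalize ∑ i, W i = WW at *
    generalize ∑ i, ∑ x, w i x = tot at *
    have hσp : 0 < 1 - σ := by linarith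
    have hσ0 : 0 < σ := by
      have : (0 : ℝ) < s0 := by exact_mod_cast hs0p
      by_contra hc
      push Not at hc
      nlinarith
    have t3 : (M + WW / n) * ((1 - σ) * n) ≤ tot := by
      have : (M + WW / n) * ((1 - σ) * n) = M * ((1 - σ) * n) + (1 - σ) * WW := by
        field_simp
      rw [this]
      have q1 : M * ((1 - σ) * n) ≤ M * (n - s0) := by
        apply mul_le_mul_of_nonneg_left _ hM0
        linarith
      nlinarith
    have t4 : M + WW / n ≤ tot / ((1 - σ) * n) := by
      rw [le_div_iff₀ (by positivity)]; exact t3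
    calc _ ≤ s * (M + ∑ i, e i) := t1
      _ ≤ s * (tot / ((1 - σ) * n)) := by
        apply mul_le_mul_of_nonneg_left _ hs0'
        linarith
      _ = _ := by ring

end TransTiling

namespace TransTiling
open Finset

lemma equal_parts {ι α : Type*} [DecidableEq ι] [DecidableEq α] (q : ℕ) (S : Finset ι) :
    ∀ U : Finset α, q * S.card ≤ U.card →
    ∃ B : ι → Finset α, (∀ t, B t ⊆ U) ∧ (∀ t t', t ≠ t' → Disjoint (B t) (B t')) ∧
      ∀ t ∈ S, (B t).card = q := by
  induction S using Finset.induction_on with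
  | empty => intro U _; exact ⟨fun _ => ∅, by simp, by simp, by simp⟩
  | insert a S ha ih =>
    intro U hU
    rw [card_insert_of_notMem ha, mul_add, mul_one] at hU
    obtain ⟨X, hX, hXc⟩ := exists_subset_card_eq (s := U) (n := q) (by omega)
    have hc := card_sdiff_add_card_eq_card hX
    obtain ⟨B, hBU, hBd, hBc⟩ := ih (U \ X) (by omega)
    have hdis : ∀ t, Disjoint (B t) X := fun t =>
      disjoint_of_subset_left (hBU t) sdiff_disjoint
    refine ⟨Function.update B a X, ?_, ?_, ?_⟩
    · intro t
      by_cases h : t = a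
      · subst h; simpa using hX
      · simp only [Function.update_of_ne h]
        exact (hBU t).trans sdiff_subset
    · intro t t' htt
      by_cases h : t = a
      · subst h
        rw [Function.update_self, Function.update_of_ne htt.symm]
        exact (hdis t').symm
      · by_cases h' : t' = a
        · subst h'
          rw [Function.update_self, Function.update_of_ne h]
          exact hdis t
        · rw [Function.update_of_ne h, Function.update_of_ne h']
          exact hBd t t' htt
    · intro t ht
      by_cases h : t = a
      · subst h; simpa using hXc
      · rw [Function.update_of_ne h]
        exact hBc t ((mem_insert.1 ht).resolve_left h)

lemma split {α : Type*} [Fintype α] [DecidableEq α] (N : ℕ) (A : Fin N → Finset α) :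
    ∃ B : Fin N → Finset α, (∀ t, B t ⊆ A t) ∧ (∀ t t', t ≠ t' → Disjoint (B t) (B t')) ∧
      ∀ t, ∑ x ∈ A t, (1 : ℝ) / ((univ.filter (fun t => x ∈ A t)).card : ℝ) - 2 ^ N
        ≤ ((B t).card : ℝ) := by
  set sig : α → Finset (Fin N) := fun x => univ.filter (fun t => x ∈ A t) with hsig
  set U : Finset (Fin N) → Finset α := fun S => univ.filter (fun x => sig x = S) with hU
  choose P hPU hPd hPc using fun S : Finset (Fin N) =>
    equal_parts ((U S).card / S.card) S (U S) (Nat.div_mul_le_self _ _)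
  have hPsig : ∀ S t x, x ∈ P S t → sig x = S := fun S t x hx => (mem_filter.1 (hPU S t hx)).2
  refine ⟨fun t => (univ.filter (fun S : Finset (Fin N) => t ∈ S)).biUnion (fun S => P S t), ?_, ?_, ?_⟩
  · intro t x hx
    simp only [mem_biUnion, mem_filter, mem_univ, true_and] at hx
    obtain ⟨S, htS, hxS⟩ := hx
    have := hPsig S t x hxS
    rw [← this] at htS
    simpa [hsig] using htS
  · intro t t' htt
    rw [disjoint_left]
    intro x hx hx'
    simp only [mem_biUnion, mem_filter, mem_univ, true_and] at hx hx'
    obtain ⟨S, htS, hxS⟩ := hx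
    obtain ⟨S', htS', hxS'⟩ := hx'
    have e1 := hPsig S t x hxS
    have e2 := hPsig S' t' x hxS'
    have : S = S' := e1.symm.trans e2
    subst this
    exact disjoint_left.1 (hPd S t t' htt) hxS hxS'
  · intro t
    rw [card_biUnion]
    swap
    · intro S _ S' _ hSS
      change Disjoint (P S t) (P S' t)
      rw [disjoint_left]
      intro x hx hx'
      exact hSS ((hPsig S t x hx).symm.trans (hPsig S' t x hx'))
    have hfib := sum_fiberwise_of_maps_to (s := A t)
      (t := univ.filter (fun S : Finset (Fin N) => t ∈ S)) (g := sig)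
      (fun x hx => by simpa [hsig] using hx) (fun x => (1 : ℝ) / ((sig x).card : ℝ))
    rw [← hfib]
    push_cast
    have hterm : ∀ S ∈ univ.filter (fun S : Finset (Fin N) => t ∈ S),
        ∑ x ∈ A t with sig x = S, (1 : ℝ) / ((sig x).card : ℝ) ≤ ((P S t).card : ℝ) + 1 := by
      intro S hS
      have htS : t ∈ S := (mem_filter.1 hS).2
      rw [hPc S t htS]
      have h1 : ∑ x ∈ A t with sig x = S, (1 : ℝ) / ((sig x).card : ℝ)
          = ∑ x ∈ A t with sig x = S, (1 : ℝ) / (S.card : ℝ) :=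
        sum_congr rfl fun x hx => by rw [(mem_filter.1 hx).2]
      rw [h1, sum_const, nsmul_eq_mul]
      have h2 : ((A t).filter (fun x => sig x = S)).card ≤ (U S).card :=
        card_le_card (filter_subset_filter _ (subset_univ _))
      have hSp : 0 < S.card := card_pos.2 ⟨t, htS⟩
      have hSp' : (0 : ℝ) < S.card := by exact_mod_cast hSp
      have h3 : (U S).card ≤ ((U S).card / S.card + 1) * S.card := by
        have := Nat.div_add_mod (U S).card S.card
        have := Nat.mod_lt (U S).card hSp
        nlinarith
      have h4 : (((A t).filter (fun x => sig x = S)).card : ℝ)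
          ≤ (((U S).card / S.card : ℕ) + 1) * S.card := by exact_mod_cast h2.trans h3
      rw [mul_one_div, div_le_iff₀ hSp']
      exact h4
    have hsum := sum_le_sum hterm
    rw [sum_add_distrib, sum_const, nsmul_eq_mul, mul_one] at hsum
    have hcard : ((univ.filter (fun S : Finset (Fin N) => t ∈ S)).card : ℝ) ≤ 2 ^ N := by
      have : (univ.filter (fun S : Finset (Fin N) => t ∈ S)).card ≤ 2 ^ N := by
        refine (card_filter_le _ _).trans ?_
        simp
      exact_mod_cast this
    linarith

lemma greedy {k n : ℕ} (E : ZMod k → Fin n → Fin n → Prop) (A : ZMod k → Finset (Fin n)) (m : ℕ)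
    (hA : Good E A m) (r : ℕ) : ∀ B : ZMod k → Finset (Fin n), (∀ i, B i ⊆ A i) →
    (∀ i, r ≤ (B i).card - m) →
    ∃ c : Fin r → ZMod k → Fin n, (∀ j i, c j i ∈ B i) ∧ (∀ j i, E i (c j i) (c j (i + 1))) ∧
      ∀ i, Function.Injective fun j => c j i := by
  induction r with
  | zero =>
    intro B _ _
    exact ⟨fun j => j.elim0, fun j => j.elim0, fun j => j.elim0, fun i j => j.elim0⟩
  | succ r ih =>
    intro B hB hr
    obtain ⟨c0, hc0, hcE⟩ := hA B hB (fun i => by have := hr i; omega)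
    obtain ⟨c, h1, h2, h3⟩ := ih (fun i => (B i).erase (c0 i))
      (fun i => (erase_subset _ _).trans (hB i))
      (fun i => by have := hr i; rw [card_erase_of_mem (hc0 i)]; omega)
    refine ⟨Fin.cons c0 c, ?_, ?_, ?_⟩
    · intro j
      refine Fin.cases ?_ (fun j => ?_) j
      · exact hc0
      · intro i; exact (mem_erase.1 (h1 j i)).2
    · intro j
      refine Fin.cases ?_ (fun j => ?_) j
      · exact hcE
      · exact h2 j
    · intro i j j'
      refine Fin.cases ?_ (fun j => ?_) j <;> refine Fin.cases ?_ (fun j' => ?_) j'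
      · simp
      · intro h
        simp only [Fin.cons_zero, Fin.cons_succ] at h
        exact absurd h.symm (mem_erase.1 (h1 j' i)).1
      · intro h
        simp only [Fin.cons_zero, Fin.cons_succ] at h
        exact absurd h (mem_erase.1 (h1 j i)).1
      · intro h
        simp only [Fin.cons_succ] at h
        exact congrArg Fin.succ (h3 i h)

lemma mw {k n : ℕ} [NeZero k] (hn : 0 < n) (E : ZMod k → Fin n → Fin n → Prop) (m0 R : ℕ)
    (σ η D : ℝ) (hσ1 : σ < 1) (hη : 0 < η) (hη1 : η ≤ 1) (hD : 0 ≤ D) (hR : 1 ≤ R)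
    (hstep : ∀ w : ZMod k → Fin n → ℝ, (∀ i x, 0 ≤ w i x) →
      ∃ (A : ZMod k → Finset (Fin n)) (m : ℕ), m0 ≤ m ∧ R * m ≤ n ∧
      (∀ i, (A i).card = R * m) ∧ Good E A m ∧
      ∑ i, ∑ x ∈ A i, w i x ≤ (R * m : ℕ) / ((1 - σ) * n) * ∑ i, ∑ x, w i x) (N : ℕ) :
    ∃ N' ≤ N, ∃ (A : Fin N' → ZMod k → Finset (Fin n)) (m : Fin N' → ℕ),
      (∀ t i, (A t i).card = R * m t) ∧ (∀ t, Good E (A t) (m t)) ∧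
      ∑ i, ∑ x, Real.exp (η * ∑ t, if x ∈ A t i then 1 else 0) ≤
        k * n * Real.exp ((η + η ^ 2) / ((1 - σ) * n) * ∑ t, (R * m t : ℝ)) ∧
      ∑ t, (R * m t : ℝ) ≤ (D + 1) * n ∧
      (D * n ≤ ∑ t, (R * m t : ℝ) ∨ (N * m0 : ℝ) ≤ ∑ t, (R * m t : ℝ)) := by
  have hnp : (0 : ℝ) < n := by exact_mod_cast hn
  induction N with
  | zero =>
    refine ⟨0, le_rfl, fun t => t.elim0, fun t => t.elim0, fun t => t.elim0, fun t => t.elim0, ?_, ?_, ?_⟩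
    · simp [ZMod.card]
    · simp; positivity
    · simp
  | succ N ih =>
    obtain ⟨N', hN', A, m, hAc, hAG, hΦ, hle, hor⟩ := ih
    by_cases hDn : D * n ≤ ∑ t, (R * m t : ℝ)
    · exact ⟨N', by omega, A, m, hAc, hAG, hΦ, hle, Or.inl hDn⟩
    have hN := hor.resolve_left hDn
    push Not at hDn
    obtain ⟨A', m', hm0, hm'n, hc', hG', hw'⟩ := hstep
      (fun i x => Real.exp (η * ∑ t, if x ∈ A t i then 1 else 0)) (fun i x => (Real.exp_pos _).le)
    refine ⟨N' + 1, by omega, Fin.cons A' A, Fin.cons m' m, ?_, ?_, ?_, ?_, ?_⟩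
    · intro t
      refine Fin.cases ?_ (fun t => ?_) t
      · exact hc'
      · exact hAc t
    · intro t
      refine Fin.cases ?_ (fun t => ?_) t
      · exact hG'
      · exact hAG t
    · simp only [Fin.sum_univ_succ, Fin.cons_zero, Fin.cons_succ]
      set Φ := ∑ i, ∑ x, Real.exp (η * ∑ t, if x ∈ A t i then 1 else 0) with hΦdef
      have hΦ0 : 0 ≤ Φ := sum_nonneg fun i _ => sum_nonneg fun x _ => (Real.exp_pos _).le
      have heq : ∑ i, ∑ x, Real.exp (η * ((if x ∈ A' i then 1 else 0) + ∑ t, if x ∈ A t i then 1 else 0))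
          = Φ + (Real.exp η - 1) * ∑ i, ∑ x ∈ A' i, Real.exp (η * ∑ t, if x ∈ A t i then 1 else 0) := by
        rw [hΦdef, mul_sum, ← sum_add_distrib]
        refine sum_congr rfl fun i _ => ?_
        have : ∑ x ∈ A' i, Real.exp (η * ∑ t, if x ∈ A t i then 1 else 0)
            = ∑ x, if x ∈ A' i then Real.exp (η * ∑ t, if x ∈ A t i then 1 else 0) else 0 := by
          simp
        rw [this, mul_sum, ← sum_add_distrib]
        refine sum_congr rfl fun x _ => ?_
        split_ifs
        · rw [mul_add, Real.exp_add, mul_one]; ring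
        · simp
      rw [heq]
      have hexp : Real.exp η - 1 ≤ η + η ^ 2 := by
        have := Real.abs_exp_sub_one_sub_id_le (x := η) (by rw [abs_of_pos hη]; exact hη1)
        have := (abs_le.1 this).2
        linarith
      have hexp0 : 0 ≤ Real.exp η - 1 := by
        have := Real.add_one_le_exp η
        linarith
      have hσp : 0 < 1 - σ := by linarith
      set y := (η + η ^ 2) / ((1 - σ) * n) * (R * m' : ℝ) with hy
      have hΨ0 : 0 ≤ ∑ i, ∑ x ∈ A' i, Real.exp (η * ∑ t, if x ∈ A t i then 1 else 0) :=
        sum_nonneg fun i _ => sum_nonneg fun x _ => (Real.exp_pos _).le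
      change _ ≤ (R * m' : ℕ) / ((1 - σ) * n) * Φ at hw'
      clear heq
      clear_value Φ
      generalize ∑ i, ∑ x ∈ A' i, Real.exp (η * ∑ t, if x ∈ A t i then 1 else 0) = Ψ at *
      calc Φ + (Real.exp η - 1) * Ψ
          ≤ Φ + (η + η ^ 2) * ((R * m' : ℕ) / ((1 - σ) * n) * Φ) :=
            add_le_add le_rfl (mul_le_mul hexp hw' hΨ0 (by positivity))
        _ = Φ * (y + 1) := by rw [hy]; push_cast; ring
        _ ≤ Φ * Real.exp y := by
            apply mul_le_mul_of_nonneg_left (Real.add_one_le_exp y) hΦ0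
        _ ≤ (k * n * Real.exp ((η + η ^ 2) / ((1 - σ) * n) * ∑ t, (R * m t : ℝ))) * Real.exp y :=
            mul_le_mul_of_nonneg_right hΦ (Real.exp_pos _).le
        _ = _ := by
            rw [mul_assoc, ← Real.exp_add, hy]
            congr 2
            ring
    · simp only [Fin.sum_univ_succ, Fin.cons_zero, Fin.cons_succ]
      have : (R * m' : ℝ) ≤ n := by exact_mod_cast hm'n
      linarith
    · right
      simp only [Fin.sum_univ_succ, Fin.cons_zero, Fin.cons_succ]
      have : (m0 : ℝ) ≤ R * m' := by
        exact_mod_cast hm0.trans (Nat.le_mul_of_pos_left _ (by omega))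
      push_cast
      linarith

lemma assemble {k n : ℕ} [NeZero k] (E : ZMod k → Fin n → Fin n → Prop) (R N : ℕ)
    (A : Fin N → ZMod k → Finset (Fin n)) (m : Fin N → ℕ) (η D' : ℝ) (hη : 0 < η) (hD' : 0 < D')
    (hAc : ∀ t i, (A t i).card = R * m t) (hAG : ∀ t, Good E (A t) (m t))
    (hΦ : ∑ i, ∑ x, Real.exp (η * ∑ t, if x ∈ A t i then 1 else 0) ≤ k * n * Real.exp (η * D')) :
    ∃ (M : ℕ) (c : Fin M → ZMod k → Fin n), (∀ j i, E i (c j i) (c j (i + 1))) ∧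
      (∀ i, Function.Injective fun j => c j i) ∧
      (∑ t, (R * m t : ℝ)) / D' - k * n / (η * D') - N * 2 ^ N - ∑ t, (m t : ℝ) ≤ M := by
  choose B hBA hBd hBc using fun i : ZMod k => split N (fun t => A t i)
  set ℓ : ZMod k → Fin n → ℝ := fun i x => ((univ.filter (fun t => x ∈ A t i)).card : ℝ) with hℓ
  have hℓs : ∀ i x, (∑ t, if x ∈ A t i then (1 : ℝ) else 0) = ℓ i x := by
    intro i x; simp [hℓ]
  simp only [hℓs] at hΦ
  set e : ZMod k → Fin n → ℝ := fun i x => Real.exp (η * (ℓ i x - D')) / (η * D' * ℓ i x) with he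
  have hℓ0 : ∀ i x, 0 ≤ ℓ i x := fun i x => Nat.cast_nonneg _
  have he0 : ∀ i x, 0 ≤ e i x := fun i x => by
    have := hℓ0 i x
    simp only [he]; positivity
  have hpt : ∀ t i, ∀ x ∈ A t i, 1 / D' - e i x ≤ 1 / ℓ i x := by
    intro t i x hx
    have hp : 0 < ℓ i x := by
      simp only [hℓ]
      exact_mod_cast card_pos.2 ⟨t, by simpa using hx⟩
    have h1 := Real.add_one_le_exp (η * (ℓ i x - D'))
    have h2 : 1 / D' - 1 / ℓ i x = η * (ℓ i x - D') / (η * D' * ℓ i x) := by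
      field_simp
    have h3 : η * (ℓ i x - D') / (η * D' * ℓ i x) ≤ e i x := by
      simp only [he]
      gcongr
      linarith
    linarith
  have hlow : ∀ t i, (R * m t : ℝ) / D' - ∑ j, ∑ x ∈ A t j, e j x - 2 ^ N ≤ ((B i t).card : ℝ) := by
    intro t i
    refine le_trans ?_ (hBc i t)
    have h1 := sum_le_sum (hpt t i)
    rw [sum_sub_distrib, sum_const, hAc, nsmul_eq_mul] at h1
    have h2 : ∑ x ∈ A t i, e i x ≤ ∑ j, ∑ x ∈ A t j, e j x :=
      single_le_sum (f := fun j => ∑ x ∈ A t j, e j x)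
        (fun j _ => sum_nonneg fun x _ => he0 j x) (mem_univ i)
    push_cast at h1
    rw [mul_one_div] at h1
    simp only [hℓ] at h1
    linarith
  set X : Fin N → ℝ := fun t => (R * m t : ℝ) / D' - ∑ j, ∑ x ∈ A t j, e j x - 2 ^ N - m t with hX
  have hr : ∀ t i, ⌈X t⌉₊ ≤ (B i t).card - m t := by
    intro t i
    rw [Nat.ceil_le]
    have h1 := hlow t i
    have h2 : ((B i t).card : ℝ) ≤ ((B i t).card - m t : ℕ) + m t := by
      exact_mod_cast (by omega)
    simp only [hX]
    linarith
  choose c hcB hcE hcI using fun t => greedy E (A t) (m t) (hAG t) ⌈X t⌉₊ (fun i => B i t)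
    (fun i => hBA i t) (hr t)
  let e' := (finSigmaFinEquiv (m := N) (n := fun t => ⌈X t⌉₊)).symm
  refine ⟨∑ t, ⌈X t⌉₊, fun j => c (e' j).1 (e' j).2, fun j i => hcE _ _ i, ?_, ?_⟩
  · intro i j j' hjj
    apply e'.injective
    change c (e' j).1 (e' j).2 i = c (e' j').1 (e' j').2 i at hjj
    generalize e' j = p at hjj
    generalize e' j' = p' at hjj
    obtain ⟨t, a⟩ := p
    obtain ⟨t', a'⟩ := p'
    dsimp only at hjj
    have htt : t = t' := by
      by_contra hne
      have := disjoint_left.1 (hBd i t t' hne) (hcB t a i)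
      rw [hjj] at this
      exact this (hcB t' a' i)
    subst htt
    rw [hcI t i hjj]
  · push_cast
    have h1 : ∑ t, X t ≤ ∑ t, (⌈X t⌉₊ : ℝ) := sum_le_sum fun t _ => Nat.le_ceil _
    have h2 : ∑ t, X t = (∑ t, (R * m t : ℝ)) / D' - ∑ t, ∑ j, ∑ x ∈ A t j, e j x - N * 2 ^ N
        - ∑ t, (m t : ℝ) := by
      simp only [hX, sum_sub_distrib, sum_const, card_univ, Fintype.card_fin, nsmul_eq_mul, sum_div]
    have h3 : ∑ t, ∑ j, ∑ x ∈ A t j, e j x = ∑ j, ∑ x, ℓ j x * e j x := by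
      rw [sum_comm]
      refine sum_congr rfl fun j _ => ?_
      have : ∀ t, ∑ x ∈ A t j, e j x = ∑ x, (if x ∈ A t j then 1 else 0) * e j x := by
        intro t; simp
      simp only [this]
      rw [sum_comm]
      refine sum_congr rfl fun x _ => ?_
      rw [← sum_mul, hℓs]
    have h4 : ∑ j, ∑ x, ℓ j x * e j x ≤ ∑ j, ∑ x, Real.exp (η * ℓ j x) * (Real.exp (- (η * D')) / (η * D')) := by
      refine sum_le_sum fun j _ => sum_le_sum fun x _ => ?_
      rcases (hℓ0 j x).eq_or_lt with h0 | hp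
      · rw [← h0, zero_mul]; positivity
      · apply le_of_eq
        simp only [he]
        rw [mul_sub, sub_eq_add_neg, Real.exp_add]
        field_simp
    have h5 : ∑ j, ∑ x, Real.exp (η * ℓ j x) * (Real.exp (- (η * D')) / (η * D')) ≤ k * n / (η * D') := by
      simp only [← sum_mul]
      calc _ ≤ k * n * Real.exp (η * D') * (Real.exp (- (η * D')) / (η * D')) := by
            gcongr
        _ = k * n * (Real.exp (η * D') * Real.exp (- (η * D'))) / (η * D') := by ring
        _ = _ := by rw [← Real.exp_add]; simp
    linarith

end TransTiling

set_option maxHeartbeats 1000000 in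
open TransTiling in
/-- **Lemma 4 (Almost perfect tiling).** Given a positive integer `k` divisible by `4` and
constants `δ > 2/k`, `ζ > 0`, there exists `α > 0` such that for all sufficiently large `n`:
every spanning subgraph `G` of the `n`-blow-up of `C_k` with `δ̄(G) ≥ δn` and `α*_b(G) < αn`
contains a collection of `m` pairwise vertex-disjoint transversal copies of `C_k` covering all
but at most `ζn` vertices, i.e., `kn − km ≤ ζn`. -/
theorem almost_perfect_transversal_tiling
    (k : ℕ) (hk : 0 < k) (hk4 : 4 ∣ k) (δ ζ : ℝ) (hδ : 2 / k < δ) (hζ : 0 < ζ) :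
    ∃ α : ℝ, 0 < α ∧ ∃ n₀ : ℕ, ∀ n : ℕ, n₀ ≤ n →
      ∀ G : SimpleGraph (ZMod k × Fin n),
        (∀ u v : ZMod k × Fin n, G.Adj u v → v.1 = u.1 + 1 ∨ u.1 = v.1 + 1) →
        (∀ (i : ZMod k) (a : Fin n),
          δ * n ≤ (({b : Fin n | G.Adj (i, a) (i + 1, b)}).ncard : ℝ) ∧
          δ * n ≤ (({b : Fin n | G.Adj (i, a) (i - 1, b)}).ncard : ℝ)) →
        (∀ (i : ZMod k) (S T : Finset (Fin n)), S.card = T.card →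
          α * n ≤ (S.card : ℝ) → ∃ a ∈ S, ∃ b ∈ T, G.Adj (i, a) (i + 1, b)) →
        ∃ (m : ℕ) (c : Fin m → ZMod k → Fin n),
          (∀ (j : Fin m) (i : ZMod k), G.Adj (i, c j i) (i + 1, c j (i + 1))) ∧
          (∀ i : ZMod k, Function.Injective fun j => c j i) ∧
          (k * n : ℝ) - k * m ≤ ζ * n := by
  classical
  have : NeZero k := ⟨hk.ne'⟩
  have hk4' : 4 ≤ k := Nat.le_of_dvd hk hk4
  have hkp : (0 : ℝ) < k := by exact_mod_cast hk
  obtain ⟨γ, hγ, hγδ⟩ : ∃ γ : ℝ, 0 < γ ∧ 2 / k + γ = δ := ⟨δ - 2 / k, by linarith, by ring⟩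
  obtain ⟨z, hz, hz1, hzζ⟩ : ∃ z : ℝ, 0 < z ∧ z ≤ 1 ∧ k * z ≤ ζ := by
    refine ⟨min (ζ / k) 1, by positivity, min_le_right _ _, ?_⟩
    calc k * min (ζ / k) 1 ≤ k * (ζ / k) := by gcongr; exact min_le_left _ _
      _ = ζ := by field_simp
  obtain ⟨σ, hσ, hσγ, hσz⟩ : ∃ σ : ℝ, 0 < σ ∧ σ ≤ γ ∧ σ ≤ z / 8 :=
    ⟨min γ (z / 8), by positivity, min_le_left _ _, min_le_right _ _⟩
  obtain ⟨η, hηdef⟩ : ∃ η : ℝ, η = z / 8 := ⟨_, rfl⟩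
  have hη : 0 < η := by rw [hηdef]; positivity
  obtain ⟨D, hD, hDk⟩ : ∃ D : ℝ, 0 < D ∧ k = η * D * (z / 8) :=
    ⟨8 * k / (η * z), by positivity, by field_simp⟩
  obtain ⟨R, hR, hRD⟩ : ∃ R : ℕ, 2 ≤ R ∧ D + 1 ≤ R * (z / 8) := by
    obtain ⟨R, hR⟩ := exists_nat_ge ((D + 1) / (z / 8))
    refine ⟨R + 2, by omega, ?_⟩
    rw [div_le_iff₀ (by positivity)] at hR
    push_cast
    nlinarith
  have hRp : (0 : ℝ) < R := by exact_mod_cast (by omega : 0 < R)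
  obtain ⟨J, hJ⟩ : ∃ J : ℕ, 1 < γ ^ 2 + J * (γ ^ 2 / (2 * (R : ℝ) ^ 3)) := by
    obtain ⟨J, hJ⟩ := exists_nat_gt (1 / (γ ^ 2 / (2 * (R : ℝ) ^ 3)))
    refine ⟨J, ?_⟩
    rw [div_lt_iff₀ (by positivity)] at hJ
    have : 0 < γ ^ 2 := by positivity
    linarith
  obtain ⟨c, hc, hcdef⟩ : ∃ c : ℝ, 0 < c ∧ σ / (R : ℝ) ^ J = 2 * c :=
    ⟨σ / (R : ℝ) ^ J / 2, by positivity, by ring⟩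
  obtain ⟨α, hα, hα1, hα2⟩ : ∃ α : ℝ, 0 < α ∧ 8 * α < γ ^ 2 * c ∧ 4 * α ≤ c := by
    refine ⟨c * min (γ ^ 2) 1 / 16, by positivity, ?_, ?_⟩
    · have : min (γ ^ 2) 1 ≤ γ ^ 2 := min_le_left _ _
      have h2 : c * min (γ ^ 2) 1 ≤ c * γ ^ 2 := by gcongr
      have : 0 < c * γ ^ 2 := by positivity
      linarith
    · have : min (γ ^ 2) 1 ≤ 1 := min_le_right _ _
      have h2 : c * min (γ ^ 2) 1 ≤ c * 1 := by gcongr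
      linarith
  obtain ⟨N, hN⟩ := exists_nat_ge (D / c)
  rw [div_le_iff₀ hc] at hN
  obtain ⟨n1, hn1⟩ := exists_nat_ge (1 / c)
  obtain ⟨n2, hn2⟩ := exists_nat_ge (1 / α)
  obtain ⟨n3, hn3⟩ := exists_nat_ge ((N * 2 ^ N : ℝ) / (z / 8))
  refine ⟨α, hα, n1 + n2 + n3 + 1, ?_⟩
  intro n hn G _ hdeg hhole
  have hn0 : 0 < n := by omega
  have hnp : (0 : ℝ) < n := by exact_mod_cast hn0
  have hnc : 1 ≤ c * n := by
    have h1 : (n1 : ℝ) ≤ n := by exact_mod_cast (by omega)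
    have := hn1.trans h1
    rw [div_le_iff₀ hc] at this
    linarith
  have hnα : 1 ≤ α * n := by
    have h1 : (n2 : ℝ) ≤ n := by exact_mod_cast (by omega)
    have := hn2.trans h1
    rw [div_le_iff₀ hα] at this
    linarith
  have hnN : (N * 2 ^ N : ℝ) ≤ z / 8 * n := by
    have h1 : (n3 : ℝ) ≤ n := by exact_mod_cast (by omega)
    have := hn3.trans h1
    rw [div_le_iff₀ (by positivity)] at this
    linarith
  set E : ZMod k → Fin n → Fin n → Prop := fun i a b => G.Adj (i, a) (i + 1, b) with hE
  obtain ⟨h, hhα, hhα2, hh0⟩ : ∃ h : ℕ, α * n ≤ h ∧ (h : ℝ) ≤ 2 * (α * n) ∧ 0 < h := by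
    refine ⟨⌈α * n⌉₊, Nat.le_ceil _, ?_, Nat.ceil_pos.2 (by positivity)⟩
    have := Nat.ceil_lt_add_one (a := α * n) (by positivity)
    linarith
  obtain ⟨m0, hm0u, hm0l⟩ : ∃ m0 : ℕ, (m0 : ℝ) ≤ 2 * c * n ∧ c * n ≤ m0 := by
    refine ⟨⌊2 * c * n⌋₊, Nat.floor_le (by positivity), ?_⟩
    have := Nat.lt_floor_add_one (2 * c * n)
    linarith
  have hs0 : ((R ^ J * m0 : ℕ) : ℝ) ≤ σ * n := by
    push_cast
    calc (R : ℝ) ^ J * m0 ≤ (R : ℝ) ^ J * (2 * c * n) := by gcongr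
      _ = σ * n := by rw [← hcdef]; field_simp
  have hσ1 : σ < 1 := by linarith
  have hcardeq : ∀ P : Fin n → Prop, ({b : Fin n | P b}).ncard = (Finset.univ.filter P).card := by
    intro P
    rw [← Set.ncard_coe_finset]
    simp
  have hstep : ∀ w : ZMod k → Fin n → ℝ, (∀ i x, 0 ≤ w i x) →
      ∃ (A : ZMod k → Finset (Fin n)) (m : ℕ), m0 ≤ m ∧ R * m ≤ n ∧
      (∀ i, (A i).card = R * m) ∧ Good E A m ∧
      ∑ i, ∑ x ∈ A i, w i x ≤ (R * m : ℕ) / ((1 - σ) * n) * ∑ i, ∑ x, w i x := by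
    intro w hw
    obtain ⟨A, m, a1, a2, a3⟩ := key hk4' hn0 E h m0 R J γ σ hγ
      (by
        intro i a
        rw [hγδ]
        have := (hdeg i a).1
        rw [hcardeq] at this
        exact this)
      (by
        intro i b
        rw [hγδ]
        have := (hdeg (i + 1) b).2
        rw [hcardeq] at this
        refine this.trans (le_of_eq ?_)
        congr 2
        ext a
        simp only [hE, Finset.mem_filter, Finset.mem_univ, true_and, add_sub_cancel_right]
        exact G.adj_comm _ _)
      hh0
      (by
        intro i S T hS hT
        exact hhole i S T (hS.trans hT.symm) (by rw [hS]; exact hhα))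
      hR hJ hs0 hσγ hσ1
      (by
        calc 4 * (h : ℝ) ≤ 8 * α * n := by linarith
          _ < γ ^ 2 * c * n := by gcongr
          _ = γ ^ 2 * (c * n) := by ring
          _ ≤ γ ^ 2 * m0 := by gcongr)
      (by
        have : 2 * (h : ℝ) ≤ m0 := by
          calc 2 * (h : ℝ) ≤ 4 * α * n := by linarith
            _ ≤ c * n := by gcongr
            _ ≤ m0 := hm0l
        exact_mod_cast this)
      w hw
    refine ⟨A, m, a1, ?_, a3⟩
    have : ((R ^ J * m0 : ℕ) : ℝ) ≤ n := hs0.trans (by nlinarith)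
    exact a2.trans (by exact_mod_cast this)
  obtain ⟨N', hN', A, m, hAc, hAG, hΦ, hup, hor⟩ := mw hn0 E m0 R σ η D hσ1 hη
    (by rw [hηdef]; linarith) hD.le (by omega) hstep N
  set Ssum := ∑ t, (R * m t : ℝ) with hSum
  have hlow : D * n ≤ Ssum := by
    rcases hor with h1 | h1
    · exact h1
    · refine le_trans ?_ h1
      calc D * n ≤ N * c * n := by gcongr
        _ = N * (c * n) := by ring
        _ ≤ N * m0 := by gcongr
  have hSump : 0 < Ssum := lt_of_lt_of_le (by positivity) hlow
  have hσp : 0 < 1 - σ := by linarith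
  obtain ⟨D', hD'def⟩ : ∃ D' : ℝ, D' = (1 + η) / ((1 - σ) * n) * Ssum := ⟨_, rfl⟩
  have hD'p : 0 < D' := by rw [hD'def]; positivity
  obtain ⟨M, cyc, hcE, hcI, hM⟩ := assemble E R N' A m η D' hη hD'p hAc hAG (by
    refine hΦ.trans (le_of_eq ?_)
    rw [hD'def]
    congr 2
    ring)
  refine ⟨M, cyc, hcE, hcI, ?_⟩
  have q1 : (1 - z / 4) * n ≤ Ssum / D' := by
    have e1 : Ssum / D' = (1 - σ) * n / (1 + η) := by
      rw [hD'def]; field_simp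
    rw [e1, le_div_iff₀ (by positivity)]
    have e2 : (1 - z / 4) * (1 + η) ≤ 1 - σ := by
      rw [hηdef]
      have := sq_nonneg z
      linarith
    have e3 := mul_le_mul_of_nonneg_right e2 hnp.le
    linarith
  have q2 : k * n / (η * D') ≤ z / 8 * n := by
    have hDD : D ≤ D' := by
      have e3 : D ≤ Ssum / n := by rw [le_div_iff₀ hnp]; exact hlow
      refine e3.trans ?_
      rw [hD'def, div_mul_eq_mul_div, div_le_div_iff₀ hnp (by positivity)]
      have : Ssum * n * (1 - σ) ≤ Ssum * n * (1 + η) := by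
        apply mul_le_mul_of_nonneg_left _ (by positivity)
        linarith
      nlinarith
    rw [div_le_iff₀ (by positivity)]
    calc (k : ℝ) * n = η * D * (z / 8) * n := by rw [← hDk]
      _ ≤ η * D' * (z / 8) * n := by gcongr
      _ = _ := by ring
  have q3 : (N' * 2 ^ N' : ℝ) ≤ z / 8 * n := by
    refine le_trans ?_ hnN
    have : (N' : ℝ) ≤ N := by exact_mod_cast hN'
    have : (2 : ℝ) ^ N' ≤ 2 ^ N := pow_le_pow_right₀ (by norm_num) hN'
    gcongr
  have q4 : ∑ t, (m t : ℝ) ≤ z / 8 * n := by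
    have e : Ssum = R * ∑ t, (m t : ℝ) := by rw [hSum, Finset.mul_sum]
    have : R * ∑ t, (m t : ℝ) ≤ R * (z / 8 * n) := by
      rw [← e]
      refine hup.trans ?_
      calc (D + 1) * n ≤ (R * (z / 8)) * n := by gcongr
        _ = _ := by ring
    exact le_of_mul_le_mul_left this hRp
  have q5 : (1 - z) * n ≤ M := by
    have : 0 < z * n := by positivity
    linarith
  calc (k * n : ℝ) - k * M ≤ k * n - k * ((1 - z) * n) := by gcongr
    _ = k * z * n := by ring
    _ ≤ ζ * n := by gcongr
end
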